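/- Let T_d denote the number of proper 3-colourings of the Hamming cube Q_d. There exist constants c > 0 and d₀ such that for all integers d ≥ d₀, | T_d − 6e·2^{2^{d−1}} | ≤ e^{−cd}·2^{2^{d−1}}. -/

import Mathlib

/-- Two vertices of the Hamming cube `{0,1}^d` are adjacent iff they differ in
exactly one coordinate. -/
def cubeAdj (d : ℕ) (u v : Fin d → Bool) : Prop :=
  (Finset.univ.filter fun i => u i ≠ v i).card = 1

/-- Proper 3-colourings of the Hamming cube `Q_d`. -/
def Col3 (d : ℕ) : Set ((Fin d → Bool) → Fin 3) :=
  {χ | ∀ u v, cubeAdj d u v → χ u ≠ χ v}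

open Finset

namespace HammingCube

/-! ### The cube: coordinate flips, parity, colourings -/

section Basics

variable {d : ℕ}

/-- Flip the `i`-th coordinate of `x`. -/
def flipAt (i : Fin d) (x : Fin d → Bool) : Fin d → Bool := Function.update x i (!x i)

lemma flipAt_same (i : Fin d) (x : Fin d → Bool) : flipAt i x i = !x i := by
  simp [flipAt]

lemma flipAt_of_ne {i j : Fin d} (h : j ≠ i) (x : Fin d → Bool) : flipAt i x j = x j := by
  simp [flipAt, h]

lemma flipAt_apply (i j : Fin d) (x : Fin d → Bool) :
    flipAt i x j = if j = i then !x j else x j := by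
  by_cases h : j = i
  · subst h; simp [flipAt]
  · simp [flipAt, h]

@[simp] lemma flipAt_flipAt (i : Fin d) (x : Fin d → Bool) : flipAt i (flipAt i x) = x := by
  funext j
  by_cases h : j = i <;> simp [flipAt_apply, h]

lemma flipAt_comm (i j : Fin d) (x : Fin d → Bool) :
    flipAt i (flipAt j x) = flipAt j (flipAt i x) := by
  funext k
  simp only [flipAt_apply]
  split_ifs <;> rfl

lemma flipAt_injective (i : Fin d) : Function.Injective (flipAt i) :=
  fun x y h => by rw [← flipAt_flipAt i x, h, flipAt_flipAt]

lemma flipAt_left_injective (x : Fin d → Bool) : Function.Injective fun i => flipAt i x := by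
  intro i j h
  by_contra hij
  have := congrFun h i
  simp only [flipAt_same, flipAt_of_ne hij] at this
  cases hx : x i <;> simp [hx] at this

lemma cubeAdj_iff (u v : Fin d → Bool) : cubeAdj d u v ↔ ∃ i, v = flipAt i u := by
  unfold cubeAdj
  rw [Finset.card_eq_one]
  constructor
  · rintro ⟨i, hi⟩
    refine ⟨i, funext fun j => ?_⟩
    have hj : j ∈ (univ.filter fun i => u i ≠ v i) ↔ j ∈ ({i} : Finset (Fin d)) := by rw [hi]
    simp only [mem_filter, mem_univ, true_and, mem_singleton] at hj
    rw [flipAt_apply]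
    split_ifs with h
    · have := hj.2 h
      cases hu : u j <;> cases hv : v j <;> simp_all
    · by_contra h'
      exact h (hj.1 fun h'' => h' h''.symm)
  · rintro ⟨i, rfl⟩
    refine ⟨i, ?_⟩
    ext j
    simp only [mem_filter, mem_univ, true_and, mem_singleton, flipAt_apply]
    split_ifs with h <;> simp [h]

/-- The parity of the number of `true` coordinates. -/
def parity (x : Fin d → Bool) : Bool := decide (Odd (univ.filter fun i => x i = true).card)

@[simp] lemma parity_flipAt (i : Fin d) (x : Fin d → Bool) :
    parity (flipAt i x) = !parity x := by
  have key : ∀ y : Fin d → Bool, y i = false →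
      (univ.filter fun j => flipAt i y j = true).card
        = (univ.filter fun j => y j = true).card + 1 := by
    intro y hy
    have : (univ.filter fun j => flipAt i y j = true)
        = insert i (univ.filter fun j => y j = true) := by
      ext j
      by_cases h : j = i
      · subst h; simp [flipAt_same, hy]
      · simp [flipAt_of_ne h, h]
    rw [this, card_insert_of_notMem (by simp [hy])]
  unfold parity
  cases hx : x i
  · simp only [key x hx, Nat.odd_add_one, decide_not]
  · have := key (flipAt i x) (by simp [flipAt_same, hx])
    rw [flipAt_flipAt] at this
    simp only [this, Nat.odd_add_one, decide_not, Bool.not_not]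

/-- The vertices of parity `p`. -/
def parityClass (d : ℕ) (p : Bool) : Finset (Fin d → Bool) := univ.filter fun x => parity x = p

@[simp] lemma mem_parityClass {p : Bool} {x : Fin d → Bool} :
    x ∈ parityClass d p ↔ parity x = p := by simp [parityClass]

lemma card_parityClass_eq (i : Fin d) (p : Bool) :
    (parityClass d p).card = (parityClass d (!p)).card := by
  refine card_bij' (fun x _ => flipAt i x) (fun x _ => flipAt i x) ?_ ?_ ?_ ?_ <;> simp

lemma card_parityClass (hd : 1 ≤ d) (p : Bool) : (parityClass d p).card = 2 ^ (d - 1) := by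
  have h1 : (parityClass d p).card + (parityClass d (!p)).card = 2 ^ d := by
    have : (univ : Finset (Fin d → Bool)).card = 2 ^ d := by simp
    rw [← this, ← card_union_of_disjoint]
    · congr 1
      ext x
      simp only [mem_union, mem_parityClass, mem_univ, iff_true]
      cases parity x <;> cases p <;> simp
    · rw [Finset.disjoint_left]
      intro x hx hx'
      simp only [mem_parityClass] at hx hx'
      rw [hx] at hx'
      cases p <;> simp at hx'
  rw [← card_parityClass_eq ⟨0, hd⟩ p] at h1
  obtain ⟨e, rfl⟩ : ∃ e, d = e + 1 := ⟨d - 1, by omega⟩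
  simp only [Nat.add_sub_cancel]
  rw [pow_succ] at h1
  omega

/-- The neighbours of `x`. -/
def nbrs (x : Fin d → Bool) : Finset (Fin d → Bool) := univ.image fun i => flipAt i x

lemma mem_nbrs {x y : Fin d → Bool} : y ∈ nbrs x ↔ ∃ i, flipAt i x = y := by simp [nbrs]

lemma flipAt_mem_nbrs (i : Fin d) (x : Fin d → Bool) : flipAt i x ∈ nbrs x :=
  mem_nbrs.2 ⟨i, rfl⟩

lemma mem_nbrs_comm {x y : Fin d → Bool} : y ∈ nbrs x ↔ x ∈ nbrs y := by
  constructor <;>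
  · intro h
    obtain ⟨i, rfl⟩ := mem_nbrs.1 h
    exact mem_nbrs.2 ⟨i, by simp⟩

lemma card_nbrs (x : Fin d → Bool) : (nbrs x).card = d := by
  rw [nbrs, card_image_of_injective _ (flipAt_left_injective x)]; simp

/-- The proper 3-colourings, as a finset. -/
def colourings (d : ℕ) : Finset ((Fin d → Bool) → Fin 3) :=
  univ.filter fun f => ∀ x i, f (flipAt i x) ≠ f x

lemma mem_colourings {f : (Fin d → Bool) → Fin 3} :
    f ∈ colourings d ↔ ∀ x i, f (flipAt i x) ≠ f x := by simp [colourings]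

lemma ncard_Col3 (d : ℕ) : (Col3 d).ncard = (colourings d).card := by
  rw [← Set.ncard_coe_finset]
  congr 1
  ext f
  simp only [Col3, Set.mem_ofPred_eq, mem_coe, mem_colourings, cubeAdj_iff]
  constructor
  · intro h x i
    exact (h x _ ⟨i, rfl⟩).symm
  · rintro h u v ⟨i, rfl⟩
    exact (h u i).symm

/-- The set of colours that `f` uses on the neighbours of `x` in the directions `J`. -/
def palette (f : (Fin d → Bool) → Fin 3) (J : Finset (Fin d)) (x : Fin d → Bool) :
    Finset (Fin 3) := J.image fun i => f (flipAt i x)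

lemma mem_palette {f : (Fin d → Bool) → Fin 3} {J : Finset (Fin d)} {x : Fin d → Bool}
    {c : Fin 3} : c ∈ palette f J x ↔ ∃ i ∈ J, f (flipAt i x) = c := by simp [palette]

lemma flipAt_mem_palette {f : (Fin d → Bool) → Fin 3} {J : Finset (Fin d)} {x : Fin d → Bool}
    {i : Fin d} (hi : i ∈ J) : f (flipAt i x) ∈ palette f J x := mem_palette.2 ⟨i, hi, rfl⟩

lemma palette_mono (f : (Fin d → Bool) → Fin 3) {J J' : Finset (Fin d)} (h : J ⊆ J')
    (x : Fin d → Bool) : palette f J x ⊆ palette f J' x := image_subset_image h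

lemma notMem_palette {f : (Fin d → Bool) → Fin 3} (hf : f ∈ colourings d) (J : Finset (Fin d))
    (x : Fin d → Bool) : f x ∉ palette f J x := by
  rw [mem_palette]
  rintro ⟨i, -, h⟩
  exact mem_colourings.1 hf x i h

lemma card_palette_le {f : (Fin d → Bool) → Fin 3} (hf : f ∈ colourings d) (J : Finset (Fin d))
    (x : Fin d → Bool) : (palette f J x).card ≤ 2 := by
  have h : palette f J x ⊆ univ.erase (f x) := fun c hc =>
    mem_erase.2 ⟨fun h => notMem_palette hf J x (h ▸ hc), mem_univ _⟩
  simpa using card_le_card h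

/-- The automorphism of the cube sending `v` to `v'` and permuting the directions by `π`. -/
def moveTo (v v' : Fin d → Bool) (π : Equiv.Perm (Fin d)) (x : Fin d → Bool) : Fin d → Bool :=
  fun i => xor (xor (x (π i)) (v (π i))) (v' i)

lemma moveTo_self (v v' : Fin d → Bool) (π : Equiv.Perm (Fin d)) : moveTo v v' π v = v' := by
  funext i; simp [moveTo]

lemma moveTo_flipAt (v v' : Fin d → Bool) (π : Equiv.Perm (Fin d)) (i : Fin d)
    (x : Fin d → Bool) : moveTo v v' π (flipAt (π i) x) = flipAt i (moveTo v v' π x) := by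
  funext j
  simp only [moveTo, flipAt_apply, EmbeddingLike.apply_eq_iff_eq]
  by_cases h : j = i
  · subst h; simp
  · simp [h]

lemma moveTo_moveTo (v v' : Fin d → Bool) (π : Equiv.Perm (Fin d)) (x : Fin d → Bool) :
    moveTo v v' π (moveTo v' v π.symm x) = x := by
  funext i
  simp only [moveTo, Equiv.symm_apply_apply]
  cases x i <;> cases v' i <;> cases v (π i) <;> rfl

lemma comp_moveTo_mem {f : (Fin d → Bool) → Fin 3} (hf : f ∈ colourings d)
    (v v' : Fin d → Bool) (π : Equiv.Perm (Fin d)) : f ∘ moveTo v v' π ∈ colourings d := by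
  rw [mem_colourings] at hf ⊢
  intro x i
  obtain ⟨j, rfl⟩ := π.surjective i
  simp only [Function.comp, moveTo_flipAt]
  exact hf _ _

/-- The uniform measure on colourings is invariant under automorphisms of the cube. -/
lemma card_filter_comp_moveTo (v v' : Fin d → Bool) (π : Equiv.Perm (Fin d))
    (Q : ((Fin d → Bool) → Fin 3) → Prop) [DecidablePred Q] :
    ((colourings d).filter fun f => Q (f ∘ moveTo v v' π)).card
      = ((colourings d).filter Q).card := by
  have hcomp : ∀ (w w' : Fin d → Bool) (ρ : Equiv.Perm (Fin d)) (f : (Fin d → Bool) → Fin 3),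
      (f ∘ moveTo w' w ρ.symm) ∘ moveTo w w' ρ = f := by
    intro w w' ρ f
    funext x
    have h := moveTo_moveTo w' w ρ.symm x
    rw [Equiv.symm_symm] at h
    simp [Function.comp, h]
  refine card_bij' (fun f _ => f ∘ moveTo v v' π) (fun f _ => f ∘ moveTo v' v π.symm) ?_ ?_ ?_ ?_
  · intro f hf
    rw [mem_filter] at hf ⊢
    exact ⟨comp_moveTo_mem hf.1 _ _ _, hf.2⟩
  · intro f hf
    rw [mem_filter] at hf ⊢
    refine ⟨comp_moveTo_mem hf.1 _ _ _, ?_⟩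
    rw [hcomp]; exact hf.2
  · intro f _
    simpa using hcomp v' v π.symm f
  · intro f _
    exact hcomp v v' π f

lemma palette_comp_moveTo (f : (Fin d → Bool) → Fin 3) (v v' : Fin d → Bool)
    (π : Equiv.Perm (Fin d)) (J : Finset (Fin d)) (x : Fin d → Bool) :
    palette (f ∘ moveTo v v' π) (J.map π.toEmbedding) x = palette f J (moveTo v v' π x) := by
  ext c
  simp only [mem_palette, mem_map, Function.comp]
  constructor
  · rintro ⟨_, ⟨i, hi, rfl⟩, rfl⟩
    exact ⟨i, hi, by rw [← moveTo_flipAt]; rfl⟩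
  · rintro ⟨i, hi, rfl⟩
    exact ⟨_, ⟨i, hi, rfl⟩, by rw [← moveTo_flipAt]; rfl⟩

end Basics

/-! ### Conditional entropy of a uniformly random element of a finite set of functions -/

section Entropy

variable {V κ : Type*} [DecidableEq κ]

/-- The number of members of `Ω` that agree with `f` on `S`. -/
def agree (Ω : Finset (V → κ)) (S : Finset V) (f : V → κ) : ℕ :=
  (Ω.filter fun g => ∀ x ∈ S, g x = f x).card

/-- `|Ω|` times the entropy of a uniformly random `f ∈ Ω` conditioned on `f|_S`, in bits. -/
noncomputable def condEnt (Ω : Finset (V → κ)) (S : Finset V) : ℝ :=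
  ∑ f ∈ Ω, Real.logb 2 (agree Ω S f)

variable {Ω : Finset (V → κ)}

lemma agree_pos {S : Finset V} {f : V → κ} (hf : f ∈ Ω) : 0 < agree Ω S f :=
  card_pos.2 ⟨f, mem_filter.2 ⟨hf, fun _ _ => rfl⟩⟩

lemma agree_congr {S : Finset V} {f g : V → κ} (h : ∀ x ∈ S, g x = f x) :
    agree Ω S g = agree Ω S f := by
  unfold agree
  congr 1
  refine filter_congr fun e _ => ?_
  exact ⟨fun he x hx => (he x hx).trans (h x hx), fun he x hx => (he x hx).trans (h x hx).symm⟩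

lemma condEnt_empty : condEnt Ω ∅ = Ω.card * Real.logb 2 Ω.card := by
  simp [condEnt, agree]

variable [DecidableEq V]

/-- Gibbs' inequality. -/
lemma condEnt_sub_le_of_weight (P S : Finset V) (K : (V → κ) → ℝ) (hK : ∀ f ∈ Ω, 0 < K f)
    (hsum : ∀ f ∈ Ω, ∑ g ∈ Ω with ∀ x ∈ P, g x = f x, K g / agree Ω (P ∪ S) g ≤ 1) :
    condEnt Ω P - condEnt Ω (P ∪ S) ≤ ∑ f ∈ Ω, -Real.logb 2 (K f) := by
  set t : (V → κ) → ℝ := fun f => agree Ω P f * (K f / agree Ω (P ∪ S) f) with ht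
  have hpos : ∀ f ∈ Ω, ∀ T : Finset V, (0 : ℝ) < agree Ω T f := fun f hf T => by
    exact_mod_cast agree_pos hf
  have htpos : ∀ f ∈ Ω, 0 < t f := fun f hf =>
    mul_pos (hpos f hf _) (div_pos (hK f hf) (hpos f hf _))
  have hsumt : ∑ f ∈ Ω, t f ≤ Ω.card := by
    have h1 : ∑ f ∈ Ω, t f = ∑ f ∈ Ω, ∑ g ∈ Ω with ∀ x ∈ P, g x = f x,
        K g / agree Ω (P ∪ S) g := by
      have h2 : ∀ f ∈ Ω, t f = ∑ g ∈ Ω with ∀ x ∈ P, g x = f x, K f / agree Ω (P ∪ S) f := by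
        intro f _
        rw [sum_const, nsmul_eq_mul]
        rfl
      rw [sum_congr rfl h2]
      simp only [sum_filter]
      rw [sum_comm]
      refine sum_congr rfl fun f _ => sum_congr rfl fun g _ => ?_
      refine if_congr ?_ rfl rfl
      exact ⟨fun h x hx => (h x hx).symm, fun h x hx => (h x hx).symm⟩
    rw [h1]
    simpa using sum_le_sum hsum
  have hlog : ∑ f ∈ Ω, Real.log (t f) ≤ 0 := by
    have : ∑ f ∈ Ω, Real.log (t f) ≤ ∑ f ∈ Ω, (t f - 1) :=
      sum_le_sum fun f hf => Real.log_le_sub_one_of_pos (htpos f hf)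
    rw [sum_sub_distrib] at this
    simp only [sum_const, nsmul_eq_mul, mul_one] at this
    linarith
  have hlogb : ∑ f ∈ Ω, Real.logb 2 (t f) ≤ 0 := by
    simp only [Real.logb, ← sum_div]
    exact div_nonpos_of_nonpos_of_nonneg hlog (Real.log_nonneg one_le_two)
  have hexp : ∑ f ∈ Ω, Real.logb 2 (t f)
      = condEnt Ω P - condEnt Ω (P ∪ S) + ∑ f ∈ Ω, Real.logb 2 (K f) := by
    unfold condEnt
    rw [← sum_sub_distrib, ← sum_add_distrib]
    refine sum_congr rfl fun f hf => ?_
    rw [ht, Real.logb_mul (hpos f hf _).ne' (div_pos (hK f hf) (hpos f hf _)).ne',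
      Real.logb_div (hK f hf).ne' (hpos f hf _).ne']
    ring
  rw [sum_neg_distrib]
  linarith

/-- Gibbs' inequality for a transition kernel from `f|_P` to the values of `f` along `u`. -/
lemma condEnt_sub_le_of_kernel {ι : Type*} [Fintype ι] [DecidableEq ι] [Fintype κ]
    (P : Finset V) (u : ι → V) (ker : (V → κ) → (ι → κ) → ℝ)
    (hker : ∀ f g, (∀ x ∈ P, g x = f x) → ker g = ker f) (hnn : ∀ f x, 0 ≤ ker f x)
    (hsum : ∀ f ∈ Ω, ∑ x, ker f x ≤ 1) (hpos : ∀ f ∈ Ω, 0 < ker f (f ∘ u)) :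
    condEnt Ω P - condEnt Ω (P ∪ univ.image u) ≤ ∑ f ∈ Ω, -Real.logb 2 (ker f (f ∘ u)) := by
  refine condEnt_sub_le_of_weight P _ (fun f => ker f (f ∘ u)) hpos fun f hf => ?_
  refine le_trans ?_ (hsum f hf)
  rw [← sum_fiberwise (g := fun g : V → κ => g ∘ u)]
  refine sum_le_sum fun x _ => ?_
  rw [filter_filter]
  set A := Ω.filter fun g => (∀ y ∈ P, g y = f y) ∧ g ∘ u = x with hA
  have hterm : ∀ g ∈ A, ker g (g ∘ u) / (agree Ω (P ∪ univ.image u) g : ℝ)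
      = ker f x / (A.card : ℝ) := by
    intro g hg
    rw [hA, mem_filter] at hg
    rw [hker f g hg.2.1, hg.2.2]
    congr 2
    unfold agree
    congr 1
    rw [hA]
    refine filter_congr fun e _ => ?_
    constructor
    · intro h
      refine ⟨fun y hy => (h y (mem_union_left _ hy)).trans (hg.2.1 y hy), ?_⟩
      rw [← hg.2.2]
      exact funext fun i => h _ (mem_union_right _ (mem_image_of_mem _ (mem_univ i)))
    · rintro ⟨h1, h2⟩ y hy
      rcases mem_union.1 hy with hy | hy
      · exact (h1 y hy).trans (hg.2.1 y hy).symm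
      · obtain ⟨i, -, rfl⟩ := mem_image.1 hy
        exact congrFun (h2.trans hg.2.2.symm) i
  rw [sum_congr rfl hterm, sum_const, nsmul_eq_mul]
  rcases A.eq_empty_or_nonempty with h | h
  · simp [h, hnn]
  · have : (A.card : ℝ) ≠ 0 := by exact_mod_cast (card_pos.2 h).ne'
    rw [mul_div_cancel₀ _ this]

/-- Conditioning on more reduces entropy. -/
lemma condEnt_submod [Fintype κ] {R S : Finset V} (h : R ⊆ S) (u : V) :
    condEnt Ω S - condEnt Ω (insert u S) ≤ condEnt Ω R - condEnt Ω (insert u R) := by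
  have hcnt : ∀ f : V → κ, (((Ω.filter fun g => ∀ y ∈ R, g y = f y).filter
      fun g => g u = f u).card) = agree Ω (insert u R) f := by
    intro f
    unfold agree
    rw [filter_filter]
    congr 1
    refine filter_congr fun g _ => ?_
    simp [and_comm]
  have key := condEnt_sub_le_of_kernel (Ω := Ω) S (fun _ : Unit => u)
    (fun f x => (((Ω.filter fun g => ∀ y ∈ R, g y = f y).filter fun g => g u = x ()).card : ℝ)
      / agree Ω R f) ?_ ?_ ?_ ?_
  · have himg : (univ : Finset Unit).image (fun _ => u) = {u} := by ext; simp
    rw [himg, union_comm, ← insert_eq] at key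
    refine key.trans (le_of_eq ?_)
    unfold condEnt
    rw [← sum_sub_distrib]
    refine sum_congr rfl fun f hf => ?_
    simp only [Function.comp, hcnt]
    rw [Real.logb_div]
    · ring
    · exact_mod_cast (agree_pos hf).ne'
    · exact_mod_cast (agree_pos hf).ne'
  · intro f g hg
    funext x
    have h1 : agree Ω R g = agree Ω R f := agree_congr fun y hy => hg y (h hy)
    rw [h1]
    congr 4
    refine filter_congr fun e _ => ?_
    exact forall₂_congr fun y hy => by rw [hg y (h hy)]
  · intro f x
    positivity
  · intro f hf
    rw [← sum_div]
    refine div_le_one_of_le₀ ?_ (by positivity)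
    rw [← Nat.cast_sum, Nat.cast_le]
    rw [← (Equiv.funUnique Unit κ).symm.sum_comp]
    refine le_of_eq ?_
    exact (card_eq_sum_card_fiberwise (f := fun g : V → κ => g u) (t := univ)
      fun _ _ => mem_coe.2 (mem_univ _)).symm
  · intro f hf
    simp only [Function.comp, hcnt]
    exact div_pos (by exact_mod_cast agree_pos hf) (by exact_mod_cast agree_pos hf)

/-- Shearer's inequality, conditioned on the values on `P`. -/
lemma condEnt_shearer [Fintype κ] {τ : Type*} (T : Finset τ) (B : τ → Finset V) (P : Finset V)
    (k : ℕ) (U : Finset V) (hU : ∀ u ∈ U, (T.filter fun v => u ∈ B v).card = k) :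
    k * (condEnt Ω P - condEnt Ω (P ∪ U))
      ≤ ∑ v ∈ T, (condEnt Ω P - condEnt Ω (P ∪ (B v ∩ U))) := by
  induction U using Finset.induction_on with
  | empty => simp
  | insert u U hu ih =>
    have ih' := ih fun x hx => hU x (mem_insert_of_mem hx)
    have hk := hU u (mem_insert_self _ _)
    have hstep : (k : ℝ) * (condEnt Ω (P ∪ U) - condEnt Ω (P ∪ insert u U))
        ≤ ∑ v ∈ T, (condEnt Ω (P ∪ (B v ∩ U)) - condEnt Ω (P ∪ (B v ∩ insert u U))) := by
      have h1 : (k : ℝ) * (condEnt Ω (P ∪ U) - condEnt Ω (P ∪ insert u U))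
          = ∑ v ∈ T, if u ∈ B v then condEnt Ω (P ∪ U) - condEnt Ω (P ∪ insert u U) else 0 := by
        rw [← sum_filter, sum_const, hk, nsmul_eq_mul]
      rw [h1]
      refine sum_le_sum fun v _ => ?_
      split_ifs with h
      · rw [inter_insert_of_mem h, union_insert, union_insert]
        exact condEnt_submod (union_subset_union_right inter_subset_right) u
      · rw [inter_insert_of_notMem h, sub_self]
    rw [sum_sub_distrib] at ih' hstep ⊢
    linarith

end Entropy

/-! ### Counting colourings with a given property -/

section Count

variable {d : ℕ}

open Classical in
/-- The number of colourings with the property `Q`. -/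
noncomputable def count (d : ℕ) (Q : ((Fin d → Bool) → Fin 3) → Prop) : ℝ :=
  ((colourings d).filter Q).card

lemma sum_ite_eq_count (Q : ((Fin d → Bool) → Fin 3) → Prop) [DecidablePred Q] :
    ∑ f ∈ colourings d, (if Q f then (1 : ℝ) else 0) = count d Q := by
  rw [sum_boole, count]
  congr!

lemma count_eq_card (Q : ((Fin d → Bool) → Fin 3) → Prop) [DecidablePred Q] :
    count d Q = ((colourings d).filter Q).card := by
  rw [← sum_ite_eq_count, sum_boole]

lemma count_nonneg (Q : ((Fin d → Bool) → Fin 3) → Prop) : 0 ≤ count d Q := by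
  unfold count; positivity

lemma count_mono {Q R : ((Fin d → Bool) → Fin 3) → Prop}
    (h : ∀ f ∈ colourings d, Q f → R f) : count d Q ≤ count d R := by
  classical
  rw [← sum_ite_eq_count, ← sum_ite_eq_count]
  refine sum_le_sum fun f hf => ?_
  by_cases hQ : Q f
  · simp [hQ, h f hf hQ]
  · rw [if_neg hQ]; positivity

lemma count_congr {Q R : ((Fin d → Bool) → Fin 3) → Prop}
    (h : ∀ f ∈ colourings d, Q f ↔ R f) : count d Q = count d R :=
  le_antisymm (count_mono fun f hf => (h f hf).1) (count_mono fun f hf => (h f hf).2)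

lemma count_true : count d (fun _ => True) = (colourings d).card := by
  simp [count]

lemma count_or_le (Q R : ((Fin d → Bool) → Fin 3) → Prop) :
    count d (fun f => Q f ∨ R f) ≤ count d Q + count d R := by
  classical
  rw [← sum_ite_eq_count, ← sum_ite_eq_count, ← sum_ite_eq_count, ← sum_add_distrib]
  refine sum_le_sum fun f _ => ?_
  by_cases hQ : Q f <;> by_cases hR : R f <;> simp [hQ, hR]

lemma count_and_add (Q R : ((Fin d → Bool) → Fin 3) → Prop) :
    count d (fun f => Q f ∧ R f) + count d (fun f => Q f ∧ ¬ R f) = count d Q := by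
  classical
  rw [← sum_ite_eq_count, ← sum_ite_eq_count, ← sum_ite_eq_count, ← sum_add_distrib]
  refine sum_congr rfl fun f _ => ?_
  by_cases hQ : Q f <;> by_cases hR : R f <;> simp [hQ, hR]

lemma count_comp_moveTo (v v' : Fin d → Bool) (π : Equiv.Perm (Fin d))
    (Q : ((Fin d → Bool) → Fin 3) → Prop) :
    count d (fun f => Q (f ∘ moveTo v v' π)) = count d Q := by
  classical
  rw [count_eq_card, count_eq_card]
  exact_mod_cast card_filter_comp_moveTo v v' π Q

/-- The number of colourings using at least two colours on the neighbours of `v` in the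
directions `J` does not depend on `v`. -/
lemma count_palette_eq (J : Finset (Fin d)) (v v' : Fin d → Bool) :
    count d (fun f => 1 < (palette f J v').card) = count d (fun f => 1 < (palette f J v).card) := by
  rw [← count_comp_moveTo v v' 1 fun f => 1 < (palette f J v).card]
  refine count_congr fun f _ => ?_
  have h := palette_comp_moveTo f v v' 1 J v
  rw [moveTo_self] at h
  have hJ : J.map (1 : Equiv.Perm (Fin d)).toEmbedding = J := map_refl
  rw [← h, hJ]

end Count

/-! ### The local entropy estimate -/

section LocalEntropy

/-- The weight that the kernel gives to colour `c` on a neighbour of a vertex whose neighbours use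
the colours `M ∋ a`, if the common neighbour with a vertex of palette `M'` is being coloured. -/
noncomputable def colourWeight (M M' : Finset (Fin 3)) (a c : Fin 3) : ℝ :=
  if M.card ≤ 1 then (if c ∈ M then 1 else 0)
  else if M' = M then (if c ∈ M then 1 / 2 else 0)
  else if M'.card ≤ 1 then (if c = a then 3 / 4 else if c ∈ M then 1 / 4 else 0)
  else if c = a then 1 else 0

lemma colourWeight_nonneg (M M' : Finset (Fin 3)) (a c : Fin 3) : 0 ≤ colourWeight M M' a c := by
  unfold colourWeight
  split_ifs <;> norm_num

lemma sum_colourWeight_le {M : Finset (Fin 3)} (M' : Finset (Fin 3)) {a : Fin 3} (ha : a ∈ M)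
    (hM : M.card ≤ 2) : ∑ c, colourWeight M M' a c ≤ 1 := by
  have hM' : (M.card : ℝ) ≤ 2 := by exact_mod_cast hM
  unfold colourWeight
  split_ifs with h1 h2 h3
  · rw [sum_boole, filter_mem_eq_inter, univ_inter]; exact_mod_cast h1
  · rw [← sum_filter, filter_mem_eq_inter, univ_inter, sum_const, nsmul_eq_mul]; linarith
  · have : ∀ c : Fin 3, (if c = a then (3 / 4 : ℝ) else if c ∈ M then 1 / 4 else 0)
        = (if c = a then 1 / 2 else 0) + (if c ∈ M then 1 / 4 else 0) := by
      intro c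
      by_cases hc : c = a
      · subst hc; simp [ha]; norm_num
      · simp [hc]
    rw [sum_congr rfl fun c _ => this c, sum_add_distrib, ← sum_filter (fun c => c ∈ M),
      filter_mem_eq_inter, univ_inter, sum_const, nsmul_eq_mul]
    simp only [sum_ite_eq', mem_univ, if_true]
    linarith
  · simp

lemma colourWeight_spec {M M' : Finset (Fin 3)} {a c : Fin 3} (hc : c ∈ M)
    (h : 1 < M.card → M' ≠ M → 1 < M'.card → c = a) :
    0 < colourWeight M M' a c ∧ -Real.logb 2 (colourWeight M M' a c) ≤
      (if 1 < M.card then 1 else 0) - (if 1 < M.card ∧ M' ≠ M then 1 else 0) / 2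
        + 3 / 2 * (if M'.card ≤ 1 ∧ c ≠ a then 1 else 0) := by
  have hhalf : Real.logb 2 (1 / 2) = -1 := by
    rw [one_div, Real.logb_inv, Real.logb_self_eq_one one_lt_two]
  have hquarter : Real.logb 2 (1 / 4) = -2 := by
    rw [show (1 / 4 : ℝ) = (1 / 2) * (1 / 2) by norm_num, Real.logb_mul (by norm_num) (by norm_num),
      hhalf]; norm_num
  have hthree : -(1 / 2) ≤ Real.logb 2 (3 / 4) := by
    have h2 : Real.logb 2 ((1 / 2 : ℝ)) ≤ Real.logb 2 ((3 / 4) * (3 / 4)) :=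
      Real.logb_le_logb_of_le one_lt_two (by norm_num) (by norm_num)
    rw [Real.logb_mul (by norm_num) (by norm_num), hhalf] at h2
    linarith
  unfold colourWeight
  by_cases h1 : M.card ≤ 1
  · have h1' : ¬ 1 < M.card := by omega
    simp only [h1, hc, h1', if_true, if_false, false_and]
    refine ⟨one_pos, ?_⟩
    rw [Real.logb_one]
    split_ifs <;> norm_num
  have h1' : 1 < M.card := by omega
  by_cases h2 : M' = M
  · subst h2
    simp only [h1, hc, h1', if_true, if_false, ne_eq, not_true_eq_false, and_false, false_and]
    refine ⟨by norm_num, ?_⟩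
    rw [hhalf]; norm_num
  by_cases h3 : M'.card ≤ 1
  · by_cases h4 : c = a
    · simp only [h1, h2, h3, h4, h1', if_true, if_false, ne_eq, not_true_eq_false, not_false_iff,
        and_false, and_true]
      refine ⟨by norm_num, ?_⟩
      linarith
    · simp only [h1, h2, h3, h4, h1', hc, if_true, if_false, ne_eq, not_false_iff, and_true]
      refine ⟨by norm_num, ?_⟩
      rw [hquarter]; norm_num
  · have h4 := h h1' h2 (by omega)
    simp only [h1, h2, h3, h4, h1', if_true, if_false, ne_eq, not_true_eq_false, not_false_iff,
      and_false, and_true]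
    refine ⟨one_pos, ?_⟩
    rw [Real.logb_one]; norm_num

/-- The guess for the colours `x` of the remaining neighbours of a vertex, one of whose neighbours
has colour `a`, from the palettes `M'` of nearby vertices. -/
noncomputable def guess {ι : Type*} [Fintype ι] [DecidableEq ι] (r : ℝ) (i₀ : ι) (a : Fin 3)
    (M' : ι → Finset (Fin 3)) (x : ι → Fin 3) : ℝ :=
  if ∃ i c, c ≠ a ∧ x = Function.update (fun _ => a) i c then r / (2 * Fintype.card ι)
  else if (insert a (univ.image x)).card ≤ 2 then
    (if insert a (univ.image x) = M' i₀ then 1 - 3 * r else r)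
      * ∏ i, colourWeight (insert a (univ.image x)) (M' i) a (x i)
  else 0

variable {ι : Type*} [Fintype ι] [DecidableEq ι]

lemma guess_nonneg {r : ℝ} (hr : 0 ≤ r) (hr' : 4 * r ≤ 1) (i₀ : ι) (a : Fin 3)
    (M' : ι → Finset (Fin 3)) (x : ι → Fin 3) : 0 ≤ guess r i₀ a M' x := by
  unfold guess
  split_ifs
  · positivity
  · exact mul_nonneg (by linarith) (prod_nonneg fun i _ => colourWeight_nonneg _ _ _ _)
  · exact mul_nonneg hr (prod_nonneg fun i _ => colourWeight_nonneg _ _ _ _)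
  · rfl

lemma sum_guess_le {r : ℝ} (hr : 0 ≤ r) (hr' : 4 * r ≤ 1) (i₀ : ι) (a : Fin 3)
    (M' : ι → Finset (Fin 3)) : ∑ x, guess r i₀ a M' x ≤ 1 := by
  have hcard : 0 < Fintype.card ι := Fintype.card_pos_iff.2 ⟨i₀⟩
  set D : Finset (ι → Fin 3) :=
    univ.filter fun x => ∃ i c, c ≠ a ∧ x = Function.update (fun _ => a) i c with hD
  set S : Finset (Finset (Fin 3)) := univ.filter fun M => a ∈ M ∧ M.card ≤ 2 with hS
  set om : Finset (Fin 3) → ℝ := fun M => if M = M' i₀ then 1 - 3 * r else r with hom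
  have homnn : ∀ M, 0 ≤ om M := fun M => by
    simp only [hom]; split_ifs <;> linarith
  have hDcard : D.card ≤ 2 * Fintype.card ι := by
    have hsub : D ⊆ ((univ : Finset ι) ×ˢ (univ.erase a)).image
        fun p => Function.update (fun _ => a) p.1 p.2 := by
      intro x hx
      obtain ⟨i, c, hc, rfl⟩ := (mem_filter.1 hx).2
      exact mem_image.2 ⟨(i, c), by simp [hc], rfl⟩
    refine (card_le_card hsub).trans (card_image_le.trans ?_)
    rw [card_product, card_erase_of_mem (mem_univ _)]
    simp [mul_comm]
  have hScard : S.card ≤ 3 := by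
    have : ∀ b : Fin 3, (univ.filter fun M : Finset (Fin 3) => b ∈ M ∧ M.card ≤ 2).card ≤ 3 := by
      decide
    exact this a
  have hpt : ∀ x, guess r i₀ a M' x ≤ (if x ∈ D then r / (2 * Fintype.card ι) else 0)
      + ∑ M ∈ S, om M * ∏ i, colourWeight M (M' i) a (x i) := by
    intro x
    have hnn : ∀ M ∈ S, 0 ≤ om M * ∏ i, colourWeight M (M' i) a (x i) := fun M _ =>
      mul_nonneg (homnn M) (prod_nonneg fun i _ => colourWeight_nonneg _ _ _ _)
    unfold guess
    by_cases h1 : ∃ i c, c ≠ a ∧ x = Function.update (fun _ => a) i c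
    · have h1' : x ∈ D := mem_filter.2 ⟨mem_univ _, h1⟩
      rw [if_pos h1, if_pos h1']
      exact le_add_of_nonneg_right (sum_nonneg hnn)
    · have h1' : x ∉ D := fun h => h1 (mem_filter.1 h).2
      rw [if_neg h1, if_neg h1', zero_add]
      split_ifs with h2 h3
      · refine le_trans (le_of_eq ?_) (single_le_sum hnn
          (mem_filter.2 ⟨mem_univ _, mem_insert_self _ _, h2⟩))
        rw [hom]; simp only [if_pos h3]
      · refine le_trans (le_of_eq ?_) (single_le_sum hnn
          (mem_filter.2 ⟨mem_univ _, mem_insert_self _ _, h2⟩))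
        rw [hom]; simp only [if_neg h3]
      · exact sum_nonneg hnn
  have hprod : ∀ M ∈ S, ∑ x : ι → Fin 3, om M * ∏ i, colourWeight M (M' i) a (x i) ≤ om M := by
    intro M hM
    rw [← mul_sum, ← Fintype.prod_sum fun i c => colourWeight M (M' i) a c]
    refine mul_le_of_le_one_right (homnn M) (prod_le_one ?_ ?_)
    · exact fun i _ => sum_nonneg fun c _ => colourWeight_nonneg _ _ _ _
    · exact fun i _ => sum_colourWeight_le _ (mem_filter.1 hM).2.1 (mem_filter.1 hM).2.2
  have homsum : ∑ M ∈ S, om M ≤ 1 - r := by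
    have h1 : ∀ M ∈ S, om M ≤ r + if M = M' i₀ then 1 - 4 * r else 0 := by
      intro M _
      simp only [hom]; split_ifs <;> linarith
    refine (sum_le_sum h1).trans ?_
    rw [sum_add_distrib, sum_const, nsmul_eq_mul, sum_ite_eq']
    have h3 : (S.card : ℝ) * r ≤ 3 * r := by
      refine mul_le_mul_of_nonneg_right ?_ hr
      exact_mod_cast hScard
    split_ifs <;> linarith
  have hDsum : ∑ x : ι → Fin 3, (if x ∈ D then r / (2 * Fintype.card ι) else 0) ≤ r := by
    rw [← sum_filter, filter_mem_eq_inter, univ_inter, sum_const, nsmul_eq_mul]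
    have h2 : (D.card : ℝ) ≤ 2 * Fintype.card ι := by exact_mod_cast hDcard
    have h3 : (0 : ℝ) < 2 * Fintype.card ι := by positivity
    calc (D.card : ℝ) * (r / (2 * Fintype.card ι))
        ≤ 2 * Fintype.card ι * (r / (2 * Fintype.card ι)) :=
          mul_le_mul_of_nonneg_right h2 (by positivity)
      _ = r := mul_div_cancel₀ _ h3.ne'
  calc ∑ x, guess r i₀ a M' x
      ≤ ∑ x : ι → Fin 3, ((if x ∈ D then r / (2 * Fintype.card ι) else 0)
          + ∑ M ∈ S, om M * ∏ i, colourWeight M (M' i) a (x i)) := sum_le_sum fun x _ => hpt x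
    _ = ∑ x : ι → Fin 3, (if x ∈ D then r / (2 * Fintype.card ι) else 0)
          + ∑ M ∈ S, ∑ x : ι → Fin 3, om M * ∏ i, colourWeight M (M' i) a (x i) := by
        rw [sum_add_distrib, sum_comm (s := univ) (t := S)]
    _ ≤ r + ∑ M ∈ S, om M := add_le_add hDsum (sum_le_sum hprod)
    _ ≤ 1 := by linarith

lemma sixteen_mul_lt_two_pow {q : ℕ} (hq : 8 ≤ q) : 16 * (q + 1) ≤ 2 ^ q := by
  induction q, hq using Nat.le_induction with
  | base => norm_num
  | succ q hq ih => rw [pow_succ]; omega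

lemma logb_two_mul_le {n : ℕ} (hn : 64 ≤ n) : Real.logb 2 (2 * n) ≤ n / 8 := by
  have h1 : 2 * n ≤ 2 ^ (n / 8) := by
    have := sixteen_mul_lt_two_pow (q := n / 8) (by omega)
    omega
  have h2 : Real.logb 2 (2 * n) ≤ (n / 8 : ℕ) := by
    rw [Real.logb_le_iff_le_rpow one_lt_two (by positivity), Real.rpow_natCast]
    exact_mod_cast h1
  exact h2.trans (Nat.cast_div_le (α := ℝ))

/-- The number of bits charged by `guess`. The three indicators refer to the palette `M` of the
vertex being completed. -/
lemma guess_spec (hn : 64 ≤ Fintype.card ι) (i₀ : ι) (a : Fin 3)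
    (M' : ι → Finset (Fin 3)) (x : ι → Fin 3) (M : Finset (Fin 3))
    (hM : M = insert a (univ.image x)) (hM2 : M.card ≤ 2)
    (h : ∀ i, 1 < M.card → M' i ≠ M → 1 < (M' i).card → x i = a) :
    0 < guess ((1 / 2) ^ (Fintype.card ι / 8)) i₀ a M' x ∧
    -Real.logb 2 (guess ((1 / 2) ^ (Fintype.card ι / 8)) i₀ a M' x) ≤
      Fintype.card ι * (if 1 < M.card then 1 else 0)
      + 12 * (1 / 2) ^ (Fintype.card ι / 8)
      + Fintype.card ι / 8 * (if M ≠ M' i₀ then 1 else 0)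
      - 1 / 2 * ∑ i, (if 1 < M.card ∧ M' i ≠ M then 1 else 0)
      + 3 / 2 * ∑ i, (if (M' i).card ≤ 1 ∧ x i ≠ a then 1 else 0)
      - Fintype.card ι / 4 *
        (if ∃ i c, c ≠ a ∧ x = Function.update (fun _ => a) i c then 1 else 0) := by
  set n := Fintype.card ι with hn'
  set q := n / 8 with hq
  set r : ℝ := (1 / 2) ^ q with hr
  have hr0 : 0 < r := by positivity
  have hr1 : r ≤ 1 / 256 := by
    have : r ≤ (1 / 2) ^ 8 := pow_le_pow_of_le_one (by norm_num) (by norm_num) (by omega)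
    norm_num at this ⊢
    exact this
  have hqn : (q : ℝ) ≤ n / 8 := Nat.cast_div_le (α := ℝ)
  have hn0 : (64 : ℝ) ≤ n := by exact_mod_cast hn
  have hlogr : Real.logb 2 r = -q := by
    rw [hr, one_div, inv_pow, Real.logb_inv, Real.logb_pow, Real.logb_self_eq_one one_lt_two,
      mul_one]
  have hlog13 : -Real.logb 2 (1 - 3 * r) ≤ 12 * r := by
    have hp : 0 < 1 - 3 * r := by linarith
    have h1 : Real.log ((1 - 3 * r)⁻¹) ≤ (1 - 3 * r)⁻¹ - 1 :=
      Real.log_le_sub_one_of_pos (inv_pos.2 hp)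
    rw [Real.log_inv] at h1
    have h2 : (1 - 3 * r)⁻¹ - 1 ≤ 6 * r := by
      rw [sub_le_iff_le_add, inv_le_iff_one_le_mul₀ hp]
      nlinarith
    have h3 : (1 / 2 : ℝ) < Real.log 2 := by linarith [Real.log_two_gt_d9]
    rw [Real.logb, ← neg_div, div_le_iff₀ (by linarith)]
    nlinarith
  have hXle : ∑ i, (if 1 < M.card ∧ M' i ≠ M then (1 : ℝ) else 0) ≤ n := by
    refine (sum_le_sum (g := fun _ => (1 : ℝ)) fun i _ => ?_).trans (by simp [hn'])
    split_ifs <;> norm_num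
  have hVnn : 0 ≤ ∑ i, (if (M' i).card ≤ 1 ∧ x i ≠ a then (1 : ℝ) else 0) :=
    sum_nonneg fun i _ => by split_ifs <;> norm_num
  have hYnn : (0 : ℝ) ≤ n / 8 * (if M ≠ M' i₀ then 1 else 0) := by positivity
  unfold guess
  by_cases hU : ∃ i c, c ≠ a ∧ x = Function.update (fun _ => a) i c
  · simp only [if_pos hU]
    have hpos : 0 < r / (2 * n) := by positivity
    refine ⟨hpos, ?_⟩
    have hMnc : 1 < M.card := by
      obtain ⟨i, c, hc, rfl⟩ := hU
      rw [one_lt_card]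
      refine ⟨a, by simp [hM], c, ?_, hc.symm⟩
      rw [hM]
      exact mem_insert_of_mem (mem_image.2 ⟨i, mem_univ _, by simp⟩)
    rw [if_pos hMnc, Real.logb_div hr0.ne' (by positivity), hlogr]
    have := logb_two_mul_le hn
    linarith
  · simp only [if_neg hU]
    rw [← hM, if_pos hM2]
    have hspec : ∀ i, _ := fun i => colourWeight_spec (M := M) (M' := M' i) (a := a) (c := x i)
      (by rw [hM]; exact mem_insert_of_mem (mem_image_of_mem _ (mem_univ i))) (h i)
    have hprodpos : 0 < ∏ i, colourWeight M (M' i) a (x i) := prod_pos fun i _ => (hspec i).1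
    have hbits : -Real.logb 2 (∏ i, colourWeight M (M' i) a (x i)) ≤
        n * (if 1 < M.card then 1 else 0)
        - 1 / 2 * ∑ i, (if 1 < M.card ∧ M' i ≠ M then (1 : ℝ) else 0)
        + 3 / 2 * ∑ i, (if (M' i).card ≤ 1 ∧ x i ≠ a then (1 : ℝ) else 0) := by
      rw [Real.logb_prod _ _ fun i _ => (hspec i).1.ne', ← sum_neg_distrib]
      refine (sum_le_sum fun i _ => (hspec i).2).trans (le_of_eq ?_)
      rw [sum_add_distrib, sum_sub_distrib, ← mul_sum, ← sum_div, sum_const, nsmul_eq_mul]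
      simp only [card_univ, ← hn']
      ring
    have hom : 0 < (if M = M' i₀ then 1 - 3 * r else r) := by
      split_ifs <;> linarith
    refine ⟨mul_pos hom hprodpos, ?_⟩
    rw [Real.logb_mul hom.ne' hprodpos.ne']
    have homb : -Real.logb 2 (if M = M' i₀ then 1 - 3 * r else r)
        ≤ 12 * r + n / 8 * (if M ≠ M' i₀ then 1 else 0) := by
      by_cases hMM : M = M' i₀
      · rw [if_pos hMM, if_neg (not_not.2 hMM)]
        linarith
      · rw [if_neg hMM, if_pos hMM, hlogr]
        linarith
    linarith

end LocalEntropy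

section LocalCube

variable {d : ℕ}

/-- Among the neighbours of `v` in the directions `J`, all have the same colour except for the one
in direction `i`. -/
def Deviates (f : (Fin d → Bool) → Fin 3) (J : Finset (Fin d)) (i : Fin d) (v : Fin d → Bool) :
    Prop :=
  ∃ c, f (flipAt i v) ≠ c ∧ ∀ j ∈ J, j ≠ i → f (flipAt j v) = c

lemma count_deviates_eq {J : Finset (Fin d)} {i k : Fin d} (hi : i ∈ J) (hk : k ∈ J)
    (v v' : Fin d → Bool) :
    count d (fun f => Deviates f J k v') = count d (fun f => Deviates f J i v) := by
  rw [← count_comp_moveTo v v' (Equiv.swap i k) fun f => Deviates f J i v]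
  refine count_congr fun f _ => ?_
  have hmove : ∀ j, (f ∘ moveTo v v' (Equiv.swap i k)) (flipAt j v)
      = f (flipAt (Equiv.swap i k j) v') := by
    intro j
    have h := moveTo_flipAt v v' (Equiv.swap i k) (Equiv.swap i k j) v
    rw [Equiv.swap_apply_self, moveTo_self] at h
    simp only [Function.comp, h]
  have hmem : ∀ j ∈ J, Equiv.swap i k j ∈ J := by
    intro j hj
    rw [Equiv.swap_apply_def]
    split_ifs <;> assumption
  unfold Deviates
  simp only [hmove, Equiv.swap_apply_left]
  refine exists_congr fun c => and_congr_right fun _ => ?_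
  constructor
  · intro h j hj hji
    refine h _ (hmem j hj) fun h' => hji ?_
    simpa using congrArg (Equiv.swap i k) h'
  · intro h j hj hjk
    have := h _ (hmem j hj) fun h' => hjk (by
      simpa using congrArg (Equiv.swap i k) h')
    simpa using this

/-- The bound on the entropy of the colours around `v` given the colours on the lower half. -/
lemma condEnt_star_le {J : Finset (Fin d)} {k : Fin d} (hk : k ∉ J) (hJ : 64 ≤ J.card)
    (v : Fin d → Bool) (P : Finset (Fin d → Bool)) (hP : flipAt k v ∈ P)
    (hP' : ∀ i ∈ J, ∀ j ∈ J, flipAt j (flipAt i (flipAt k v)) ∈ P) :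
    condEnt (colourings d) P
        - condEnt (colourings d) (P ∪ (insert k J).image fun i => flipAt i v) ≤
      J.card * count d (fun f => 1 < (palette f (insert k J) v).card)
      + 12 * (1 / 2) ^ (J.card / 8) * (colourings d).card
      - 1 / 8 * ∑ i ∈ J, count d (fun f => palette f (insert k J) v ≠
          palette f (insert k J) (flipAt i (flipAt k v))) := by
  classical
  set n := J.card with hn
  set M : ((Fin d → Bool) → Fin 3) → Finset (Fin 3) := fun f => palette f (insert k J) v with hM
  set M' : Fin d → ((Fin d → Bool) → Fin 3) → Finset (Fin 3) :=
    fun i f => palette f J (flipAt i (flipAt k v)) with hM'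
  set X : Fin d → ℝ := fun i => count d fun f => 1 < (M f).card ∧ M' i f ≠ M f with hX
  set Y : Fin d → ℝ := fun i => count d fun f => M f ≠ M' i f with hY
  set W : Fin d → ℝ := fun i => count d fun f =>
    (M' i f).card ≤ 1 ∧ f (flipAt i v) ≠ f (flipAt k v) with hW
  set U : ℝ := count d fun f => ∃ i ∈ J, Deviates f (insert k J) i v with hU
  have hJne : J.Nonempty := card_pos.1 (by omega)
  have hZ : ∑ i ∈ J, count d (fun f => palette f (insert k J) v ≠
      palette f (insert k J) (flipAt i (flipAt k v))) ≤ ∑ i ∈ J, (Y i + W i) := by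
    refine sum_le_sum fun i hi => le_trans (count_mono fun f hf h => ?_) (count_or_le _ _)
    by_cases hMM : M f = M' i f
    · refine Or.inr ?_
      have ha : f (flipAt k v) ∈ M' i f := mem_palette.2 ⟨i, hi, by rw [flipAt_flipAt]⟩
      have hins : palette f (insert k J) (flipAt i (flipAt k v))
          = insert (f (flipAt i v)) (M' i f) := by
        rw [palette, image_insert, flipAt_comm k i (flipAt k v), flipAt_flipAt]
        rfl
      have hnot : f (flipAt i v) ∉ M' i f := fun h' => by
        rw [insert_eq_of_mem h'] at hins
        exact h (hMM.trans hins.symm)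
      have h2 := card_palette_le hf (insert k J) (flipAt i (flipAt k v))
      rw [hins, card_insert_of_notMem hnot] at h2
      exact ⟨by omega, fun h' => hnot (h' ▸ ha)⟩
    · exact Or.inl hMM
  rw [sum_add_distrib] at hZ
  have hcard : Fintype.card J = n := Fintype.card_coe J
  have hn0 : (64 : ℝ) ≤ n := by exact_mod_cast hJ
  have hYX : ∀ i ∈ J, Y i ≤ 2 * X i := by
    intro i hi
    have hle : count d (fun f => 1 < (M' i f).card) ≤ count d (fun f => 1 < (M f).card) := by
      rw [hM, ← count_palette_eq (insert k J) v (flipAt i (flipAt k v))]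
      refine count_mono fun f _ h => lt_of_lt_of_le h (card_le_card ?_)
      exact palette_mono f (subset_insert _ _) _
    have h1 := count_and_add (d := d) (fun f => 1 < (M' i f).card) fun f => 1 < (M f).card
    have h2 := count_and_add (d := d) (fun f => 1 < (M f).card) fun f => 1 < (M' i f).card
    have h3 : count d (fun f => 1 < (M' i f).card ∧ 1 < (M f).card)
        = count d (fun f => 1 < (M f).card ∧ 1 < (M' i f).card) :=
      count_congr fun f _ => and_comm
    have h4 : count d (fun f => 1 < (M f).card ∧ ¬ 1 < (M' i f).card) ≤ X i := by
      refine count_mono fun f _ h => ⟨h.1, fun h' => h.2 ?_⟩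
      rw [h']; exact h.1
    have h5 : Y i ≤ count d (fun f => 1 < (M' i f).card ∧ ¬ 1 < (M f).card) + X i := by
      refine le_trans (count_mono fun f hf h => ?_) (count_or_le _ _)
      by_cases hc : 1 < (M f).card
      · exact Or.inr ⟨hc, fun h' => h h'.symm⟩
      · refine Or.inl ⟨?_, hc⟩
        by_contra hc'
        apply h
        have ha : f (flipAt k v) ∈ M f := flipAt_mem_palette (mem_insert_self _ _)
        have ha' : f (flipAt k v) ∈ M' i f := mem_palette.2 ⟨i, hi, by rw [flipAt_flipAt]⟩
        rw [eq_singleton_iff_unique_mem.2 ⟨ha, fun c hc2 => card_le_one.1 (by omega) _ hc2 _ ha⟩,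
          eq_singleton_iff_unique_mem.2 ⟨ha', fun c hc2 => card_le_one.1 (by omega) _ hc2 _ ha'⟩]
    linarith
  have hWU : ∑ i ∈ J, W i ≤ U := by
    have h1 : ∀ i ∈ J, W i ≤ count d fun f => Deviates f (insert k J) i v := by
      intro i hi
      rw [← count_deviates_eq (mem_insert_of_mem hi) (mem_insert_self k J) v
        (flipAt i (flipAt k v))]
      refine count_mono fun f _ h => ⟨f (flipAt k v), ?_, ?_⟩
      · rw [flipAt_comm k i, flipAt_flipAt]; exact h.2
      · intro j hj hjk
        exact card_le_one.1 h.1 _ (flipAt_mem_palette (mem_of_mem_insert_of_ne hj hjk)) _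
          (mem_palette.2 ⟨i, hi, by rw [flipAt_flipAt]⟩)
    refine (sum_le_sum h1).trans ?_
    rw [hU, ← sum_ite_eq_count, sum_congr rfl fun i _ => (sum_ite_eq_count
      (fun f => Deviates f (insert k J) i v)).symm, sum_comm]
    refine sum_le_sum fun f _ => ?_
    by_cases h : ∃ i ∈ J, Deviates f (insert k J) i v
    · rw [if_pos h]
      obtain ⟨i, hi, c, hc, hc'⟩ := h
      rw [sum_eq_single_of_mem i hi]
      · split_ifs <;> norm_num
      · rintro j hj hji
        rw [if_neg]
        rintro ⟨c', hcc, hcc'⟩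
        have hki : k ≠ i := fun h => hk (h ▸ hi)
        have hkj : k ≠ j := fun h => hk (h ▸ hj)
        have e1 := hc' k (mem_insert_self _ _) hki
        have e2 := hcc' k (mem_insert_self _ _) hkj
        exact hc ((hcc' i (mem_insert_of_mem hi) hji.symm).trans (e2.symm.trans e1))
    · rw [if_neg h]
      refine le_of_eq (sum_eq_zero fun i hi => if_neg fun h' => h ⟨i, hi, h'⟩)
  obtain ⟨i₀, hi₀, hmin⟩ := exists_min_image J Y hJne
  have hYmin : (n : ℝ) * Y i₀ ≤ 2 * ∑ i ∈ J, X i := by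
    rw [← nsmul_eq_mul, hn, ← sum_const, mul_sum]
    exact sum_le_sum fun i hi => (hmin i hi).trans (hYX i hi)
  have hspec : ∀ f ∈ colourings d, _ := fun f hf =>
    guess_spec (ι := J) (hcard.symm ▸ hJ) ⟨i₀, hi₀⟩ (f (flipAt k v)) (fun i => M' i f)
      (fun i => f (flipAt i v)) (M f)
      (by
        rw [hM]
        simp only [palette, image_insert]
        congr 1
        ext c
        simp only [mem_image, mem_univ, true_and, Subtype.exists, exists_prop])
      (card_palette_le hf _ _)
      (by
        rintro ⟨i, hi⟩ h1 h2 h3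
        have e1 := notMem_palette hf (insert k J) v
        have e2 := notMem_palette hf J (flipAt i (flipAt k v))
        have e3 : f (flipAt i v) ≠ f v := mem_colourings.1 hf v i
        have e4 : f (flipAt i v) ≠ f (flipAt i (flipAt k v)) := by
          have := mem_colourings.1 hf (flipAt i (flipAt k v)) k
          rwa [flipAt_comm k i, flipAt_flipAt] at this
        have e5 : f (flipAt k v) ≠ f v := mem_colourings.1 hf v k
        have e6 : f (flipAt k v) ≠ f (flipAt i (flipAt k v)) :=
          (mem_colourings.1 hf (flipAt k v) i).symm
        have e7 : M f = univ.erase (f v) := by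
          refine eq_of_subset_of_card_le (fun c hc => mem_erase.2 ⟨fun h => e1 (h ▸ hc),
            mem_univ _⟩) ?_
          rw [card_erase_of_mem (mem_univ _)]; exact h1
        have e8 : M' i f = univ.erase (f (flipAt i (flipAt k v))) := by
          refine eq_of_subset_of_card_le (fun c hc => mem_erase.2 ⟨fun h => e2 (h ▸ hc),
            mem_univ _⟩) ?_
          rw [card_erase_of_mem (mem_univ _)]; exact h3
        have e9 : f (flipAt i (flipAt k v)) ≠ f v := by
          intro h
          rw [← h] at e7
          exact h2 (e8.trans e7.symm)
        have : ∀ p q r s : Fin 3, p ≠ q → p ≠ r → s ≠ q → s ≠ r → r ≠ q → p = s := by decide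
        exact this _ _ _ _ e3 e4 e5 e6 e9)
  have key := condEnt_sub_le_of_kernel (Ω := colourings d) P (fun i : J => flipAt (i : Fin d) v)
    (fun f x => guess ((1 / 2) ^ (Fintype.card J / 8)) (⟨i₀, hi₀⟩ : J) (f (flipAt k v))
      (fun i => M' i f) x) ?_ ?_ ?_ ?_
  rotate_left
  · intro f g hg
    have hM'eq : ∀ i : J, M' i g = M' i f := by
      rintro ⟨i, hi⟩
      exact image_congr fun j hj => hg _ (hP' i hi j hj)
    simp only [hM'eq, hg _ hP]
  · intro f x
    refine guess_nonneg (by positivity) ?_ _ _ _ _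
    have : ((1 : ℝ) / 2) ^ (Fintype.card J / 8) ≤ (1 / 2) ^ 2 :=
      pow_le_pow_of_le_one (by norm_num) (by norm_num) (by omega)
    linarith
  · intro f _
    refine sum_guess_le (by positivity) ?_ _ _ _
    have : ((1 : ℝ) / 2) ^ (Fintype.card J / 8) ≤ (1 / 2) ^ 2 :=
      pow_le_pow_of_le_one (by norm_num) (by norm_num) (by omega)
    linarith
  · intro f hf
    exact (hspec f hf).1
  have himg : P ∪ univ.image (fun i : J => flipAt (i : Fin d) v)
      = P ∪ (insert k J).image fun i => flipAt i v := by
    ext y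
    simp only [mem_union, mem_image, mem_univ, true_and, Subtype.exists, exists_prop, mem_insert,
      exists_eq_or_imp]
    constructor
    · rintro (h | h)
      · exact Or.inl h
      · exact Or.inr (Or.inr h)
    · rintro (h | rfl | h)
      · exact Or.inl h
      · exact Or.inl hP
      · exact Or.inr h
  rw [himg] at key
  refine key.trans ((sum_le_sum fun f hf => (hspec f hf).2).trans ?_)
  simp only [sum_add_distrib, sum_sub_distrib, ← mul_sum]
  rw [sum_comm (s := colourings d) (t := univ), sum_comm (s := colourings d) (t := univ)]
  simp only [sum_ite_eq_count, sum_const, nsmul_eq_mul, hcard]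
  have e1 : ∑ i : J, count d (fun f => 1 < (M f).card ∧ M' i f ≠ M f) = ∑ i ∈ J, X i :=
    sum_coe_sort J X
  have e2 : ∑ i : J, count d (fun f => (M' i f).card ≤ 1 ∧ f (flipAt i v) ≠ f (flipAt k v))
      = ∑ i ∈ J, W i := sum_coe_sort J W
  have e3 : U ≤ count d (fun f => ∃ (i : J) (c : Fin 3), c ≠ f (flipAt k v) ∧
      (fun i : J => f (flipAt (i : Fin d) v)) = Function.update (fun _ => f (flipAt k v)) i c) := by
    refine count_mono ?_
    rintro f - ⟨i, hi, c, hc, hc'⟩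
    have hki : k ≠ i := fun h => hk (h ▸ hi)
    have hc1 := hc' k (mem_insert_self _ _) hki
    refine ⟨⟨i, hi⟩, f (flipAt i v), by rw [hc1]; exact hc, funext fun j => ?_⟩
    by_cases hj : j = ⟨i, hi⟩
    · subst hj; simp
    · rw [Function.update_of_ne hj, hc1]
      exact hc' j (mem_insert_of_mem j.2) fun h => hj (Subtype.ext h)
  rw [e1, e2]
  have e4 : (n : ℝ) / 4 * U ≤ n / 4 * count d (fun f => ∃ (i : J) (c : Fin 3),
      c ≠ f (flipAt k v) ∧ (fun i : J => f (flipAt (i : Fin d) v))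
        = Function.update (fun _ => f (flipAt k v)) i c) :=
    mul_le_mul_of_nonneg_left e3 (by positivity)
  have e5 : 0 ≤ U := count_nonneg _
  have e6 : 64 * U ≤ n * U := mul_le_mul_of_nonneg_right hn0 e5
  have e7 : Y i₀ = count d fun f => M f ≠ M' i₀ f := rfl
  simp only [← e7]
  have e8 : ∑ i ∈ J, Y i ≤ 2 * ∑ i ∈ J, X i := by
    rw [mul_sum]
    exact sum_le_sum hYX
  linarith

end LocalCube

/-! ### Most pairs of vertices at distance two have the same palette -/

section Levels

variable {d : ℕ}

lemma count_palette_ne_eq {i j k : Fin d} (hi : i ≠ k) (hj : j ≠ k) (v v' : Fin d → Bool) :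
    count d (fun f => palette f univ v ≠ palette f univ (flipAt i (flipAt k v)))
      = count d (fun f => palette f univ v' ≠ palette f univ (flipAt j (flipAt k v'))) := by
  rw [← count_comp_moveTo v v' (Equiv.swap i j) fun f =>
    palette f univ v ≠ palette f univ (flipAt i (flipAt k v))]
  refine count_congr fun f _ => ?_
  have huniv : (univ : Finset (Fin d)).map (Equiv.swap i j).toEmbedding = univ :=
    map_univ_equiv _
  have hpal : ∀ x, palette (f ∘ moveTo v v' (Equiv.swap i j)) univ x
      = palette f univ (moveTo v v' (Equiv.swap i j) x) := by
    intro x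
    have := palette_comp_moveTo f v v' (Equiv.swap i j) univ x
    rwa [huniv] at this
  have h1 := moveTo_flipAt v v' (Equiv.swap i j) j (flipAt k v)
  have h2 := moveTo_flipAt v v' (Equiv.swap i j) k v
  rw [Equiv.swap_apply_right] at h1
  rw [Equiv.swap_apply_of_ne_of_ne hi.symm hj.symm, moveTo_self] at h2
  rw [hpal, hpal, moveTo_self, h1, h2]

/-- The vertices of parity `p` supported on the first `m` coordinates. -/
def lowClass (d : ℕ) (p : Bool) (m : ℕ) : Finset (Fin d → Bool) :=
  univ.filter fun x => parity x = p ∧ ∀ i : Fin d, m ≤ i → x i = false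

/-- The vertices of odd parity whose last non-zero coordinate is `k`. -/
def oddLevel (k : Fin d) : Finset (Fin d → Bool) :=
  univ.filter fun x => parity x = true ∧ x k = true ∧ ∀ i, k < i → x i = false

/-- The directions below `k`. -/
def below (k : Fin d) : Finset (Fin d) := univ.filter fun i => i < k

lemma card_below (k : Fin d) : (below k).card = k := by
  have : below k = Finset.Iio k := by ext; simp [below]
  rw [this, Fin.card_Iio]

lemma condEnt_lowClass_sub_le (k : Fin d) :
    k * (condEnt (colourings d) (lowClass d false k)
        - condEnt (colourings d) (lowClass d false (k + 1)))
      ≤ ∑ v ∈ oddLevel k, (condEnt (colourings d) (lowClass d false k)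
        - condEnt (colourings d) (lowClass d false k
            ∪ (insert k (below k)).image fun i => flipAt i v)) := by
  have hsub : lowClass d false k ⊆ lowClass d false (k + 1) := by
    intro x hx
    simp only [lowClass, mem_filter, mem_univ, true_and] at hx ⊢
    exact ⟨hx.1, fun i hi => hx.2 i (by omega)⟩
  have hB : ∀ v ∈ oddLevel k,
      (insert k (below k)).image (fun i => flipAt i v) ⊆ lowClass d false (k + 1) := by
    intro v hv x hx
    simp only [oddLevel, mem_filter, mem_univ, true_and] at hv
    obtain ⟨i, hi, rfl⟩ := mem_image.1 hx
    simp only [lowClass, mem_filter, mem_univ, true_and, parity_flipAt, hv.1, Bool.not_true]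
    have hik : i ≤ k := by
      rcases mem_insert.1 hi with rfl | h
      · exact le_rfl
      · exact (mem_filter.1 h).2.le
    intro j hj
    have hkj : k < j := by rw [Fin.lt_def]; omega
    rw [flipAt_of_ne (hik.trans_lt hkj).ne']
    exact hv.2.2 j hkj
  have key := condEnt_shearer (Ω := colourings d) (oddLevel k)
    (fun v => (insert k (below k)).image fun i => flipAt i v) (lowClass d false k) k
    (lowClass d false (k + 1) \ lowClass d false k) ?_
  · rw [union_sdiff_of_subset hsub] at key
    refine key.trans (sum_le_sum fun v hv => ?_)
    have : lowClass d false k ∪ ((insert k (below k)).image (fun i => flipAt i v)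
        ∩ (lowClass d false (k + 1) \ lowClass d false k))
        = lowClass d false k ∪ (insert k (below k)).image fun i => flipAt i v := by
      ext x
      have := @hB v hv x
      simp only [mem_union, mem_inter, mem_sdiff]
      tauto
    rw [this]
  · intro u hu
    simp only [mem_sdiff, lowClass, mem_filter, mem_univ, true_and, not_and, not_forall] at hu
    obtain ⟨⟨hu1, hu2⟩, hu3⟩ := hu
    obtain ⟨i, hi, hui⟩ := hu3 hu1
    have huk : u k = true := by
      have : i = k := by
        by_contra h
        refine hui (hu2 i ?_)
        have : (i : ℕ) ≠ k := fun h' => h (Fin.ext h')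
        omega
      rw [this] at hui
      simpa using hui
    have : (oddLevel k).filter (fun v => u ∈ (insert k (below k)).image fun i => flipAt i v)
        = (below k).image fun i => flipAt i u := by
      ext v
      simp only [mem_filter, mem_image, mem_insert, oddLevel, mem_univ, true_and]
      constructor
      · rintro ⟨⟨hv1, hv2, hv3⟩, j, hj, rfl⟩
        refine ⟨j, ?_, flipAt_flipAt _ _⟩
        rcases hj with rfl | hj
        · simp [flipAt_same, hv2] at huk
        · exact hj
      · rintro ⟨j, hj, rfl⟩
        have hjk : j < k := (mem_filter.1 hj).2
        refine ⟨⟨by simp [hu1], by rw [flipAt_of_ne hjk.ne', huk], fun i hi => ?_⟩, j, Or.inr hj,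
          flipAt_flipAt _ _⟩
        rw [flipAt_of_ne (hjk.trans hi).ne']
        exact hu2 i (by rw [Fin.lt_def] at hi; omega)
    rw [this, card_image_of_injective _ (flipAt_left_injective u), card_below]

lemma condEnt_lowClass_sub_le' {k : Fin d} (hk : 64 ≤ (k : ℕ)) :
    k * (condEnt (colourings d) (lowClass d false k)
        - condEnt (colourings d) (lowClass d false (k + 1)))
      ≤ ∑ v ∈ oddLevel k, (k * count d (fun f => 1 < (palette f univ v).card)
        + 12 * (1 / 2) ^ (k / 8 : ℕ) * (colourings d).card
        - 1 / 8 * ∑ i ∈ below k, count d (fun f => palette f (insert k (below k)) v ≠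
            palette f (insert k (below k)) (flipAt i (flipAt k v)))) := by
  refine (condEnt_lowClass_sub_le k).trans (sum_le_sum fun v hv => ?_)
  simp only [oddLevel, mem_filter, mem_univ, true_and] at hv
  have hP : flipAt k v ∈ lowClass d false k := by
    simp only [lowClass, mem_filter, mem_univ, true_and, parity_flipAt, hv.1, Bool.not_true]
    intro i hi
    by_cases hik : i = k
    · subst hik; simp [flipAt_same, hv.2.1]
    · rw [flipAt_of_ne hik]
      exact hv.2.2 i (lt_of_le_of_ne hi fun h => hik h.symm)
  have key := condEnt_star_le (J := below k) (k := k) (by simp [below])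
    (by rw [card_below]; exact hk) v (lowClass d false k) hP ?_
  · rw [card_below] at key
    refine key.trans ?_
    have : count d (fun f => 1 < (palette f (insert k (below k)) v).card)
        ≤ count d (fun f => 1 < (palette f univ v).card) :=
      count_mono fun f _ h => h.trans_le (card_le_card (palette_mono f (subset_univ _) v))
    have := mul_le_mul_of_nonneg_left this (Nat.cast_nonneg (α := ℝ) k)
    linarith
  · intro i hi j hj
    have hik : i < k := (mem_filter.1 hi).2
    have hjk : j < k := (mem_filter.1 hj).2
    simp only [lowClass, mem_filter, mem_univ, true_and] at hP ⊢
    refine ⟨by simp [hv.1], fun l hl => ?_⟩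
    have hl' : k ≤ l := hl
    rw [flipAt_of_ne (hjk.trans_le hl').ne', flipAt_of_ne (hik.trans_le hl').ne']
    exact hP.2 l hl

lemma condEnt_empty_sub_le (S : Finset (Fin d → Bool)) :
    condEnt (colourings d) ∅ - condEnt (colourings d) S ≤ 2 * S.card * (colourings d).card := by
  have key := condEnt_sub_le_of_kernel (Ω := colourings d) ∅ (fun x : S => (x : Fin d → Bool))
    (fun _ _ => (1 / 4 : ℝ) ^ S.card) (fun _ _ _ => rfl) (fun _ _ => by positivity)
    (fun f _ => ?_) (fun _ _ => by positivity)
  · have : ∅ ∪ univ.image (fun x : S => (x : Fin d → Bool)) = S := by ext; simp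
    rw [this] at key
    refine key.trans (le_of_eq ?_)
    rw [sum_const, nsmul_eq_mul, Real.logb_pow, one_div, Real.logb_inv,
      show (4 : ℝ) = 2 ^ 2 by norm_num, Real.logb_pow, Real.logb_self_eq_one one_lt_two]
    push_cast; ring
  · rw [sum_const, nsmul_eq_mul, card_univ, Fintype.card_fun, Fintype.card_coe, Fintype.card_fin]
    push_cast
    rw [← mul_pow]
    exact pow_le_one₀ (by norm_num) (by norm_num)

end Levels

section Stability

variable {d : ℕ}

lemma one_le_card_palette (hd : 1 ≤ d) (f : (Fin d → Bool) → Fin 3) (v : Fin d → Bool) :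
    1 ≤ (palette f univ v).card :=
  card_pos.2 ⟨_, flipAt_mem_palette (mem_univ (⟨0, hd⟩ : Fin d))⟩

/-- The number of ways to extend a colouring of one parity class to the whole cube. -/
lemma card_extend (p : Bool) (χ : (Fin d → Bool) → Fin 3) :
    ((colourings d).filter fun g => ∀ x ∈ parityClass d p, g x = χ x).card
      = ∏ v ∈ parityClass d (!p), (3 - (palette χ univ v).card) := by
  have h : ((colourings d).filter fun g => ∀ x ∈ parityClass d p, g x = χ x)
      = Fintype.piFinset fun v => if parity v = p then {χ v} else (palette χ univ v)ᶜ := by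
    ext g
    simp only [mem_filter, mem_colourings, mem_parityClass, Fintype.mem_piFinset]
    constructor
    · rintro ⟨h1, h2⟩ v
      split_ifs with hv
      · simp [h2 v hv]
      · rw [mem_compl, mem_palette]
        rintro ⟨i, -, hi⟩
        apply h1 v i
        rw [h2 _ (by rw [parity_flipAt]; cases p <;> simpa using hv), hi]
    · intro h
      have h2 : ∀ x, parity x = p → g x = χ x := fun x hx => by simpa [hx] using h x
      have h3 : ∀ x i, parity x ≠ p → g (flipAt i x) ≠ g x := by
        intro x i hx hg
        have h4 := h x
        rw [if_neg hx, mem_compl] at h4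
        apply h4
        rw [← hg, h2 _ (by rw [parity_flipAt]; cases p <;> simpa using hx)]
        exact flipAt_mem_palette (mem_univ i)
      refine ⟨fun x i => ?_, h2⟩
      by_cases hx : parity x = p
      · have := h3 (flipAt i x) i (by rw [parity_flipAt, hx]; cases p <;> simp)
        rw [flipAt_flipAt] at this
        exact this.symm
      · exact h3 x i hx
  rw [h, Fintype.card_piFinset]
  have hfil : parityClass d (!p) = univ.filter fun v => ¬ parity v = p := by
    ext v
    simp only [mem_parityClass, mem_filter, mem_univ, true_and]
    cases parity v <;> cases p <;> simp
  rw [hfil, prod_filter]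
  refine prod_congr rfl fun v _ => ?_
  split_ifs with hv
  · simp
  · rw [card_compl, Fintype.card_fin]

lemma two_pow_le_card_colourings (hd : 1 ≤ d) : 2 ^ 2 ^ (d - 1) ≤ (colourings d).card := by
  have h := card_extend (d := d) false fun _ => 0
  have hp : ∀ v : Fin d → Bool, palette (fun _ => (0 : Fin 3)) univ v = {0} := by
    intro v
    have : Nonempty (Fin d) := ⟨⟨0, hd⟩⟩
    rw [palette, image_const univ_nonempty]
  simp only [hp, card_singleton, prod_const] at h
  rw [card_parityClass hd] at h
  rw [← h]
  exact card_filter_le _ _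

lemma agree_parityClass_le (hd : 1 ≤ d) (p : Bool) (f : (Fin d → Bool) → Fin 3) :
    agree (colourings d) (parityClass d p) f
      ≤ 2 ^ ((parityClass d (!p)).filter fun v => ¬ 1 < (palette f univ v).card).card := by
  have h : agree (colourings d) (parityClass d p) f
      = ∏ v ∈ parityClass d (!p), (3 - (palette f univ v).card) := by
    rw [← card_extend]
    unfold agree
    congr!
  rw [h, ← prod_const, prod_filter]
  refine prod_le_prod' fun v _ => ?_
  have := one_le_card_palette hd f v
  split_ifs <;> omega

lemma condEnt_parityClass_le (hd : 1 ≤ d) (v₀ : Fin d → Bool) :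
    condEnt (colourings d) (parityClass d false)
      ≤ 2 ^ (d - 1) * ((colourings d).card - count d fun f => 1 < (palette f univ v₀).card) := by
  have h1 : condEnt (colourings d) (parityClass d false) ≤ ∑ f ∈ colourings d,
      ∑ v ∈ parityClass d true, (if ¬ 1 < (palette f univ v).card then (1 : ℝ) else 0) := by
    refine sum_le_sum fun f hf => ?_
    rw [sum_boole, Real.logb_le_iff_le_rpow one_lt_two (by exact_mod_cast agree_pos hf),
      Real.rpow_natCast]
    exact_mod_cast agree_parityClass_le hd false f
  refine h1.trans (le_of_eq ?_)
  rw [sum_comm]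
  simp only [sum_ite_eq_count]
  have h2 : ∀ v, count d (fun f => ¬ 1 < (palette f univ v).card)
      = (colourings d).card - count d fun f => 1 < (palette f univ v₀).card := by
    intro v
    have := count_and_add (d := d) (fun _ => True) fun f => 1 < (palette f univ v).card
    simp only [true_and, count_true] at this
    rw [← count_palette_eq univ v₀ v]
    linarith
  simp only [h2, sum_const, nsmul_eq_mul, card_parityClass hd]
  push_cast; rfl

lemma card_le_two_pow {m : ℕ} (hm : m ≤ d) (S : Finset (Fin d → Bool))
    (hS : ∀ x ∈ S, ∀ y ∈ S, ∀ i : Fin d, m ≤ i → x i = y i) : S.card ≤ 2 ^ m := by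
  have h : S.card ≤ (univ : Finset (Fin m → Bool)).card := by
    refine card_le_card_of_injOn (fun x i => x (Fin.castLE hm i)) (fun _ _ => by simp) ?_
    intro x hx y hy hxy
    funext i
    by_cases hi : m ≤ i
    · exact hS x hx y hy i hi
    · exact congrFun hxy ⟨i, by omega⟩
  simpa using h

lemma card_lowClass_le {m : ℕ} (hm : m ≤ d) (p : Bool) : (lowClass d p m).card ≤ 2 ^ m := by
  refine card_le_two_pow hm _ fun x hx y hy i hi => ?_
  rw [(mem_filter.1 hx).2.2 i hi, (mem_filter.1 hy).2.2 i hi]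

lemma card_oddLevel_le (k : Fin d) : (oddLevel k).card ≤ 2 ^ (k : ℕ) := by
  refine card_le_two_pow k.2.le _ fun x hx y hy i hi => ?_
  simp only [oddLevel, mem_filter, mem_univ, true_and] at hx hy
  by_cases hik : i = k
  · rw [hik, hx.2.1, hy.2.1]
  · have : k < i := lt_of_le_of_ne hi fun h => hik h.symm
    rw [hx.2.2 i this, hy.2.2 i this]

lemma card_oddLevel_last {e : ℕ} : (oddLevel (Fin.last (e + 1))).card = 2 ^ e := by
  have h1 : oddLevel (Fin.last (e + 1))
      = (parityClass (e + 2) true).filter fun x => x (Fin.last _) = true := by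
    ext x
    simp only [oddLevel, mem_filter, mem_univ, true_and, mem_parityClass]
    refine and_congr_right fun _ => ⟨fun h => h.1, fun h => ⟨h, fun i hi => ?_⟩⟩
    exact absurd hi (not_lt.2 (Fin.le_last i))
  have h2 := card_filter_add_card_filter_not (s := parityClass (e + 2) true)
    fun x => x (Fin.last (e + 1)) = true
  have h3 : ((parityClass (e + 2) true).filter fun x => x (Fin.last _) = true).card
      = ((parityClass (e + 2) true).filter fun x => ¬ x (Fin.last _) = true).card := by
    have h0 : (Fin.last (e + 1)) ≠ 0 := by simp [Fin.ext_iff]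
    refine card_bij' (fun x _ => flipAt 0 (flipAt (Fin.last _) x))
      (fun x _ => flipAt (Fin.last _) (flipAt 0 x)) ?_ ?_ ?_ ?_
    · intro x hx
      simp only [mem_filter, mem_parityClass] at hx ⊢
      simp [hx.1, flipAt_of_ne h0, flipAt_same, hx.2]
    · intro x hx
      simp only [mem_filter, mem_parityClass] at hx ⊢
      simp [hx.1, flipAt_of_ne h0, flipAt_same, hx.2]
    · intro x _; simp
    · intro x _; simp
  rw [card_parityClass (by omega)] at h2
  rw [h1]
  have : 2 ^ (e + 2 - 1) = 2 * 2 ^ e := by rw [show e + 2 - 1 = e + 1 by omega, pow_succ, mul_comm]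
  omega

lemma sum_card_oddLevel_le : ∑ k : Fin d, (oddLevel k).card ≤ (parityClass d true).card := by
  rw [← card_biUnion]
  · refine card_le_card fun x hx => ?_
    obtain ⟨k, -, hk⟩ := mem_biUnion.1 hx
    exact mem_parityClass.2 (mem_filter.1 hk).2.1
  · intro i _ j _ hij
    rw [Function.onFun, Finset.disjoint_left]
    intro x hx hy
    simp only [oddLevel, mem_filter, mem_univ, true_and] at hx hy
    rcases lt_or_gt_of_ne hij with h | h
    · simpa [hy.2.1] using hx.2.2 j h
    · simpa [hx.2.1] using hy.2.2 i h

lemma level_error_le {k : ℕ} (hk : 64 ≤ k) (hkd : k ≤ d) {s A : ℝ} (hs : s ≤ 2 ^ k)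
    (hA : 0 ≤ A) :
    s * (12 * (1 / 2) ^ (k / 8) * A) ≤ k * (2 ^ d * (1 / 2) ^ (d / 8) * A) := by
  have h1 : (2 : ℝ) ^ k * (1 / 2) ^ (k / 8) ≤ 2 ^ d * (1 / 2) ^ (d / 8) := by
    have h2 : ∀ m : ℕ, (2 : ℝ) ^ m * (1 / 2) ^ (m / 8) = 2 ^ (m - m / 8) := by
      intro m
      rw [pow_sub₀ _ two_ne_zero (Nat.div_le_self _ _), one_div, inv_pow]
    rw [h2, h2]
    exact pow_le_pow_right₀ one_le_two (by omega)
  have h3 : (64 : ℝ) ≤ k := by exact_mod_cast hk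
  have h4 : s * (1 / 2) ^ (k / 8) ≤ 2 ^ k * (1 / 2) ^ (k / 8) :=
    mul_le_mul_of_nonneg_right hs (by positivity)
  calc s * (12 * (1 / 2) ^ (k / 8) * A) = 12 * (s * (1 / 2) ^ (k / 8)) * A := by ring
    _ ≤ 12 * (2 ^ d * (1 / 2) ^ (d / 8)) * A := by
        have := h4.trans h1
        gcongr
    _ ≤ k * (2 ^ d * (1 / 2) ^ (d / 8)) * A := by gcongr; linarith
    _ = _ := by ring

lemma sub_le_of_levels {n m₀ m : ℕ} (a : ℕ → ℝ) (s : Fin n → ℝ) (hs : ∀ l, 0 ≤ s l)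
    {c err : ℝ} (hc : 0 ≤ c) (herr : 0 ≤ err)
    (h : ∀ l : Fin n, m₀ ≤ (l : ℕ) → a l - a (l + 1) ≤ s l * c + err) (hm : m₀ ≤ m) (hmn : m ≤ n) :
    a m₀ - a m ≤ (∑ l ∈ univ.filter (fun l : Fin n => (l : ℕ) < m), s l) * c + m * err := by
  induction m, hm using Nat.le_induction with
  | base =>
    rw [sub_self]
    exact add_nonneg (mul_nonneg (sum_nonneg fun l _ => hs l) hc)
      (mul_nonneg (Nat.cast_nonneg _) herr)
  | succ m hm ih =>
    have h1 := ih (by omega)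
    have h2 := h ⟨m, by omega⟩ hm
    have h3 : (univ.filter fun l : Fin n => (l : ℕ) < m + 1)
        = insert ⟨m, by omega⟩ (univ.filter fun l : Fin n => (l : ℕ) < m) := by
      ext l
      simp only [mem_filter, mem_univ, true_and, mem_insert, Fin.ext_iff]
      omega
    have h4 : (⟨m, by omega⟩ : Fin n) ∉ univ.filter fun l : Fin n => (l : ℕ) < m :=
      fun h => lt_irrefl _ (mem_filter.1 h).2
    have h5 : a m - a (m + 1) ≤ s ⟨m, by omega⟩ * c + err := h2
    rw [h3, sum_insert h4, Nat.cast_succ]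
    linarith

set_option maxHeartbeats 1000000 in
/-- Two vertices at distance two rarely see different palettes. -/
theorem count_palette_ne_le (hd : 66 ≤ d) {i k : Fin d} (hik : i ≠ k) (v : Fin d → Bool) :
    count d (fun f => palette f univ v ≠ palette f univ (flipAt i (flipAt k v)))
      ≤ 32 * (2 ^ 65 * (1 / 2) ^ d + d * (1 / 2) ^ (d / 8)) * (colourings d).card := by
  set z := count d (fun f => palette f univ v ≠ palette f univ (flipAt i (flipAt k v))) with hz
  set A : ℝ := ((colourings d).card : ℝ) with hA
  set nc := count d (fun f => 1 < (palette f univ v).card) with hnc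
  set err : ℝ := 2 ^ d * (1 / 2) ^ (d / 8) * A with herr
  have hA0 : 0 ≤ A := by positivity
  have hnc0 : 0 ≤ nc := count_nonneg _
  have hz0 : 0 ≤ z := count_nonneg _
  obtain ⟨e, rfl⟩ : ∃ e, d = e + 2 := ⟨d - 2, by omega⟩
  have hcomm : ∀ (a b : Fin (e + 2)) (w : Fin (e + 2) → Bool),
      count (e + 2) (fun f => palette f univ w ≠ palette f univ (flipAt a (flipAt b w)))
        = count (e + 2) (fun f => palette f univ w ≠ palette f univ (flipAt b (flipAt a w))) :=
    fun a b w => by rw [flipAt_comm a b w]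
  have hzall : ∀ (j : Fin (e + 2)) (w : Fin (e + 2) → Bool), j ≠ Fin.last _ →
      count (e + 2) (fun f => palette f univ w ≠ palette f univ (flipAt j (flipAt (Fin.last _) w)))
        = z := by
    intro j w hj
    by_cases hi : i = Fin.last (e + 1)
    · rw [hi] at hik hz
      rw [hz]
      exact (count_palette_ne_eq hj hik.symm w v).trans (hcomm _ _ v)
    · exact (count_palette_ne_eq hj hi w v).trans ((hcomm _ _ v).trans
        ((count_palette_ne_eq (Ne.symm hi) hik.symm v v).trans (hcomm _ _ v)))
  -- the ordinary levels
  have hlevel : ∀ l : Fin (e + 2), 64 ≤ (l : ℕ) →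
      condEnt (colourings (e + 2)) (lowClass (e + 2) false l)
        - condEnt (colourings (e + 2)) (lowClass (e + 2) false (l + 1))
        ≤ (oddLevel l).card * nc + err := by
    intro l hl
    have hl0 : (0 : ℝ) < (l : ℕ) := by exact_mod_cast (by omega : 0 < (l : ℕ))
    have h1 := condEnt_lowClass_sub_le' hl
    have h2 : ∀ w ∈ oddLevel l, ((l : ℕ) : ℝ) * count (e + 2) (fun f => 1 < (palette f univ w).card)
        + 12 * (1 / 2) ^ (l / 8 : ℕ) * (colourings (e + 2)).card
        - 1 / 8 * ∑ i ∈ below l, count (e + 2) (fun f => palette f (insert l (below l)) w ≠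
            palette f (insert l (below l)) (flipAt i (flipAt l w)))
        ≤ (l : ℕ) * nc + 12 * (1 / 2) ^ (l / 8 : ℕ) * A := by
      intro w _
      rw [count_palette_eq univ v w]
      have := sum_nonneg fun i (_ : i ∈ below l) =>
        count_nonneg (d := e + 2) (fun f => palette f (insert l (below l)) w ≠
            palette f (insert l (below l)) (flipAt i (flipAt l w)))
      linarith
    have h3 := h1.trans (sum_le_sum h2)
    rw [sum_const, nsmul_eq_mul, mul_add] at h3
    have h4 := level_error_le (d := e + 2) hl l.2.le (s := (oddLevel l).card)
      (by exact_mod_cast card_oddLevel_le l) hA0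
    refine le_of_mul_le_mul_left ?_ hl0
    rw [mul_add]
    linarith
  -- the top level
  have htop : condEnt (colourings (e + 2)) (lowClass (e + 2) false (e + 1))
      - condEnt (colourings (e + 2)) (lowClass (e + 2) false (e + 2))
        ≤ (oddLevel (Fin.last (e + 1))).card * nc + err - 2 ^ e / 8 * z := by
    have hl : 64 ≤ ((Fin.last (e + 1) : Fin (e + 2)) : ℕ) := by rw [Fin.val_last]; omega
    have hl0 : (0 : ℝ) < ((Fin.last (e + 1) : Fin (e + 2)) : ℕ) := by
      exact_mod_cast (by omega : 0 < ((Fin.last (e + 1) : Fin (e + 2)) : ℕ))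
    have h1 := condEnt_lowClass_sub_le' hl
    have huniv : insert (Fin.last (e + 1)) (below (Fin.last (e + 1))) = univ := by
      ext j
      simp only [below, mem_insert, mem_filter, mem_univ, true_and, iff_true]
      exact (Fin.le_last j).eq_or_lt
    have h2 : ∀ w ∈ oddLevel (Fin.last (e + 1)), ∑ i ∈ below (Fin.last (e + 1)),
        count (e + 2) (fun f => palette f univ w ≠
            palette f univ (flipAt i (flipAt (Fin.last (e + 1)) w)))
          = ((Fin.last (e + 1) : Fin (e + 2)) : ℕ) * z := by
      intro w _
      rw [sum_congr rfl fun j hj => hzall j w (mem_filter.1 hj).2.ne, sum_const, card_below,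
        nsmul_eq_mul]
    simp only [huniv] at h1
    rw [sum_congr rfl fun w hw => by rw [h2 w hw, count_palette_eq univ v w]] at h1
    rw [sum_const, nsmul_eq_mul] at h1
    have h4 := level_error_le (d := e + 2) hl (Fin.last (e + 1)).2.le
      (s := (oddLevel (Fin.last (e + 1))).card)
      (by exact_mod_cast card_oddLevel_le (Fin.last (e + 1))) hA0
    have h5 : ((oddLevel (Fin.last (e + 1))).card : ℝ) = 2 ^ e := by
      rw [card_oddLevel_last]; push_cast; rfl
    refine le_of_mul_le_mul_left ?_ hl0
    rw [Fin.val_last] at h1 h4 ⊢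
    rw [h5] at h1 h4 ⊢
    have h6 : ((e + 1 : ℕ) : ℝ) * (2 ^ e * nc + err - 2 ^ e / 8 * z)
        = 2 ^ e * (((e + 1 : ℕ) : ℝ) * nc + 12 * (1 / 2) ^ ((e + 1) / 8) * A
          - 1 / 8 * (((e + 1 : ℕ) : ℝ) * z)) - 2 ^ e * (12 * (1 / 2) ^ ((e + 1) / 8) * A)
          + ((e + 1 : ℕ) : ℝ) * err := by ring
    rw [h6]
    linarith
  -- telescoping
  have htel : ∀ m : ℕ, 64 ≤ m → m ≤ e + 1 →
      condEnt (colourings (e + 2)) (lowClass (e + 2) false 64)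
        - condEnt (colourings (e + 2)) (lowClass (e + 2) false m)
        ≤ (∑ l ∈ univ.filter (fun l : Fin (e + 2) => (l : ℕ) < m),
          ((oddLevel l).card : ℝ)) * nc + m * err := by
    intro m hm hm'
    exact sub_le_of_levels (fun m => condEnt (colourings (e + 2)) (lowClass (e + 2) false m))
      (fun l => ((oddLevel l).card : ℝ)) (fun _ => Nat.cast_nonneg _) hnc0
      (by rw [herr]; positivity) hlevel hm (by omega)
  have hmain := htel (e + 1) (by omega) le_rfl
  have hsum : (∑ l ∈ univ.filter (fun l : Fin (e + 2) => (l : ℕ) < e + 1), ((oddLevel l).card : ℝ))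
      + (oddLevel (Fin.last (e + 1))).card ≤ 2 ^ (e + 1) := by
    have h1 := sum_card_oddLevel_le (d := e + 2)
    rw [card_parityClass (by omega)] at h1
    have h2 : (univ : Finset (Fin (e + 2))) = insert (Fin.last (e + 1))
        (univ.filter fun l : Fin (e + 2) => (l : ℕ) < e + 1) := by
      ext l
      simp only [mem_filter, mem_univ, true_and, mem_insert, Fin.ext_iff, Fin.val_last, true_iff]
      omega
    rw [h2, sum_insert (by simp)] at h1
    have h3 : (((oddLevel (Fin.last (e + 1))).card
        + ∑ l ∈ univ.filter (fun l : Fin (e + 2) => (l : ℕ) < e + 1), (oddLevel l).card : ℕ) : ℝ)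
        ≤ ((2 ^ (e + 1) : ℕ) : ℝ) := by exact_mod_cast h1
    push_cast at h3
    linarith
  have hfull : lowClass (e + 2) false (e + 2) = parityClass (e + 2) false := by
    ext x
    simp only [lowClass, mem_filter, mem_univ, true_and, mem_parityClass, and_iff_left_iff_imp]
    intro _ j hj
    omega
  have hlast := condEnt_parityClass_le (d := e + 2) (by omega) v
  have hfirst := condEnt_empty_sub_le (lowClass (e + 2) false 64)
  have hfirst' : 2 * ((lowClass (e + 2) false 64).card : ℝ) * A ≤ 2 * 2 ^ 64 * A := by
    have : ((lowClass (e + 2) false 64).card : ℝ) ≤ 2 ^ 64 := by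
      exact_mod_cast card_lowClass_le (by omega) false
    gcongr
  have hlower : (2 : ℝ) ^ (e + 1) * A ≤ condEnt (colourings (e + 2)) ∅ := by
    rw [condEnt_empty, mul_comm]
    refine mul_le_mul_of_nonneg_left ?_ hA0
    have h1 := two_pow_le_card_colourings (d := e + 2) (by omega)
    rw [Real.le_logb_iff_rpow_le one_lt_two]
    · have : ((2 : ℝ) ^ (e + 1)) = ((2 ^ (e + 1) : ℕ) : ℝ) := by push_cast; rfl
      rw [this, Real.rpow_natCast]
      exact_mod_cast h1
    · exact_mod_cast lt_of_lt_of_le (by positivity) h1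
  rw [hfull] at htop
  rw [show e + 2 - 1 = e + 1 by omega] at hlast
  have hsum' := mul_le_mul_of_nonneg_right hsum hnc0
  push_cast at hmain
  have hgain : (2 : ℝ) ^ e / 8 * z ≤ (2 ^ 65 * A + (e + 2) * err) := by
    have : (2 : ℝ) ^ 65 = 2 * 2 ^ 64 := by norm_num
    linarith
  have h2e : (0 : ℝ) < 2 ^ e / 8 := by positivity
  refine le_of_mul_le_mul_left (hgain.trans (le_of_eq ?_)) h2e
  have h1 : (2 : ℝ) ^ (e + 2) * (1 / 2) ^ (e + 2) = 1 := by rw [← mul_pow]; norm_num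
  have h3 : (2 : ℝ) ^ (e + 2) = 4 * 2 ^ e := by ring
  rw [h3] at h1
  have h4 : (2 : ℝ) ^ 65 * A = 2 ^ 65 * A * (4 * 2 ^ e * (1 / 2) ^ (e + 2)) := by rw [h1, mul_one]
  rw [h4, herr, h3]
  push_cast
  ring

end Stability

/-! ### Most colourings are close to a ground state -/

section Majority

variable {d : ℕ}

/-- The vertices of parity `p` whose colour is not `a`. -/
def defects (f : (Fin d → Bool) → Fin 3) (p : Bool) (a : Fin 3) : Finset (Fin d → Bool) :=
  (parityClass d p).filter fun w => f w ≠ a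

lemma mem_defects {f : (Fin d → Bool) → Fin 3} {p : Bool} {a : Fin 3} {w : Fin d → Bool} :
    w ∈ defects f p a ↔ parity w = p ∧ f w ≠ a := by simp [defects]

/-- The colourings with at most `k` vertices of parity `p` whose colour is not `a`. -/
def nearGround (d : ℕ) (p : Bool) (a : Fin 3) (k : ℕ) : Finset ((Fin d → Bool) → Fin 3) :=
  (colourings d).filter fun f => (defects f p a).card ≤ k

lemma exists_two_differ {v w : Fin d → Bool} (h : parity v = parity w) (hne : v ≠ w) :
    ∃ i k, i ≠ k ∧ v i ≠ w i ∧ v k ≠ w k := by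
  obtain ⟨i, hi⟩ := Function.ne_iff.1 hne
  have h1 : flipAt i v ≠ w := by
    rintro rfl
    rw [parity_flipAt] at h
    cases hp : parity v <;> simp [hp] at h
  obtain ⟨k, hk⟩ := Function.ne_iff.1 h1
  have hki : k ≠ i := by
    rintro rfl
    rw [flipAt_same] at hk
    cases hv : v k <;> cases hw : w k <;> simp_all
  exact ⟨i, k, hki.symm, hi, by rwa [flipAt_of_ne hki] at hk⟩

lemma count_palette_ne_le_mul {q : ℝ} (hq0 : 0 ≤ q)
    (hq : ∀ (v : Fin d → Bool) (i k : Fin d), i ≠ k →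
      count d (fun f => palette f univ v ≠ palette f univ (flipAt i (flipAt k v))) ≤ q) :
    ∀ (n : ℕ) (v w : Fin d → Bool), (univ.filter fun i => v i ≠ w i).card = n →
      parity v = parity w →
      count d (fun f => palette f univ v ≠ palette f univ w) ≤ n * q := by
  intro n
  induction n using Nat.strong_induction_on with
  | _ n ih =>
    intro v w hn hp
    by_cases hvw : v = w
    · subst hvw
      have h0 : count d (fun f => palette f univ v ≠ palette f univ v) = 0 := by simp [count]
      rw [h0]; positivity
    obtain ⟨i, k, hik, hi, hk⟩ := exists_two_differ hp hvw
    have hlt : (univ.filter fun j => flipAt i (flipAt k v) j ≠ w j)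
        ⊂ univ.filter fun j => v j ≠ w j := by
      rw [Finset.ssubset_iff_of_subset]
      · refine ⟨i, by simpa using hi, ?_⟩
        rw [mem_filter, flipAt_same, flipAt_of_ne hik]
        cases hv : v i <;> cases hw : w i <;> simp_all
      · intro j hj
        simp only [mem_filter, mem_univ, true_and] at hj ⊢
        by_cases hji : j = i
        · rwa [hji]
        · by_cases hjk : j = k
          · rwa [hjk]
          · rwa [flipAt_of_ne hji, flipAt_of_ne hjk] at hj
    have hcard := card_lt_card hlt
    rw [hn] at hcard
    have h1 := ih _ hcard (flipAt i (flipAt k v)) w rfl (by simp [hp])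
    have h2 : count d (fun f => palette f univ v ≠ palette f univ w)
        ≤ count d (fun f => palette f univ v ≠ palette f univ (flipAt i (flipAt k v)))
          + count d (fun f => palette f univ (flipAt i (flipAt k v)) ≠ palette f univ w) :=
      (count_mono fun f _ h => by
        by_contra h'
        push Not at h'
        exact h (h'.1.trans h'.2)).trans (count_or_le _ _)
    have h3 := hq v i k hik
    have h4 : (((univ.filter fun j => flipAt i (flipAt k v) j ≠ w j).card : ℝ) + 1) * q ≤ n * q :=
      mul_le_mul_of_nonneg_right (by exact_mod_cast hcard) hq0
    linarith

lemma exists_mem_nearGround (hd : 1 ≤ d) {f : (Fin d → Bool) → Fin 3} (hf : f ∈ colourings d)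
    (v : Fin d → Bool) {k : ℕ}
    (hk : ((parityClass d true).filter fun w => palette f univ v ≠ palette f univ w).card ≤ k) :
    ∃ p a, f ∈ nearGround d p a k := by
  have h1 := one_le_card_palette hd f v
  have h2 := card_palette_le hf univ v
  rcases (by omega : (palette f univ v).card = 1 ∨ (palette f univ v).card = 2) with h | h
  · obtain ⟨a, ha⟩ := card_eq_one.1 h
    refine ⟨false, a, mem_filter.2 ⟨hf, le_trans ?_ hk⟩⟩
    refine card_le_card_of_injOn (flipAt ⟨0, hd⟩) ?_ (flipAt_injective _).injOn
    intro w hw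
    rw [mem_coe, mem_defects] at hw
    rw [mem_coe, mem_filter, mem_parityClass, parity_flipAt, hw.1, ha]
    refine ⟨rfl, fun h' => hw.2 ?_⟩
    have := flipAt_mem_palette (f := f) (x := flipAt ⟨0, hd⟩ w) (mem_univ (⟨0, hd⟩ : Fin d))
    rwa [← h', flipAt_flipAt, mem_singleton] at this
  · have h3 : ((palette f univ v)ᶜ).card = 1 := by rw [card_compl, h]; rfl
    obtain ⟨c, hc⟩ := card_eq_one.1 h3
    refine ⟨true, c, mem_filter.2 ⟨hf, le_trans (card_le_card ?_) hk⟩⟩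
    intro w hw
    rw [mem_defects] at hw
    rw [mem_filter, mem_parityClass]
    refine ⟨hw.1, fun h' => hw.2 ?_⟩
    have := notMem_palette hf univ w
    rwa [← h', ← mem_compl, hc, mem_singleton] at this

/-- Few colourings are far from all six ground states. -/
lemma mul_count_not_nearGround_le (hd : 1 ≤ d) {q : ℝ} (hq0 : 0 ≤ q)
    (hq : ∀ (v : Fin d → Bool) (i k : Fin d), i ≠ k →
      count d (fun f => palette f univ v ≠ palette f univ (flipAt i (flipAt k v))) ≤ q) (k : ℕ) :
    k * count d (fun f => ∀ p a, f ∉ nearGround d p a k) ≤ 2 ^ (d - 1) * (d * q) := by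
  classical
  set v : Fin d → Bool := flipAt ⟨0, hd⟩ fun _ => false with hv
  have hpv : parity v = true := by
    rw [hv, parity_flipAt]; simp [parity]
  have h1 : ∑ w ∈ parityClass d true, count d (fun f => palette f univ v ≠ palette f univ w)
      ≤ 2 ^ (d - 1) * (d * q) := by
    have : ∀ w ∈ parityClass d true,
        count d (fun f => palette f univ v ≠ palette f univ w) ≤ d * q := by
      intro w hw
      refine (count_palette_ne_le_mul hq0 hq _ v w rfl
        (hpv.trans (mem_parityClass.1 hw).symm)).trans ?_
      refine mul_le_mul_of_nonneg_right ?_ hq0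
      exact_mod_cast (card_le_univ _).trans (by simp)
    refine (sum_le_sum this).trans ?_
    rw [sum_const, card_parityClass hd, nsmul_eq_mul]
    push_cast; rfl
  refine le_trans ?_ h1
  simp only [← sum_ite_eq_count]
  rw [sum_comm, mul_sum]
  refine sum_le_sum fun f hf => ?_
  rw [sum_boole]
  split_ifs with h
  · rw [mul_one]
    by_contra! h'
    obtain ⟨p, a, hpa⟩ := exists_mem_nearGround hd hf v (k := k) (by exact_mod_cast h'.le)
    exact h p a hpa
  · simp

end Majority

/-! ### Edge isoperimetry in the cube -/

section Isoperimetry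

variable {d : ℕ}

lemma add_two_mul_le_mul_logb {a b : ℝ} (ha : 0 < a) (hab : a ≤ b) :
    a * Real.logb 2 a + b * Real.logb 2 b + 2 * a ≤ (a + b) * Real.logb 2 (a + b) := by
  have hb : 0 < b := ha.trans_le hab
  have h1 : Real.logb 2 a + 1 ≤ Real.logb 2 (a + b) := by
    rw [← Real.logb_self_eq_one one_lt_two, ← Real.logb_mul ha.ne' two_ne_zero]
    exact Real.logb_le_logb_of_le one_lt_two (by positivity) (by linarith)
  have hz : (2 : ℝ) ^ (a / b) ≤ 1 + a / b := by
    have := _root_.rpow_one_add_le_one_add_mul_self (s := 1) (by norm_num) (p := a / b)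
      (by positivity) ((div_le_one hb).2 hab)
    norm_num at this
    exact this
  have h2 : a / b + Real.logb 2 b ≤ Real.logb 2 (a + b) := by
    have h3 : a + b = (1 + a / b) * b := by field_simp; ring
    rw [h3, Real.logb_mul (by positivity) hb.ne']
    gcongr
    exact (Real.le_logb_iff_rpow_le one_lt_two (by positivity)).2 hz
  have h4 := mul_le_mul_of_nonneg_left h1 ha.le
  have h5 := mul_le_mul_of_nonneg_left h2 hb.le
  rw [mul_add, mul_div_cancel₀ _ hb.ne'] at h5
  linarith

/-- The number of directions in which `x` has a neighbour in `X`. -/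
def degIn (X : Finset (Fin d → Bool)) (x : Fin d → Bool) : ℕ :=
  (univ.filter fun i => flipAt i x ∈ X).card

lemma degIn_mono {X Y : Finset (Fin d → Bool)} (h : X ⊆ Y) (x : Fin d → Bool) :
    degIn X x ≤ degIn Y x :=
  card_le_card fun i hi => by
    simp only [mem_filter, mem_univ, true_and] at hi ⊢
    exact h hi

lemma degIn_le_of_split {X : Finset (Fin d → Bool)} (i : Fin d) {b : Bool} {x : Fin d → Bool}
    (hx : x i = b) :
    degIn X x ≤ degIn (X.filter fun y => y i = b) x
      + (if flipAt i x ∈ X.filter (fun y => y i = !b) then 1 else 0) := by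
  have h : (univ.filter fun j => flipAt j x ∈ X)
      ⊆ (univ.filter fun j => flipAt j x ∈ X.filter fun y => y i = b)
        ∪ (if flipAt i x ∈ X.filter (fun y => y i = !b) then {i} else ∅) := by
    intro j hj
    simp only [mem_filter, mem_univ, true_and, mem_union] at hj ⊢
    by_cases hji : j = i
    · subst hji
      right
      rw [if_pos ⟨hj, by rw [flipAt_same, hx]⟩]
      exact mem_singleton_self _
    · left
      exact ⟨hj, by rw [flipAt_of_ne (Ne.symm hji), hx]⟩
  refine (card_le_card h).trans ((card_union_le _ _).trans ?_)
  refine add_le_add le_rfl ?_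
  split_ifs <;> simp

lemma sum_degIn_split (X : Finset (Fin d → Bool)) (i : Fin d) (b : Bool) :
    ∑ x ∈ X.filter (fun y => y i = b), degIn X x
      ≤ ∑ x ∈ X.filter (fun y => y i = b), degIn (X.filter fun y => y i = b) x
        + min (X.filter fun y => y i = b).card (X.filter fun y => y i = !b).card := by
  refine (sum_le_sum fun x hx => degIn_le_of_split i (mem_filter.1 hx).2).trans ?_
  rw [sum_add_distrib]
  refine add_le_add le_rfl ?_
  rw [sum_boole, Nat.cast_id, le_min_iff]
  refine ⟨card_filter_le _ _, card_le_card_of_injOn (flipAt i) ?_ (flipAt_injective i).injOn⟩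
  intro x hx
  exact (mem_filter.1 hx).2

/-- Harper's inequality in its entropy form. -/
theorem sum_degIn_le (X : Finset (Fin d → Bool)) :
    ((∑ x ∈ X, degIn X x : ℕ) : ℝ) ≤ X.card * Real.logb 2 X.card := by
  induction hn : X.card using Nat.strong_induction_on generalizing X with
  | _ n ih =>
    rcases le_or_gt X.card 1 with h1 | h1
    · have h0 : ∑ x ∈ X, degIn X x = 0 := by
        refine sum_eq_zero fun x hx => card_eq_zero.2 (filter_eq_empty_iff.2 fun i _ hi => ?_)
        have := congrFun (card_le_one.1 h1 _ hi _ hx) i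
        rw [flipAt_same] at this
        cases hxi : x i <;> simp [hxi] at this
      rw [h0, ← hn]
      interval_cases X.card <;> simp
    · obtain ⟨x, hx, y, hy, hxy⟩ := one_lt_card.1 h1
      obtain ⟨i, hi⟩ := Function.ne_iff.1 hxy
      set X₀ := X.filter fun y => y i = false with hX₀
      set X₁ := X.filter fun y => y i = true with hX₁
      have hsum : X₀.card + X₁.card = n := by
        rw [← hn, hX₀, hX₁, ← card_filter_add_card_filter_not (s := X) (fun y => y i = false)]
        simp
      have hpos : 0 < X₀.card ∧ 0 < X₁.card := by
        rw [card_pos, card_pos]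
        cases hxi : x i <;> cases hyi : y i
        · simp [hxi, hyi] at hi
        · exact ⟨⟨x, mem_filter.2 ⟨hx, hxi⟩⟩, ⟨y, mem_filter.2 ⟨hy, hyi⟩⟩⟩
        · exact ⟨⟨y, mem_filter.2 ⟨hy, hyi⟩⟩, ⟨x, mem_filter.2 ⟨hx, hxi⟩⟩⟩
        · simp [hxi, hyi] at hi
      have ih0 := ih _ (by omega) X₀ rfl
      have ih1 := ih _ (by omega) X₁ rfl
      have hs : ∑ x ∈ X, degIn X x = ∑ x ∈ X₀, degIn X x + ∑ x ∈ X₁, degIn X x := by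
        rw [← sum_filter_add_sum_filter_not X (fun y => y i = false)]
        simp [hX₀, hX₁]
      have hs0 : ∑ x ∈ X₀, degIn X x ≤ ∑ x ∈ X₀, degIn X₀ x + min X₀.card X₁.card :=
        sum_degIn_split X i false
      have hs1 : ∑ x ∈ X₁, degIn X x ≤ ∑ x ∈ X₁, degIn X₁ x + min X₁.card X₀.card :=
        sum_degIn_split X i true
      rw [min_comm X₁.card] at hs1
      have htot : ((∑ x ∈ X, degIn X x : ℕ) : ℝ)
          ≤ X₀.card * Real.logb 2 X₀.card + X₁.card * Real.logb 2 X₁.card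
            + 2 * ((min X₀.card X₁.card : ℕ) : ℝ) := by
        have : ((∑ x ∈ X, degIn X x : ℕ) : ℝ) ≤ ((∑ x ∈ X₀, degIn X₀ x : ℕ) : ℝ)
            + ((∑ x ∈ X₁, degIn X₁ x : ℕ) : ℝ) + 2 * ((min X₀.card X₁.card : ℕ) : ℝ) := by
          rw [hs]
          exact_mod_cast (by omega : _ ≤ ∑ x ∈ X₀, degIn X₀ x + ∑ x ∈ X₁, degIn X₁ x
            + 2 * min X₀.card X₁.card)
        linarith
      refine htot.trans ?_
      have hp0 : (0 : ℝ) < X₀.card := by exact_mod_cast hpos.1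
      have hp1 : (0 : ℝ) < X₁.card := by exact_mod_cast hpos.2
      rw [← hsum]
      push_cast
      rcases le_total X₀.card X₁.card with hle | hle
      · have hle' : (X₀.card : ℝ) ≤ X₁.card := by exact_mod_cast hle
        rw [min_eq_left hle']
        exact add_two_mul_le_mul_logb hp0 hle'
      · have hle' : (X₁.card : ℝ) ≤ X₀.card := by exact_mod_cast hle
        rw [min_eq_right hle', add_comm (X₀.card : ℝ)]
        have := add_two_mul_le_mul_logb hp1 hle'
        linarith

lemma sum_degIn_le_of_card_le {X : Finset (Fin d → Bool)} {m : ℕ} (h : X.card ≤ 2 ^ m) :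
    ∑ x ∈ X, degIn X x ≤ X.card * m := by
  rcases X.eq_empty_or_nonempty with rfl | hX
  · simp
  have h1 := sum_degIn_le X
  have h2 : Real.logb 2 X.card ≤ m := by
    rw [Real.logb_le_iff_le_rpow one_lt_two (by exact_mod_cast hX.card_pos), Real.rpow_natCast]
    exact_mod_cast h
  exact_mod_cast h1.trans (mul_le_mul_of_nonneg_left h2 (Nat.cast_nonneg _))

/-- The neighbourhood of a set. -/
def nbhd (X : Finset (Fin d → Bool)) : Finset (Fin d → Bool) := X.biUnion nbrs

lemma mem_nbhd {X : Finset (Fin d → Bool)} {v : Fin d → Bool} :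
    v ∈ nbhd X ↔ ∃ i, flipAt i v ∈ X := by
  simp only [nbhd, mem_biUnion]
  constructor
  · rintro ⟨x, hx, hv⟩
    obtain ⟨i, rfl⟩ := mem_nbrs.1 (mem_nbrs_comm.1 hv)
    exact ⟨i, hx⟩
  · rintro ⟨i, hi⟩
    exact ⟨_, hi, mem_nbrs_comm.1 (flipAt_mem_nbrs i v)⟩

lemma nbhd_mono {X Y : Finset (Fin d → Bool)} (h : X ⊆ Y) : nbhd X ⊆ nbhd Y :=
  biUnion_subset_biUnion_of_subset_left _ h

lemma card_nbhd_le (X : Finset (Fin d → Bool)) : (nbhd X).card ≤ X.card * d := by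
  refine card_biUnion_le.trans ?_
  rw [sum_congr rfl fun x _ => card_nbrs x, sum_const, smul_eq_mul]

lemma card_le_card_nbhd (hd : 1 ≤ d) (X : Finset (Fin d → Bool)) : X.card ≤ (nbhd X).card :=
  card_le_card_of_injOn (flipAt ⟨0, hd⟩)
    (fun x hx => mem_nbhd.2 ⟨⟨0, hd⟩, by rwa [flipAt_flipAt]⟩) (flipAt_injective _).injOn

lemma parity_of_mem_nbhd {X : Finset (Fin d → Bool)} {p : Bool} (h : X ⊆ parityClass d p)
    {v : Fin d → Bool} (hv : v ∈ nbhd X) : parity v = !p := by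
  obtain ⟨i, hi⟩ := mem_nbhd.1 hv
  have := mem_parityClass.1 (h hi)
  rw [parity_flipAt] at this
  rw [← this, Bool.not_not]

lemma card_mul_le_sum_degIn {S Q : Finset (Fin d → Bool)} {t : ℕ}
    (hS : ∀ u ∈ S, d ≤ degIn Q u + t) :
    S.card * d ≤ ∑ u ∈ S, degIn Q u + S.card * t := by
  have := sum_le_sum hS
  rwa [sum_add_distrib, sum_const, sum_const, smul_eq_mul, smul_eq_mul] at this

lemma sum_degIn_comm (S Q : Finset (Fin d → Bool)) :
    ∑ u ∈ S, degIn Q u = ∑ v ∈ Q, degIn S v := by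
  simp only [degIn, card_filter]
  rw [sum_comm]
  rw [sum_comm (s := Q)]
  refine sum_congr rfl fun i _ => ?_
  rw [← card_filter, ← card_filter]
  refine card_bij' (fun u _ => flipAt i u) (fun u _ => flipAt i u) ?_ ?_ ?_ ?_ <;> simp
  all_goals intros; exact ⟨‹_›, ‹_›⟩

/-- A set of vertices almost all of whose neighbours lie in a small set `Q` of the opposite
parity is smaller than `Q` by a constant factor. -/
lemma card_mul_le_of_degIn {S Q : Finset (Fin d → Bool)} {p : Bool} {t : ℕ}
    (hSp : S ⊆ parityClass d p) (hQp : Q ⊆ parityClass d (!p))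
    (hS : ∀ u ∈ S, d ≤ degIn Q u + t) (ht : 2 * t ≤ d)
    (hsmall : S.card + Q.card ≤ 2 ^ (d - 2 * t)) :
    S.card * d ≤ Q.card * (d - 2 * t) := by
  have hdisj : Disjoint S Q := by
    rw [disjoint_left]
    intro x hx hx'
    have h1 := mem_parityClass.1 (hSp hx)
    have h2 := mem_parityClass.1 (hQp hx')
    rw [h1] at h2
    cases p <;> simp at h2
  have h1 := sum_degIn_le_of_card_le (X := S ∪ Q) (by rwa [card_union_of_disjoint hdisj])
  rw [sum_union hdisj, card_union_of_disjoint hdisj] at h1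
  have h2 : ∑ u ∈ S, degIn Q u ≤ ∑ u ∈ S, degIn (S ∪ Q) u :=
    sum_le_sum fun u _ => degIn_mono subset_union_right u
  have h3 : ∑ u ∈ S, degIn Q u ≤ ∑ u ∈ Q, degIn (S ∪ Q) u := by
    rw [sum_degIn_comm]
    exact sum_le_sum fun u _ => degIn_mono subset_union_left u
  have h4 := card_mul_le_sum_degIn hS
  obtain ⟨m, hm⟩ : ∃ m, d = 2 * t + m := ⟨d - 2 * t, by omega⟩
  rw [show d - 2 * t = m by omega] at h1 ⊢
  have h5 : S.card * d = S.card * (2 * t) + S.card * m := by rw [← mul_add, ← hm]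
  rw [add_mul] at h1
  have h6 : S.card * (2 * t) = S.card * t + S.card * t := by ring
  omega

/-- If `|S|` is not known to be small, it is at most `2|Q|`. -/
lemma card_le_two_mul_of_degIn {S Q : Finset (Fin d → Bool)} {t : ℕ} (hd : 1 ≤ d)
    (hS : ∀ u ∈ S, d ≤ degIn Q u + t) (ht : 2 * t ≤ d) : S.card ≤ 2 * Q.card := by
  have h1 := card_mul_le_sum_degIn hS
  rw [sum_degIn_comm] at h1
  have h2 : ∑ v ∈ Q, degIn S v ≤ Q.card * d := by
    rw [← smul_eq_mul, ← sum_const]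
    exact sum_le_sum fun v _ => (card_filter_le _ _).trans (by simp)
  have h3 : S.card * (2 * t) ≤ S.card * d := Nat.mul_le_mul le_rfl ht
  refine Nat.le_of_mul_le_mul_right (c := d) ?_ hd
  have h6 : S.card * (2 * t) = S.card * t + S.card * t := by ring
  have h7 : 2 * Q.card * d = Q.card * d + Q.card * d := by ring
  omega

end Isoperimetry

/-! ### Connected sets and approximations -/

section Clusters

variable {d : ℕ}

/-- The ball of radius `n` around `x`. -/
def ball : ℕ → (Fin d → Bool) → Finset (Fin d → Bool)
  | 0, x => {x}
  | n + 1, x => (ball n x).biUnion fun y => insert y (nbrs y)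

lemma card_ball_le (n : ℕ) (x : Fin d → Bool) : (ball n x).card ≤ (d + 1) ^ n := by
  induction n with
  | zero => simp [ball]
  | succ n ih =>
    rw [ball, pow_succ]
    refine card_biUnion_le.trans ((sum_le_card_nsmul _ _ (d + 1) fun y _ => ?_).trans ?_)
    · exact (card_insert_le _ _).trans (by rw [card_nbrs])
    · rw [smul_eq_mul]
      exact Nat.mul_le_mul_right _ ih

lemma mem_ball_succ {n : ℕ} {x z : Fin d → Bool} :
    z ∈ ball (n + 1) x ↔ ∃ y ∈ ball n x, z = y ∨ z ∈ nbrs y := by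
  simp [ball]

lemma mem_ball_one {x z : Fin d → Bool} : z ∈ ball 1 x ↔ z = x ∨ z ∈ nbrs x := by
  simp [ball]

lemma mem_ball_trans {m n : ℕ} {x y z : Fin d → Bool} (hy : y ∈ ball m x) (hz : z ∈ ball n y) :
    z ∈ ball (m + n) x := by
  induction n generalizing z with
  | zero =>
    obtain rfl := mem_singleton.1 hz
    exact hy
  | succ n ih =>
    obtain ⟨w, hw, hwz⟩ := mem_ball_succ.1 hz
    exact mem_ball_succ.2 ⟨w, ih hw, hwz⟩

lemma mem_ball_comm {n : ℕ} {x z : Fin d → Bool} (h : z ∈ ball n x) : x ∈ ball n z := by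
  induction n generalizing z with
  | zero => exact mem_singleton.2 (mem_singleton.1 h).symm
  | succ n ih =>
    obtain ⟨y, hy, hyz⟩ := mem_ball_succ.1 h
    have h1 : y ∈ ball 1 z := mem_ball_one.2 (hyz.imp Eq.symm mem_nbrs_comm.1)
    rw [add_comm]
    exact mem_ball_trans h1 (ih hy)

lemma mem_ball_self (n : ℕ) (x : Fin d → Bool) : x ∈ ball n x := by
  induction n with
  | zero => simp [ball]
  | succ n ih => exact mem_ball_succ.2 ⟨x, ih, Or.inl rfl⟩

lemma ball_mono {m n : ℕ} (h : m ≤ n) (x : Fin d → Bool) : ball m x ⊆ ball n x := by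
  intro y hy
  obtain ⟨k, rfl⟩ := Nat.exists_eq_add_of_le h
  exact mem_ball_trans hy (mem_ball_self k y)

lemma flipAt_mem_ball (i : Fin d) (x : Fin d → Bool) : flipAt i x ∈ ball 1 x :=
  mem_ball_one.2 (Or.inr (flipAt_mem_nbrs i x))

lemma flipAt_mem_ball_two (i j : Fin d) (x : Fin d → Bool) :
    flipAt i x ∈ ball 2 (flipAt j x) :=
  mem_ball_trans (m := 1) (n := 1) (mem_ball_comm (flipAt_mem_ball j x)) (flipAt_mem_ball i x)

/-- The sets visited by walks from `x` with `n` steps of length at most `r`. -/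
def visited (r : ℕ) : ℕ → (Fin d → Bool) → Finset (Finset (Fin d → Bool))
  | 0, x => {{x}}
  | n + 1, x => (ball r x).biUnion fun y => (visited r n y).image (insert x)

lemma mem_visited_succ {r n : ℕ} {x : Fin d → Bool} {S : Finset (Fin d → Bool)} :
    S ∈ visited r (n + 1) x ↔ ∃ y ∈ ball r x, ∃ S' ∈ visited r n y, insert x S' = S := by
  simp [visited]

lemma card_visited_le (r n : ℕ) (x : Fin d → Bool) :
    (visited r n x).card ≤ (d + 1) ^ (r * n) := by
  induction n generalizing x with
  | zero => simp [visited]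
  | succ n ih =>
    rw [visited]
    refine card_biUnion_le.trans ((sum_le_card_nsmul _ _ ((d + 1) ^ (r * n)) fun y _ =>
      card_image_le.trans (ih y)).trans ?_)
    rw [smul_eq_mul, mul_add, mul_one, pow_add, mul_comm]
    exact Nat.mul_le_mul_left _ (card_ball_le r x)

lemma mem_of_mem_visited {r n : ℕ} {x : Fin d → Bool} {S : Finset (Fin d → Bool)}
    (h : S ∈ visited r n x) : x ∈ S := by
  cases n with
  | zero => rw [mem_singleton.1 h]; exact mem_singleton_self x
  | succ n =>
    obtain ⟨y, -, S', -, rfl⟩ := mem_visited_succ.1 h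
    exact mem_insert_self _ _

lemma card_le_of_mem_visited {r n : ℕ} {x : Fin d → Bool} {S : Finset (Fin d → Bool)}
    (h : S ∈ visited r n x) : S.card ≤ n + 1 := by
  induction n generalizing x S with
  | zero => rw [mem_singleton.1 h]; simp
  | succ n ih =>
    obtain ⟨y, -, S', hS', rfl⟩ := mem_visited_succ.1 h
    exact (card_insert_le _ _).trans (Nat.succ_le_succ (ih hS'))

lemma visited_mono {r m n : ℕ} (h : m ≤ n) (x : Fin d → Bool) :
    visited r m x ⊆ visited r n x := by
  induction n, h using Nat.le_induction with
  | base => exact Subset.rfl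
  | succ n _ ih =>
    intro S hS
    have := ih hS
    exact mem_visited_succ.2 ⟨x, mem_ball_self r x, S, this,
      insert_eq_self.2 (mem_of_mem_visited this)⟩

lemma insert_mem_visited {r n : ℕ} {x y z : Fin d → Bool} {S : Finset (Fin d → Bool)}
    (hS : S ∈ visited r n x) (hz : z ∈ S) (hy : y ∈ ball r z) :
    insert y S ∈ visited r (n + 2) x := by
  have base : ∀ {n : ℕ} {x : Fin d → Bool} {S : Finset (Fin d → Bool)},
      S ∈ visited r n x → y ∈ ball r x → insert y S ∈ visited r (n + 2) x := by
    intro n x S hS hy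
    refine mem_visited_succ.2 ⟨y, hy, insert y S,
      mem_visited_succ.2 ⟨x, mem_ball_comm hy, S, hS, rfl⟩, ?_⟩
    exact insert_eq_self.2 (mem_insert_of_mem (mem_of_mem_visited hS))
  induction n generalizing x S with
  | zero =>
    obtain rfl := mem_singleton.1 hS
    obtain rfl := mem_singleton.1 hz
    exact base hS hy
  | succ n ih =>
    by_cases hzx : z = x
    · subst hzx
      exact base hS hy
    · obtain ⟨w, hw, S', hS', rfl⟩ := mem_visited_succ.1 hS
      refine mem_visited_succ.2 ⟨w, hw, _, ih hS' ((mem_insert.1 hz).resolve_left hzx), ?_⟩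
      exact insert_comm _ _ _

/-- `K` contains `x` and is connected through steps of length at most `r`. -/
def IsCluster (r : ℕ) (x : Fin d → Bool) (K : Finset (Fin d → Bool)) : Prop :=
  x ∈ K ∧ ∀ T ⊆ K, x ∈ T → T ≠ K → ∃ z ∈ T, ∃ y ∈ K, y ∉ T ∧ y ∈ ball r z

lemma IsCluster.mem_visited {r : ℕ} {x : Fin d → Bool} {K : Finset (Fin d → Bool)}
    (h : IsCluster r x K) {n : ℕ} (hn : K.card ≤ n + 1) : K ∈ visited r (2 * n) x := by
  have key : ∀ m, m + 1 ≤ K.card → ∃ T ⊆ K, T.card = m + 1 ∧ T ∈ visited r (2 * m) x := by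
    intro m
    induction m with
    | zero =>
      intro _
      exact ⟨{x}, singleton_subset_iff.2 h.1, by simp, by simp [visited]⟩
    | succ m ih =>
      intro hm
      obtain ⟨T, hTK, hTc, hT⟩ := ih (by omega)
      have hne : T ≠ K := by rintro rfl; omega
      obtain ⟨z, hz, y, hy, hyT, hyz⟩ := h.2 T hTK (mem_of_mem_visited hT) hne
      exact ⟨insert y T, insert_subset hy hTK, by rw [card_insert_of_notMem hyT, hTc],
        insert_mem_visited hT hz hyz⟩
  have hpos : 0 < K.card := card_pos.2 ⟨x, h.1⟩
  obtain ⟨T, hTK, hTc, hT⟩ := key (K.card - 1) (by omega)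
  rw [eq_of_subset_of_card_le hTK (by omega)] at hT
  exact visited_mono (by omega) x hT

/-- Every point of `A` lies in a cluster that is far from the rest of `A`. -/
lemma exists_isCluster (r : ℕ) {x : Fin d → Bool} {A : Finset (Fin d → Bool)} (hx : x ∈ A) :
    ∃ K ⊆ A, IsCluster r x K ∧ ∀ z ∈ K, ∀ y ∈ A, y ∉ K → y ∉ ball r z := by
  classical
  obtain ⟨K, hK, hmax⟩ := exists_max_image (A.powerset.filter (IsCluster r x)) card
    ⟨{x}, mem_filter.2 ⟨mem_powerset.2 (singleton_subset_iff.2 hx), mem_singleton_self x,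
      fun T hT hxT hne => absurd (hT.antisymm (singleton_subset_iff.2 hxT)) hne⟩⟩
  simp only [mem_filter, mem_powerset] at hK hmax
  refine ⟨K, hK.1, hK.2, fun z hz y hy hyK hyz => ?_⟩
  have := hmax (insert y K) ⟨insert_subset hy hK.1, mem_insert_of_mem hK.2.1, ?_⟩
  · rw [card_insert_of_notMem hyK] at this
    omega
  · intro T hT hxT hne
    by_cases hKT : K ⊆ T
    · refine ⟨z, hKT hz, y, mem_insert_self _ _, fun hyT => hne ?_, hyz⟩
      exact hT.antisymm (insert_subset hyT hKT)
    · obtain ⟨z', hz', y', hy', hyT', h'⟩ := hK.2.2 (T ∩ K) inter_subset_right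
        (mem_inter.2 ⟨hxT, hK.2.1⟩) (fun h => hKT (inter_eq_right.1 h))
      exact ⟨z', (mem_inter.1 hz').1, y', mem_insert_of_mem hy',
        fun h => hyT' (mem_inter.2 ⟨h, hy'⟩), h'⟩

/-- Every set has a small subset whose neighbourhood almost covers the neighbours of each of
its points. -/
lemma exists_approximation (A : Finset (Fin d → Bool)) (t : ℕ) :
    ∃ F ⊆ A, F.card * t ≤ (nbhd F).card ∧ ∀ u ∈ A, d ≤ degIn (nbhd F) u + t := by
  classical
  obtain ⟨F, hF, hmax⟩ := exists_max_image
    (A.powerset.filter fun F => F.card * t ≤ (nbhd F).card) card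
    ⟨∅, mem_filter.2 ⟨empty_mem_powerset _, by simp⟩⟩
  simp only [mem_filter, mem_powerset] at hF hmax
  refine ⟨F, hF.1, hF.2, fun u hu => ?_⟩
  by_contra! hlt
  have hcompl : degIn (nbhd F) u + (univ.filter fun i => flipAt i u ∉ nbhd F).card = d := by
    rw [degIn, card_filter_add_card_filter_not]; simp
  have huF : u ∉ F := by
    intro huF
    have : (univ.filter fun i => flipAt i u ∉ nbhd F).card = 0 := by
      rw [card_eq_zero, filter_eq_empty_iff]
      intro i _ h
      exact h (mem_nbhd.2 ⟨i, by rwa [flipAt_flipAt]⟩)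
    omega
  have hsub : nbhd F ∪ (univ.filter fun i => flipAt i u ∉ nbhd F).image (fun i => flipAt i u)
      ⊆ nbhd (insert u F) := by
    refine union_subset (nbhd_mono (subset_insert _ _)) ?_
    intro v hv
    obtain ⟨i, -, rfl⟩ := mem_image.1 hv
    exact mem_nbhd.2 ⟨i, by rw [flipAt_flipAt]; exact mem_insert_self _ _⟩
  have hdisj : Disjoint (nbhd F)
      ((univ.filter fun i => flipAt i u ∉ nbhd F).image fun i => flipAt i u) := by
    rw [disjoint_right]
    intro v hv
    obtain ⟨i, hi, rfl⟩ := mem_image.1 hv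
    exact (mem_filter.1 hi).2
  have hc := card_le_card hsub
  rw [card_union_of_disjoint hdisj, card_image_of_injective _ (flipAt_left_injective u)] at hc
  have := hmax (insert u F) ⟨insert_subset hu hF.1, by
    rw [card_insert_of_notMem huF, add_mul, one_mul]; omega⟩
  rw [card_insert_of_notMem huF] at this
  omega

end Clusters

/-! ### Adding one cluster at a time -/

section ClusterExpansion

variable {d : ℕ}

/-- The colourings whose set of even vertices not coloured `0` has size at most `k` and is
contained in `Λ`. -/
def within (k : ℕ) (Λ : Finset (Fin d → Bool)) : Finset ((Fin d → Bool) → Fin 3) :=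
  (colourings d).filter fun f => (defects f false 0).card ≤ k ∧ defects f false 0 ⊆ Λ

open Classical in
/-- The colourings whose set of even vertices not coloured `0` is a cluster around `x` of size
at most `k`. -/
noncomputable def clustered (k : ℕ) (x : Fin d → Bool) : Finset ((Fin d → Bool) → Fin 3) :=
  (colourings d).filter fun f => (defects f false 0).card ≤ k ∧ IsCluster 2 x (defects f false 0)

lemma palette_const (hd : 1 ≤ d) {f : (Fin d → Bool) → Fin 3} {a : Fin 3} {v : Fin d → Bool}
    (h : ∀ i, f (flipAt i v) = a) : palette f univ v = {a} := by
  rw [eq_singleton_iff_unique_mem]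
  refine ⟨mem_palette.2 ⟨⟨0, hd⟩, mem_univ _, h _⟩, fun c hc => ?_⟩
  obtain ⟨i, -, hi⟩ := mem_palette.1 hc
  rw [← hi, h i]

lemma card_within_empty (hd : 1 ≤ d) (k : ℕ) :
    (within k (∅ : Finset (Fin d → Bool))).card = 2 ^ 2 ^ (d - 1) := by
  have h1 : within k (∅ : Finset (Fin d → Bool))
      = (colourings d).filter fun g => ∀ x ∈ parityClass d false, g x = 0 := by
    ext f
    simp only [within, mem_filter, subset_empty, defects, filter_eq_empty_iff, not_not]
    refine and_congr_right fun _ => ⟨fun h => h.2, fun h => ⟨?_, h⟩⟩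
    rw [filter_eq_empty_iff.2 fun x hx => not_not.2 (h x hx)]
    simp
  rw [h1, card_extend false fun _ => 0,
    prod_congr rfl fun v _ => by rw [palette_const hd fun i => rfl], prod_const,
    card_parityClass hd]
  rfl

/-- Combine `f` on `C` with `g` outside `C`. -/
def splice (C : Finset (Fin d → Bool)) (f g : (Fin d → Bool) → Fin 3) : (Fin d → Bool) → Fin 3 :=
  fun w => if w ∈ C then f w else g w

lemma splice_splice (C : Finset (Fin d → Bool)) (f g : (Fin d → Bool) → Fin 3) :
    splice C (splice C f g) (splice C g f) = f := by
  funext w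
  simp only [splice]
  split_ifs <;> rfl

lemma splice_mem_colourings {C : Finset (Fin d → Bool)} {f g : (Fin d → Bool) → Fin 3}
    (hf : f ∈ colourings d) (hg : g ∈ colourings d)
    (h : ∀ v ∈ C, ∀ i, flipAt i v ∉ C → f (flipAt i v) = g (flipAt i v)) :
    splice C f g ∈ colourings d := by
  rw [mem_colourings] at hf hg ⊢
  intro v i
  simp only [splice]
  split_ifs with h1 h2 h2
  · exact hf v i
  · have := h _ h1 i (by rwa [flipAt_flipAt])
    rw [flipAt_flipAt] at this
    rw [← this]; exact hf v i
  · rw [← h v h2 i h1]; exact hf v i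
  · exact hg v i

lemma defects_splice (K : Finset (Fin d → Bool)) {f g : (Fin d → Bool) → Fin 3}
    (hK : K ⊆ parityClass d false) (a : Fin 3) :
    defects (splice (K ∪ nbhd K) f g) false a
      = (defects f false a ∩ K) ∪ (defects g false a \ K) := by
  ext w
  simp only [mem_defects, mem_union, mem_inter, mem_sdiff, splice]
  by_cases hw : parity w = false
  · have : w ∉ nbhd K := fun h => by
      have := parity_of_mem_nbhd hK h
      rw [hw] at this
      simp at this
    by_cases hwK : w ∈ K <;> simp [hw, hwK, this]
  · simp [hw]

lemma card_cluster_mul_le (k : ℕ) {x : Fin d → Bool} {Λ : Finset (Fin d → Bool)} :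
    ((within k (insert x Λ)).filter fun f => x ∈ defects f false 0).card
        * (within k (∅ : Finset (Fin d → Bool))).card
      ≤ (within k Λ).card * (clustered k x).card := by
  classical
  have hex : ∀ f : (Fin d → Bool) → Fin 3, ∃ K, x ∈ defects f false 0 → K ⊆ defects f false 0 ∧
      IsCluster 2 x K ∧ ∀ z ∈ K, ∀ y ∈ defects f false 0, y ∉ K → y ∉ ball 2 z := by
    intro f
    by_cases hx : x ∈ defects f false 0
    · obtain ⟨K, h⟩ := exists_isCluster 2 hx
      exact ⟨K, fun _ => h⟩
    · exact ⟨∅, fun h => absurd h hx⟩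
  choose K hK using hex
  rw [mul_comm (within k Λ).card, ← card_product, ← card_product]
  refine card_le_card_of_injOn
    (fun q => (splice (K q.1 ∪ nbhd (K q.1)) q.1 q.2, splice (K q.1 ∪ nbhd (K q.1)) q.2 q.1)) ?_ ?_
  · rintro ⟨f, g⟩ hq
    simp only [coe_product, Set.mem_prod, mem_coe, mem_filter, within] at hq
    obtain ⟨⟨⟨hf, hfk, hfΛ⟩, hx⟩, hg, -, hg0⟩ := hq
    obtain ⟨hKA, hKc, hKs⟩ := hK f hx
    rw [subset_empty] at hg0
    have hKp : K f ⊆ parityClass d false := hKA.trans (filter_subset _ _)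
    have hagree : ∀ v ∈ K f ∪ nbhd (K f), ∀ i, flipAt i v ∉ K f ∪ nbhd (K f) →
        f (flipAt i v) = 0 ∧ g (flipAt i v) = 0 := by
      intro v hv i hw
      rw [mem_union, not_or] at hw
      have hvK : v ∉ K f := fun h => hw.2 (mem_nbhd.2 ⟨i, by rwa [flipAt_flipAt]⟩)
      have hvN := (mem_union.1 hv).resolve_left hvK
      have hpw : parity (flipAt i v) = false := by
        rw [parity_flipAt, parity_of_mem_nbhd hKp hvN]; rfl
      obtain ⟨j, hj⟩ := mem_nbhd.1 hvN
      constructor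
      · by_contra h0
        exact hKs _ hj _ (mem_defects.2 ⟨hpw, h0⟩) hw.1 (flipAt_mem_ball_two i j v)
      · by_contra h0
        have : flipAt i v ∈ defects g false 0 := mem_defects.2 ⟨hpw, h0⟩
        rw [hg0] at this
        exact notMem_empty _ this
    have hd1 : defects (splice (K f ∪ nbhd (K f)) f g) false 0 = K f := by
      rw [defects_splice _ hKp, hg0, empty_sdiff, union_empty, inter_eq_right.2 hKA]
    have hd2 : defects (splice (K f ∪ nbhd (K f)) g f) false 0 = defects f false 0 \ K f := by
      rw [defects_splice _ hKp, hg0, empty_inter, empty_union]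
    simp only [coe_product, Set.mem_prod, mem_coe, mem_filter, within, clustered, hd1, hd2]
    refine ⟨⟨?_, (card_le_card hKA).trans hfk, hKc⟩, ?_, (card_le_card sdiff_subset).trans hfk, ?_⟩
    · exact splice_mem_colourings hf hg fun v hv i hw =>
        (hagree v hv i hw).1.trans (hagree v hv i hw).2.symm
    · exact splice_mem_colourings hg hf fun v hv i hw =>
        (hagree v hv i hw).2.trans (hagree v hv i hw).1.symm
    · intro w hw
      rw [mem_sdiff] at hw
      refine (mem_insert.1 (hfΛ hw.1)).resolve_left ?_
      rintro rfl
      exact hw.2 hKc.1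
  · rintro ⟨f, g⟩ hq ⟨f', g'⟩ hq' heq
    simp only [coe_product, Set.mem_prod, mem_coe, mem_filter, within] at hq hq'
    obtain ⟨⟨-, hx⟩, -, -, hg0⟩ := hq
    obtain ⟨⟨-, hx'⟩, -, -, hg0'⟩ := hq'
    rw [subset_empty] at hg0 hg0'
    simp only [Prod.mk.injEq] at heq
    have hd1 : ∀ (f g : (Fin d → Bool) → Fin 3), x ∈ defects f false 0 → defects g false 0 = ∅ →
        defects (splice (K f ∪ nbhd (K f)) f g) false 0 = K f := by
      intro f g hx hg0
      rw [defects_splice _ ((hK f hx).1.trans (filter_subset _ _)), hg0, empty_sdiff, union_empty,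
        inter_eq_right.2 (hK f hx).1]
    have hKK : K f = K f' := by
      rw [← hd1 f g hx hg0, heq.1, hd1 f' g' hx' hg0']
    rw [← hKK] at heq
    have h1 := splice_splice (K f ∪ nbhd (K f)) f g
    have h2 := splice_splice (K f ∪ nbhd (K f)) g f
    rw [heq.1, heq.2, splice_splice] at h1
    rw [heq.1, heq.2, splice_splice] at h2
    rw [h1, h2]

lemma card_within_insert_le (hd : 1 ≤ d) (k : ℕ) (x : Fin d → Bool) (Λ : Finset (Fin d → Bool)) :
    ((within k (insert x Λ)).card : ℝ)
      ≤ (within k Λ).card * (1 + (clustered k x).card / 2 ^ 2 ^ (d - 1)) := by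
  have h1 := card_cluster_mul_le k (x := x) (Λ := Λ)
  rw [card_within_empty hd] at h1
  have h2 : (within k (insert x Λ)).card
      ≤ ((within k (insert x Λ)).filter fun f => x ∈ defects f false 0).card
        + (within k Λ).card := by
    rw [← card_filter_add_card_filter_not (s := within k (insert x Λ))
      fun f => x ∈ defects f false 0]
    refine Nat.add_le_add_left (card_le_card fun f hf => ?_) _
    simp only [within, mem_filter] at hf ⊢
    exact ⟨hf.1.1, hf.1.2.1, (subset_insert_iff_of_notMem hf.2).1 hf.1.2.2⟩
  have h3 : ((((within k (insert x Λ)).filter fun f => x ∈ defects f false 0).card : ℕ) : ℝ)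
      ≤ (within k Λ).card * (clustered k x).card / 2 ^ 2 ^ (d - 1) := by
    rw [le_div_iff₀ (by positivity)]
    exact_mod_cast h1
  have h4 : ((within k (insert x Λ)).card : ℝ)
      ≤ ((((within k (insert x Λ)).filter fun f => x ∈ defects f false 0).card : ℕ) : ℝ)
        + (within k Λ).card := by exact_mod_cast h2
  rw [mul_add, mul_one, ← mul_div_assoc]
  linarith

theorem card_nearGround_le_pow (hd : 1 ≤ d) (k : ℕ) {y : ℝ}
    (hy : ∀ x : Fin d → Bool, ((clustered k x).card : ℝ) ≤ y * 2 ^ 2 ^ (d - 1)) :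
    ((nearGround d false 0 k).card : ℝ) ≤ 2 ^ 2 ^ (d - 1) * (1 + y) ^ 2 ^ (d - 1) := by
  have hy0 : 0 ≤ y := by
    have := (Nat.cast_nonneg _).trans (hy fun _ => false)
    exact nonneg_of_mul_nonneg_left this (by positivity)
  have key : ∀ Λ : Finset (Fin d → Bool),
      ((within k Λ).card : ℝ) ≤ 2 ^ 2 ^ (d - 1) * (1 + y) ^ Λ.card := by
    intro Λ
    induction Λ using Finset.induction_on with
    | empty => rw [card_within_empty hd]; simp
    | insert x Λ hx ih =>
      refine (card_within_insert_le hd k x Λ).trans ?_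
      rw [card_insert_of_notMem hx, pow_succ, ← mul_assoc]
      refine mul_le_mul ih ?_ (by positivity) (by positivity)
      gcongr
      rw [div_le_iff₀ (by positivity)]
      exact hy x
  have h1 : nearGround d false 0 k = within k (parityClass d false) := by
    ext f
    simp only [nearGround, within, mem_filter]
    exact and_congr_right fun _ => ⟨fun h => ⟨h, filter_subset _ _⟩, fun h => h.1⟩
  rw [h1]
  refine (key _).trans (le_of_eq ?_)
  rw [card_parityClass hd]

end ClusterExpansion

/-! ### Counting colourings through their restriction to the even vertices -/

section Fibres

variable {d : ℕ}

/-- The odd vertices that see at least two colours. -/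
def mixed (f : (Fin d → Bool) → Fin 3) : Finset (Fin d → Bool) :=
  (parityClass d true).filter fun v => 1 < (palette f univ v).card

lemma card_extensions_mul_le (hd : 1 ≤ d) (f : (Fin d → Bool) → Fin 3) :
    ((colourings d).filter fun g => ∀ x ∈ parityClass d false, g x = f x).card
      * 2 ^ (mixed f).card ≤ 2 ^ 2 ^ (d - 1) := by
  rw [card_extend false f, ← prod_const, mixed, prod_filter, ← card_parityClass hd true,
    ← prod_const, Bool.not_false, ← prod_mul_distrib]
  refine prod_le_prod' fun v _ => ?_
  have := one_le_card_palette hd f v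
  split_ifs <;> omega

/-- Replace the colours of the odd vertices by `0`. -/
def evenPart (f : (Fin d → Bool) → Fin 3) : (Fin d → Bool) → Fin 3 :=
  fun w => if parity w = false then f w else 0

lemma card_mul_le_card_image (hd : 1 ≤ d) {Φ : Finset ((Fin d → Bool) → Fin 3)} {b : ℕ}
    (hΦ : Φ ⊆ colourings d) (hb : ∀ f ∈ Φ, b ≤ (mixed f).card) :
    Φ.card * 2 ^ b ≤ (Φ.image evenPart).card * 2 ^ 2 ^ (d - 1) := by
  rw [card_eq_sum_card_image evenPart Φ, sum_mul, ← smul_eq_mul (a := (Φ.image evenPart).card)]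
  refine sum_le_card_nsmul _ _ _ fun h hh => ?_
  obtain ⟨f, hf, rfl⟩ := mem_image.1 hh
  refine le_trans ?_ (card_extensions_mul_le hd f)
  refine Nat.mul_le_mul (card_le_card fun g hg => ?_) (Nat.pow_le_pow_right two_pos (hb f hf))
  rw [mem_filter] at hg ⊢
  refine ⟨hΦ hg.1, fun x hx => ?_⟩
  have := congrFun hg.2 x
  simpa [evenPart, mem_parityClass.1 hx] using this

lemma nbhd_defects_subset_mixed {f : (Fin d → Bool) → Fin 3}
    (h : (defects f false 0).card < d) : nbhd (defects f false 0) ⊆ mixed f := by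
  intro v hv
  have hp : parity v = true := parity_of_mem_nbhd (filter_subset _ _) hv
  obtain ⟨i, hi⟩ := mem_nbhd.1 hv
  obtain ⟨j, hj⟩ : ∃ j, flipAt j v ∉ defects f false 0 := by
    by_contra! hall
    have := card_le_card (image_subset_iff.2 fun j (_ : j ∈ (univ : Finset (Fin d))) => hall j)
    rw [card_image_of_injective _ (flipAt_left_injective v), card_univ, Fintype.card_fin] at this
    omega
  have hj' : f (flipAt j v) = 0 := by
    by_contra h0
    exact hj (mem_defects.2 ⟨by rw [parity_flipAt, hp]; rfl, h0⟩)
  refine mem_filter.2 ⟨mem_parityClass.2 hp, one_lt_card.2 ⟨_, flipAt_mem_palette (mem_univ i), _,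
    flipAt_mem_palette (mem_univ j), ?_⟩⟩
  rw [hj']
  exact (mem_defects.1 hi).2

/-- The even vertices of colour `c`. -/
def evenClass (f : (Fin d → Bool) → Fin 3) (c : Fin 3) : Finset (Fin d → Bool) :=
  (parityClass d false).filter fun w => f w = c

lemma mem_evenClass {f : (Fin d → Bool) → Fin 3} {c : Fin 3} {w : Fin d → Bool} :
    w ∈ evenClass f c ↔ parity w = false ∧ f w = c := by simp [evenClass]

lemma defects_zero_eq (f : (Fin d → Bool) → Fin 3) :
    defects f false 0 = evenClass f 1 ∪ evenClass f 2 := by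
  ext w
  simp only [mem_defects, mem_union, mem_evenClass, ← and_or_left]
  refine and_congr_right fun _ => ?_
  generalize f w = c
  fin_cases c <;> simp

lemma evenPart_eq_of_evenClass {f g : (Fin d → Bool) → Fin 3}
    (h1 : evenClass f 1 = evenClass g 1) (h2 : evenClass f 2 = evenClass g 2) :
    evenPart f = evenPart g := by
  funext w
  simp only [evenPart]
  split_ifs with hw
  · have e1 := Finset.ext_iff.1 h1 w
    have e2 := Finset.ext_iff.1 h2 w
    simp only [mem_evenClass, hw, true_and] at e1 e2
    generalize f w = a at *
    generalize g w = b at *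
    fin_cases a <;> fin_cases b <;> simp_all
  · rfl

lemma evenClass_evenPart (f : (Fin d → Bool) → Fin 3) (c : Fin 3) :
    evenClass (evenPart f) c = evenClass f c := by
  ext w
  simp only [mem_evenClass, evenPart]
  refine and_congr_right fun hw => ?_
  rw [if_pos hw]

/-! ### Small clusters -/

lemma card_common_nbrs_le {x y : Fin d → Bool} (h : x ≠ y) :
    (nbrs x ∩ nbrs y).card ≤ 2 := by
  have hinj : (nbrs x ∩ nbrs y).card = (univ.filter fun i => flipAt i x ∈ nbrs y).card := by
    rw [← card_image_of_injective _ (flipAt_left_injective x)]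
    congr 1
    ext v
    simp only [mem_inter, mem_nbrs, mem_image, mem_filter, mem_univ, true_and]
    constructor
    · rintro ⟨⟨i, rfl⟩, hy⟩; exact ⟨i, hy, rfl⟩
    · rintro ⟨i, hy, rfl⟩; exact ⟨⟨i, rfl⟩, hy⟩
  rw [hinj]
  have key : ∀ i, flipAt i x ∈ nbrs y → x i ≠ y i ∧ ∃ j, ∀ z, x z ≠ y z → z = i ∨ z = j := by
    intro i hi
    obtain ⟨j, hj⟩ := mem_nbrs.1 hi
    have hij : i ≠ j := by
      rintro rfl
      exact h (flipAt_injective _ hj).symm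
    refine ⟨fun hxy => ?_, j, fun z hz => ?_⟩
    · have := congrFun hj i
      rw [flipAt_same, flipAt_of_ne hij, hxy] at this
      cases hyi : y i <;> simp [hyi] at this
    · by_contra! hzz
      have := congrFun hj z
      rw [flipAt_of_ne hzz.1, flipAt_of_ne hzz.2] at this
      exact hz this.symm
  rcases (univ.filter fun i => flipAt i x ∈ nbrs y).eq_empty_or_nonempty with he | ⟨i, hi⟩
  · rw [he]; simp
  · obtain ⟨-, j, hj⟩ := key i (mem_filter.1 hi).2
    have hsub : (univ.filter fun i => flipAt i x ∈ nbrs y) ⊆ {i, j} := fun z hz => by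
      have := hj z (key z (mem_filter.1 hz).2).1
      simpa using this
    exact (card_le_card hsub).trans card_le_two

lemma card_mul_le_card_nbhd_add (A : Finset (Fin d → Bool)) :
    A.card * d ≤ (nbhd A).card + A.card * A.card := by
  induction A using Finset.induction_on with
  | empty => simp
  | insert x A hx ih =>
    have h1 : nbhd (insert x A) = nbhd A ∪ nbrs x := by
      rw [nbhd, biUnion_insert, union_comm]; rfl
    have h2 : (nbrs x ∩ nbhd A).card ≤ A.card * 2 := by
      have : nbrs x ∩ nbhd A = A.biUnion fun y => nbrs x ∩ nbrs y := by
        ext v; simp only [nbhd, mem_inter, mem_biUnion]; tauto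
      rw [this]
      refine card_biUnion_le.trans (sum_le_card_nsmul _ _ 2 fun y hy => card_common_nbrs_le ?_)
      rintro rfl
      exact hx hy
    have h3 := card_union_add_card_inter (nbhd A) (nbrs x)
    rw [inter_comm, card_nbrs] at h3
    rw [h1, card_insert_of_notMem hx]
    have h4 : (A.card + 1) * (A.card + 1) = A.card * A.card + A.card * 2 + 1 := by ring
    have h5 : (A.card + 1) * d = A.card * d + d := by ring
    omega

lemma mul_le_card_nbhd_add {A : Finset (Fin d → Bool)} {m : ℕ} (hm : m ≤ A.card) :
    m * d ≤ (nbhd A).card + m * m := by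
  obtain ⟨B, hB, rfl⟩ := exists_subset_card_eq hm
  exact (card_mul_le_card_nbhd_add B).trans
    (Nat.add_le_add_right (card_le_card (nbhd_mono hB)) _)

lemma card_singleton_clusters_le (hd : 2 ≤ d) (k : ℕ) (x : Fin d → Bool) :
    ((clustered k x).filter fun f => (defects f false 0).card ≤ 1).card * 2 ^ d
      ≤ 2 * 2 ^ 2 ^ (d - 1) := by
  classical
  set Φ := (clustered k x).filter fun f => (defects f false 0).card ≤ 1 with hΦ
  have hdef : ∀ f ∈ Φ, defects f false 0 = {x} := by
    intro f hf
    simp only [hΦ, clustered, mem_filter] at hf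
    exact (eq_of_subset_of_card_le (singleton_subset_iff.2 hf.1.2.2.1) (by simpa using hf.2)).symm
  refine (card_mul_le_card_image (by omega) (b := d) (Φ := Φ) ?_ fun f hf => ?_).trans ?_
  · intro f hf
    simp only [hΦ, clustered, mem_filter] at hf
    exact hf.1.1
  · have h1 := nbhd_defects_subset_mixed (f := f) (by rw [hdef f hf, card_singleton]; omega)
    have h2 : (nbhd (defects f false 0)).card = d := by
      rw [hdef f hf, nbhd, singleton_biUnion, card_nbrs]
    exact h2.symm.le.trans (card_le_card h1)
  · refine Nat.mul_le_mul_right _ ?_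
    have hsub : Φ.image evenPart
        ⊆ ({1, 2} : Finset (Fin 3)).image fun c w => if w = x then c else 0 := by
      intro h hh
      obtain ⟨f, hf, rfl⟩ := mem_image.1 hh
      have hx : x ∈ defects f false 0 := by rw [hdef f hf]; exact mem_singleton_self x
      rw [mem_defects] at hx
      refine mem_image.2 ⟨f x, ?_, funext fun w => ?_⟩
      · have := hx.2
        generalize f x = c at this ⊢
        fin_cases c <;> simp_all
      · simp only [evenPart]
        split_ifs with h1 h2 h2
        · rw [h1]
        · rw [h1] at h2; exact absurd hx.1 h2
        · by_contra h0
          have : w ∈ defects f false 0 := mem_defects.2 ⟨h2, Ne.symm h0⟩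
          rw [hdef f hf] at this
          exact h1 (mem_singleton.1 this)
        · rfl
    exact (card_le_card hsub).trans (card_image_le.trans card_le_two)

lemma card_small_clusters_le {m : ℕ} (hm : m + 1 < d) (k : ℕ) (x : Fin d → Bool) :
    ((clustered k x).filter fun f =>
        1 < (defects f false 0).card ∧ (defects f false 0).card ≤ m + 1).card * 2 ^ (2 * d - 4)
      ≤ (d + 1) ^ (2 * (2 * m)) * (2 ^ (2 * m + 1) * 2 ^ (2 * m + 1)) * 2 ^ 2 ^ (d - 1) := by
  classical
  set Φ := (clustered k x).filter fun f =>
    1 < (defects f false 0).card ∧ (defects f false 0).card ≤ m + 1 with hΦ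
  have hmem : ∀ f ∈ Φ, f ∈ colourings d ∧ IsCluster 2 x (defects f false 0) ∧
      1 < (defects f false 0).card ∧ (defects f false 0).card ≤ m + 1 := by
    intro f hf
    simp only [hΦ, clustered, mem_filter] at hf
    exact ⟨hf.1.1, hf.1.2.2, hf.2⟩
  refine (card_mul_le_card_image (by omega) (b := 2 * d - 4) (Φ := Φ) (fun f hf => (hmem f hf).1)
    fun f hf => ?_).trans ?_
  · have h1 := card_le_card (nbhd_defects_subset_mixed (f := f)
      ((hmem f hf).2.2.2.trans_lt hm))
    have h2 := mul_le_card_nbhd_add (hmem f hf).2.2.1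
    omega
  · refine Nat.mul_le_mul_right _ ?_
    set 𝒟 := (visited 2 (2 * m) x).biUnion fun S => S.powerset ×ˢ S.powerset with h𝒟
    have hcard : 𝒟.card ≤ (d + 1) ^ (2 * (2 * m)) * (2 ^ (2 * m + 1) * 2 ^ (2 * m + 1)) := by
      refine card_biUnion_le.trans ((sum_le_card_nsmul _ _ _ fun S hS => ?_).trans
        (Nat.mul_le_mul_right _ (card_visited_le 2 (2 * m) x)))
      rw [card_product, card_powerset]
      have := Nat.pow_le_pow_right two_pos (card_le_of_mem_visited hS)
      exact Nat.mul_le_mul this this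
    refine (card_le_card_of_injOn (fun h => (evenClass h 1, evenClass h 2)) ?_ ?_).trans hcard
    · intro h hh
      obtain ⟨f, hf, rfl⟩ := mem_image.1 (mem_coe.1 hh)
      simp only [evenClass_evenPart, h𝒟, mem_coe, mem_biUnion, mem_product, mem_powerset]
      refine ⟨defects f false 0, (hmem f hf).2.1.mem_visited (hmem f hf).2.2.2, ?_⟩
      rw [defects_zero_eq]
      exact ⟨subset_union_left, subset_union_right⟩
    · intro h hh h' hh' heq
      obtain ⟨f, hf, rfl⟩ := mem_image.1 (mem_coe.1 hh)
      obtain ⟨f', hf', rfl⟩ := mem_image.1 (mem_coe.1 hh')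
      simp only [evenClass_evenPart, Prod.mk.injEq] at heq
      exact evenPart_eq_of_evenClass heq.1 heq.2

end Fibres

/-! ### Large clusters -/

section Containers

variable {d : ℕ}

lemma IsCluster.of_near {x : Fin d → Bool} {A R : Finset (Fin d → Bool)} (hA : IsCluster 2 x A)
    (hAR : ∀ u ∈ A, ∃ r ∈ R, r ∈ ball 2 u) (hRA : ∀ r ∈ R, ∃ a ∈ A, a ∈ ball 1 r) :
    IsCluster 6 x (insert x R) := by
  refine ⟨mem_insert_self _ _, fun T hT hxT hne => ?_⟩
  set U := A.filter fun u => ∃ s ∈ T, s ∈ ball 2 u with hU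
  have hxU : x ∈ U := mem_filter.2 ⟨hA.1, x, hxT, mem_ball_self 2 x⟩
  by_cases hUA : U = A
  · obtain ⟨r, hr, hrT⟩ : ∃ r ∈ insert x R, r ∉ T := by
      by_contra! h
      exact hne (hT.antisymm h)
    have hrR : r ∈ R := (mem_insert.1 hr).resolve_left fun h => hrT (h ▸ hxT)
    obtain ⟨a, ha, har⟩ := hRA r hrR
    rw [← hUA] at ha
    obtain ⟨s, hs, hsa⟩ := (mem_filter.1 ha).2
    exact ⟨s, hs, r, hr, hrT, ball_mono (by norm_num) _
      (mem_ball_trans (mem_ball_comm hsa) (mem_ball_comm har))⟩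
  · obtain ⟨z, hz, y, hy, hyU, hyz⟩ := hA.2 U (filter_subset _ _) hxU hUA
    obtain ⟨s, hs, hsz⟩ := (mem_filter.1 hz).2
    obtain ⟨r, hr, hry⟩ := hAR y hy
    refine ⟨s, hs, r, mem_insert_of_mem hr, fun hrT => hyU (mem_filter.2 ⟨hy, r, hrT, hry⟩), ?_⟩
    exact mem_ball_trans (m := 4) (n := 2)
      (mem_ball_trans (m := 2) (n := 2) (mem_ball_comm hsz) hyz) hry

/-- The odd vertices all of whose neighbours have colour `c`. -/
def enclosed (f : (Fin d → Bool) → Fin 3) (c : Fin 3) : Finset (Fin d → Bool) :=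
  (parityClass d true).filter fun v => palette f univ v = {c}

lemma nbhd_subset_evenClass {f : (Fin d → Bool) → Fin 3} {c : Fin 3} {G : Finset (Fin d → Bool)}
    (hG : G ⊆ enclosed f c) : nbhd G ⊆ evenClass f c := by
  intro u hu
  obtain ⟨i, hi⟩ := mem_nbhd.1 hu
  obtain ⟨hp, hc⟩ := mem_filter.1 (hG hi)
  rw [mem_parityClass, parity_flipAt] at hp
  have h := flipAt_mem_palette (f := f) (x := flipAt i u) (mem_univ i)
  rw [hc, flipAt_flipAt, mem_singleton] at h
  exact mem_evenClass.2 ⟨by simpa using hp, h⟩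

lemma evenClass_subset_defects {f : (Fin d → Bool) → Fin 3} {c : Fin 3} (hc : c ≠ 0) :
    evenClass f c ⊆ defects f false 0 := fun w hw => by
  rw [mem_evenClass] at hw
  exact mem_defects.2 ⟨hw.1, hw.2 ▸ hc⟩

lemma nbhd_defects_subset (f : (Fin d → Bool) → Fin 3) :
    nbhd (defects f false 0) ⊆ mixed f ∪ (enclosed f 1 ∪ enclosed f 2) := by
  intro v hv
  have hp : parity v = true := parity_of_mem_nbhd (filter_subset _ _) hv
  obtain ⟨i, hi⟩ := mem_nbhd.1 hv
  have hi0 := (mem_defects.1 hi).2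
  have hmem := flipAt_mem_palette (f := f) (x := v) (mem_univ i)
  simp only [mem_union, mixed, enclosed, mem_filter, mem_parityClass, hp, true_and]
  rcases lt_or_ge 1 (palette f univ v).card with h | h
  · exact Or.inl h
  · right
    have hs : palette f univ v = {f (flipAt i v)} :=
      (eq_of_subset_of_card_le (singleton_subset_iff.2 hmem) (by simpa using h)).symm
    rw [hs]
    generalize f (flipAt i v) = c at hi0
    fin_cases c <;> simp_all

/-- `F` is a subset of `A` whose neighbourhood contains all but `t` of the neighbours of every
element of `A`. -/
def Approximates (t : ℕ) (F A : Finset (Fin d → Bool)) : Prop :=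
  F ⊆ A ∧ ∀ u ∈ A, d ≤ degIn (nbhd F) u + t

lemma Approximates.exists_mem_ball {t : ℕ} {F A : Finset (Fin d → Bool)}
    (h : Approximates t F A) (ht : t < d) {u : Fin d → Bool} (hu : u ∈ A) :
    ∃ r ∈ F, r ∈ ball 2 u := by
  have h1 := h.2 u hu
  obtain ⟨i, hi⟩ : (univ.filter fun i => flipAt i u ∈ nbhd F).Nonempty := by
    rw [← card_pos]
    change 0 < degIn (nbhd F) u
    omega
  obtain ⟨j, hj⟩ := mem_nbhd.1 (mem_filter.1 hi).2
  exact ⟨_, hj, mem_ball_trans (m := 1) (n := 1) (flipAt_mem_ball i u) (flipAt_mem_ball j _)⟩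

/-- The even vertices with at most `t` neighbours outside the neighbourhood of `F`. -/
def hull (t : ℕ) (F : Finset (Fin d → Bool)) : Finset (Fin d → Bool) :=
  (parityClass d false).filter fun u => d ≤ degIn (nbhd F) u + t

lemma evenClass_subset_hull {f : (Fin d → Bool) → Fin 3} {c : Fin 3} {t : ℕ}
    {F : Finset (Fin d → Bool)} (h : Approximates t F (evenClass f c)) :
    evenClass f c ⊆ hull t F := fun u hu =>
  mem_filter.2 ⟨mem_parityClass.2 (mem_evenClass.1 hu).1, h.2 u hu⟩

lemma ne_zero_of_mem_hull {f : (Fin d → Bool) → Fin 3} (hf : f ∈ colourings d) {t : ℕ}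
    (ht : 2 * t < d) {F₁ F₂ : Finset (Fin d → Bool)} (h₁ : F₁ ⊆ evenClass f 1)
    (h₂ : F₂ ⊆ evenClass f 2) {u : Fin d → Bool} (hu₁ : u ∈ hull t F₁) (hu₂ : u ∈ hull t F₂) :
    f u ≠ 0 := by
  have d₁ := (mem_filter.1 hu₁).2
  have d₂ := (mem_filter.1 hu₂).2
  obtain ⟨i, hi⟩ : ((univ.filter fun i => flipAt i u ∈ nbhd F₁)
      ∩ (univ.filter fun i => flipAt i u ∈ nbhd F₂)).Nonempty := by
    rw [← card_pos]
    have h := card_union_add_card_inter (univ.filter fun i => flipAt i u ∈ nbhd F₁)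
      (univ.filter fun i => flipAt i u ∈ nbhd F₂)
    have h' := card_le_univ ((univ.filter fun i => flipAt i u ∈ nbhd F₁)
      ∪ (univ.filter fun i => flipAt i u ∈ nbhd F₂))
    rw [Fintype.card_fin] at h'
    unfold degIn at d₁ d₂
    omega
  simp only [mem_inter, mem_filter, mem_univ, true_and] at hi
  obtain ⟨j₁, hj₁⟩ := mem_nbhd.1 hi.1
  obtain ⟨j₂, hj₂⟩ := mem_nbhd.1 hi.2
  have e₁ := (mem_evenClass.1 (h₁ hj₁)).2
  have e₂ := (mem_evenClass.1 (h₂ hj₂)).2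
  have n₁ := mem_colourings.1 hf (flipAt i u) j₁
  have n₂ := mem_colourings.1 hf (flipAt i u) j₂
  have n₃ := mem_colourings.1 hf u i
  rw [e₁] at n₁
  rw [e₂] at n₂
  generalize f (flipAt i u) = a at *
  generalize f u = b at *
  rintro rfl
  fin_cases a <;> simp_all

/-- The possible colours of an even vertex given approximations to the colour classes. -/
def options (t : ℕ) (F₁ F₂ G₁ G₂ : Finset (Fin d → Bool)) (u : Fin d → Bool) : Finset (Fin 3) :=
  if u ∈ nbhd G₁ then {1} else if u ∈ nbhd G₂ then {2}
  else if u ∈ hull t F₁ then (if u ∈ hull t F₂ then {1, 2} else {0, 1})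
  else if u ∈ hull t F₂ then {0, 2} else {0}

lemma card_options_le (t : ℕ) (F₁ F₂ G₁ G₂ : Finset (Fin d → Bool)) (u : Fin d → Bool) :
    (options t F₁ F₂ G₁ G₂ u).card
      ≤ if u ∈ (hull t F₁ ∪ hull t F₂) \ (nbhd G₁ ∪ nbhd G₂) then 2 else 1 := by
  simp only [options, mem_sdiff, mem_union]
  by_cases h1 : u ∈ nbhd G₁ <;> by_cases h2 : u ∈ nbhd G₂ <;> by_cases h3 : u ∈ hull t F₁ <;>
    by_cases h4 : u ∈ hull t F₂ <;> simp [h1, h2, h3, h4]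

lemma evenPart_mem_options {f : (Fin d → Bool) → Fin 3} (hf : f ∈ colourings d) {t : ℕ}
    (ht : 2 * t < d) {F₁ F₂ G₁ G₂ : Finset (Fin d → Bool)}
    (hF₁ : Approximates t F₁ (evenClass f 1)) (hF₂ : Approximates t F₂ (evenClass f 2))
    (hG₁ : G₁ ⊆ enclosed f 1) (hG₂ : G₂ ⊆ enclosed f 2) (u : Fin d → Bool) :
    evenPart f u ∈ options t F₁ F₂ G₁ G₂ u := by
  unfold options
  split_ifs with h1 h2 h3 h4 h4
  · have := mem_evenClass.1 (nbhd_subset_evenClass hG₁ h1)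
    simp [evenPart, this.1, this.2]
  · have := mem_evenClass.1 (nbhd_subset_evenClass hG₂ h2)
    simp [evenPart, this.1, this.2]
  · have h0 := ne_zero_of_mem_hull hf ht hF₁.1 hF₂.1 h3 h4
    have hp := mem_parityClass.1 (mem_filter.1 h3).1
    simp only [evenPart, hp, if_true]
    generalize f u = c at h0
    fin_cases c <;> simp_all
  · have hp := mem_parityClass.1 (mem_filter.1 h3).1
    have := fun h => h4 (evenClass_subset_hull hF₂ (mem_evenClass.2 ⟨hp, h⟩))
    simp only [evenPart, hp, if_true]
    generalize f u = c at this
    fin_cases c <;> simp_all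
  · have hp := mem_parityClass.1 (mem_filter.1 h4).1
    have := fun h => h3 (evenClass_subset_hull hF₁ (mem_evenClass.2 ⟨hp, h⟩))
    simp only [evenPart, hp, if_true]
    generalize f u = c at this
    fin_cases c <;> simp_all
  · rw [mem_singleton, evenPart]
    split_ifs with hp
    · have e1 := fun h => h3 (evenClass_subset_hull hF₁ (mem_evenClass.2 ⟨hp, h⟩))
      have e2 := fun h => h4 (evenClass_subset_hull hF₂ (mem_evenClass.2 ⟨hp, h⟩))
      generalize f u = c at e1 e2
      fin_cases c <;> simp_all
    · rfl

lemma card_image_evenPart_le {Φ : Finset ((Fin d → Bool) → Fin 3)} {t : ℕ}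
    {F₁ F₂ G₁ G₂ : Finset (Fin d → Bool)}
    (h : ∀ f ∈ Φ, ∀ u, evenPart f u ∈ options t F₁ F₂ G₁ G₂ u) :
    (Φ.image evenPart).card
      ≤ 2 ^ ((hull t F₁ ∪ hull t F₂) \ (nbhd G₁ ∪ nbhd G₂)).card := by
  have hsub : Φ.image evenPart ⊆ Fintype.piFinset (options t F₁ F₂ G₁ G₂) := by
    refine image_subset_iff.2 fun f hf => Fintype.mem_piFinset.2 (h f hf)
  refine (card_le_card hsub).trans ?_
  rw [Fintype.card_piFinset]
  refine (prod_le_prod' fun u _ => card_options_le t F₁ F₂ G₁ G₂ u).trans ?_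
  rw [prod_ite, prod_const, prod_const_one, mul_one]
  exact Nat.pow_le_pow_right two_pos (card_le_card fun u hu => (mem_filter.1 hu).2)

lemma card_hull_union_mul_le {t k g : ℕ} (hd : 1 ≤ d) (ht : 2 * t < d)
    (hk : 3 * (k * d) ≤ 2 ^ (d - 2 * t)) {A F₁ F₂ : Finset (Fin d → Bool)}
    (hA : A ⊆ parityClass d false) (hAk : A.card ≤ k) (hg : (nbhd A).card = g)
    (hF₁ : F₁ ⊆ A) (hF₂ : F₂ ⊆ A) :
    (hull t F₁ ∪ hull t F₂).card * d ≤ g * (d - 2 * t) := by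
  have hQ : nbhd F₁ ∪ nbhd F₂ ⊆ nbhd A := union_subset (nbhd_mono hF₁) (nbhd_mono hF₂)
  have hdeg : ∀ u ∈ hull t F₁ ∪ hull t F₂, d ≤ degIn (nbhd F₁ ∪ nbhd F₂) u + t := by
    intro u hu
    rcases mem_union.1 hu with h | h
    · exact (mem_filter.1 h).2.trans (Nat.add_le_add_right (degIn_mono subset_union_left _) _)
    · exact (mem_filter.1 h).2.trans (Nat.add_le_add_right (degIn_mono subset_union_right _) _)
  have h1 := card_le_two_mul_of_degIn hd hdeg ht.le
  have h2 := card_le_card hQ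
  have h3 := (card_nbhd_le A).trans (Nat.mul_le_mul_right d hAk)
  refine (card_mul_le_of_degIn (S := hull t F₁ ∪ hull t F₂) (p := false)
    (union_subset (filter_subset _ _) (filter_subset _ _))
    (fun v hv => ?_) hdeg ht.le (by omega)).trans (Nat.mul_le_mul_right _ (hg ▸ h2))
  exact mem_parityClass.2 (parity_of_mem_nbhd hA (hQ hv))

lemma card_enclosed_le {t k : ℕ} (hd : 1 ≤ d) (ht : 2 * t < d)
    (hk : 3 * (k * d) ≤ 2 ^ (d - 2 * t)) {f : (Fin d → Bool) → Fin 3}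
    (hAk : (defects f false 0).card ≤ k) {c : Fin 3} (hc : c ≠ 0) {G : Finset (Fin d → Bool)}
    (hG : Approximates t G (enclosed f c)) : (enclosed f c).card ≤ (nbhd G).card := by
  have h0 := nbhd_subset_evenClass hG.1
  have h1 := card_le_two_mul_of_degIn hd hG.2 ht.le
  have h2 := card_le_card (h0.trans (evenClass_subset_defects hc))
  have h3 : k ≤ k * d := Nat.le_mul_of_pos_right _ hd
  have h4 := card_mul_le_of_degIn (S := enclosed f c) (p := true) (filter_subset _ _)
    (h0.trans (filter_subset _ _)) hG.2 ht.le (by omega)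
  exact Nat.le_of_mul_le_mul_right (h4.trans (Nat.mul_le_mul_left _ (Nat.sub_le _ _))) hd

lemma card_fibre_mul_le {t k g : ℕ} (hd : 1 ≤ d) (ht : 2 * t < d)
    (hk : 3 * (k * d) ≤ 2 ^ (d - 2 * t)) {F₁ F₂ G₁ G₂ : Finset (Fin d → Bool)}
    {Φ : Finset ((Fin d → Bool) → Fin 3)} (hΦ : Φ ⊆ colourings d)
    (hΦk : ∀ f ∈ Φ, (defects f false 0).card ≤ k)
    (hΦg : ∀ f ∈ Φ, (nbhd (defects f false 0)).card = g)
    (hF₁ : ∀ f ∈ Φ, Approximates t F₁ (evenClass f 1))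
    (hF₂ : ∀ f ∈ Φ, Approximates t F₂ (evenClass f 2))
    (hG₁ : ∀ f ∈ Φ, Approximates t G₁ (enclosed f 1))
    (hG₂ : ∀ f ∈ Φ, Approximates t G₂ (enclosed f 2)) :
    Φ.card * 2 ^ (2 * t * g / d) ≤ 2 ^ 2 ^ (d - 1) := by
  rcases Φ.eq_empty_or_nonempty with rfl | ⟨f₀, hf₀⟩
  · simp
  set S := hull t F₁ ∪ hull t F₂ with hS
  set W := nbhd G₁ ∪ nbhd G₂ with hW
  have n1 : (1 : Fin 3) ≠ 0 := by decide
  have n2 : (2 : Fin 3) ≠ 0 := by decide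
  have hW1 : nbhd G₁ ⊆ evenClass f₀ 1 := nbhd_subset_evenClass (hG₁ _ hf₀).1
  have hW2 : nbhd G₂ ⊆ evenClass f₀ 2 := nbhd_subset_evenClass (hG₂ _ hf₀).1
  have hWS : W ⊆ S := union_subset_union (hW1.trans (evenClass_subset_hull (hF₁ _ hf₀)))
    (hW2.trans (evenClass_subset_hull (hF₂ _ hf₀)))
  have hWcard : W.card = (nbhd G₁).card + (nbhd G₂).card := by
    refine card_union_of_disjoint (disjoint_left.2 fun u h1 h2 => ?_)
    have e1 := (mem_evenClass.1 (hW1 h1)).2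
    have e2 := (mem_evenClass.1 (hW2 h2)).2
    rw [e1] at e2
    exact absurd e2 (by decide)
  have hSd : S.card * d ≤ g * (d - 2 * t) :=
    card_hull_union_mul_le hd ht hk (filter_subset _ _) (hΦk _ hf₀) (hΦg _ hf₀)
      ((hF₁ _ hf₀).1.trans (evenClass_subset_defects n1))
      ((hF₂ _ hf₀).1.trans (evenClass_subset_defects n2))
  have hmixed : ∀ f ∈ Φ, g - W.card ≤ (mixed f).card := by
    intro f hf
    have h1 := card_le_card (nbhd_defects_subset f)
    rw [hΦg f hf] at h1
    have h2 := card_union_le (mixed f) (enclosed f 1 ∪ enclosed f 2)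
    have h3 := card_union_le (enclosed f 1) (enclosed f 2)
    have h4 := card_enclosed_le hd ht hk (hΦk f hf) n1 (hG₁ f hf)
    have h5 := card_enclosed_le hd ht hk (hΦk f hf) n2 (hG₂ f hf)
    omega
  have h1 := card_mul_le_card_image hd hΦ hmixed
  have h2 : (Φ.image evenPart).card ≤ 2 ^ (S \ W).card := card_image_evenPart_le fun f hf =>
    evenPart_mem_options (hΦ hf) ht (hF₁ f hf) (hF₂ f hf) (hG₁ f hf).1 (hG₂ f hf).1
  rw [card_sdiff_of_subset hWS] at h2
  have h3 : S.card + 2 * t * g / d ≤ g := by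
    refine Nat.le_of_mul_le_mul_right ?_ hd
    have e1 : 2 * t * g / d * d ≤ 2 * t * g := Nat.div_mul_le_self _ _
    obtain ⟨e, rfl⟩ : ∃ e, d = 2 * t + e := ⟨d - 2 * t, by omega⟩
    rw [Nat.add_sub_cancel_left] at hSd
    nlinarith
  have h4 := card_le_card hWS
  refine Nat.le_of_mul_le_mul_left (c := 2 ^ (S.card - W.card)) ?_ (by positivity)
  calc 2 ^ (S.card - W.card) * (Φ.card * 2 ^ (2 * t * g / d))
      = Φ.card * 2 ^ (S.card - W.card + 2 * t * g / d) := by rw [pow_add]; ring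
    _ ≤ Φ.card * 2 ^ (g - W.card) :=
        Nat.mul_le_mul_left _ (Nat.pow_le_pow_right two_pos (by omega))
    _ ≤ _ := h1
    _ ≤ _ := Nat.mul_le_mul_right _ h2

lemma exists_approximates (hd : 1 ≤ d) {t g : ℕ} (ht : 0 < t) {f : (Fin d → Bool) → Fin 3}
    (hg : (nbhd (defects f false 0)).card = g) {c : Fin 3} (hc : c ≠ 0) :
    (∃ F, Approximates t F (evenClass f c) ∧ F.card ≤ g / t)
      ∧ ∃ G, Approximates t G (enclosed f c) ∧ G.card ≤ g / t := by
  constructor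
  · obtain ⟨F, h1, h2, h3⟩ := exists_approximation (evenClass f c) t
    refine ⟨F, ⟨h1, h3⟩, (Nat.le_div_iff_mul_le ht).2 (h2.trans (hg ▸ ?_))⟩
    exact card_le_card (nbhd_mono (h1.trans (evenClass_subset_defects hc)))
  · obtain ⟨G, h1, h2, h3⟩ := exists_approximation (enclosed f c) t
    refine ⟨G, ⟨h1, h3⟩, (Nat.le_div_iff_mul_le ht).2 (h2.trans ?_)⟩
    rw [← hg]
    exact (card_le_card ((nbhd_subset_evenClass h1).trans (evenClass_subset_defects hc))).trans
      (card_le_card_nbhd hd _)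

lemma exists_approximating_sets {t k g : ℕ} (ht0 : 0 < t) (ht : 2 * t < d) {x : Fin d → Bool}
    {f : (Fin d → Bool) → Fin 3} (hf : f ∈ clustered k x)
    (hg : (nbhd (defects f false 0)).card = g) :
    ∃ F₁ F₂ G₁ G₂, Approximates t F₁ (evenClass f 1) ∧ Approximates t F₂ (evenClass f 2) ∧
      Approximates t G₁ (enclosed f 1) ∧ Approximates t G₂ (enclosed f 2) ∧
      ∃ S ∈ visited 6 (2 * (4 * (g / t))) x, F₁ ⊆ S ∧ F₂ ⊆ S ∧ G₁ ⊆ S ∧ G₂ ⊆ S := by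
  classical
  have n1 : (1 : Fin 3) ≠ 0 := by decide
  have n2 : (2 : Fin 3) ≠ 0 := by decide
  have hA : IsCluster 2 x (defects f false 0) := by
    simp only [clustered, mem_filter] at hf
    exact hf.2.2
  obtain ⟨⟨F₁, hF₁, cF₁⟩, G₁, hG₁, cG₁⟩ := exists_approximates (by omega) ht0 hg n1
  obtain ⟨⟨F₂, hF₂, cF₂⟩, G₂, hG₂, cG₂⟩ := exists_approximates (by omega) ht0 hg n2
  refine ⟨F₁, F₂, G₁, G₂, hF₁, hF₂, hG₁, hG₂, insert x (F₁ ∪ F₂ ∪ (G₁ ∪ G₂)),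
    IsCluster.mem_visited (IsCluster.of_near hA ?_ ?_) ?_, ?_, ?_, ?_, ?_⟩
  · intro u hu
    rw [defects_zero_eq] at hu
    rcases mem_union.1 hu with h | h
    · obtain ⟨r, hr, hru⟩ := hF₁.exists_mem_ball (by omega) h
      exact ⟨r, by simp [hr], hru⟩
    · obtain ⟨r, hr, hru⟩ := hF₂.exists_mem_ball (by omega) h
      exact ⟨r, by simp [hr], hru⟩
  · have key : ∀ {c : Fin 3} {G : Finset (Fin d → Bool)}, c ≠ 0 → G ⊆ enclosed f c →
        ∀ r ∈ G, ∃ a ∈ defects f false 0, a ∈ ball 1 r := fun hc hG r hr =>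
      ⟨flipAt ⟨0, by omega⟩ r, evenClass_subset_defects hc (nbhd_subset_evenClass hG
        (mem_nbhd.2 ⟨⟨0, by omega⟩, by rwa [flipAt_flipAt]⟩)), flipAt_mem_ball _ _⟩
    intro r hr
    simp only [mem_union] at hr
    rcases hr with (h | h) | (h | h)
    · exact ⟨r, evenClass_subset_defects n1 (hF₁.1 h), mem_ball_self _ _⟩
    · exact ⟨r, evenClass_subset_defects n2 (hF₂.1 h), mem_ball_self _ _⟩
    · exact key n1 hG₁.1 r h
    · exact key n2 hG₂.1 r h
  · refine (card_insert_le _ _).trans ?_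
    have h1 := card_union_le (F₁ ∪ F₂) (G₁ ∪ G₂)
    have h2 := card_union_le F₁ F₂
    have h3 := card_union_le G₁ G₂
    omega
  all_goals
    intro u hu
    simp [hu]

/-- The number of colourings whose defects form a large cluster with a given boundary size. -/
lemma card_clustered_mul_le {t k g : ℕ} (ht0 : 0 < t) (ht : 2 * t < d)
    (hk : 3 * (k * d) ≤ 2 ^ (d - 2 * t)) (x : Fin d → Bool) :
    ((clustered k x).filter fun f => (nbhd (defects f false 0)).card = g).card
        * 2 ^ (2 * t * g / d)
      ≤ (d + 1) ^ (48 * (g / t)) * 2 ^ (4 * (8 * (g / t) + 1)) * 2 ^ 2 ^ (d - 1) := by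
  classical
  set Ψ := (clustered k x).filter fun f => (nbhd (defects f false 0)).card = g with hΨ
  have hmem : ∀ f ∈ Ψ, f ∈ colourings d ∧ (defects f false 0).card ≤ k ∧
      (nbhd (defects f false 0)).card = g := by
    intro f hf
    simp only [hΨ, clustered, mem_filter] at hf
    exact ⟨hf.1.1, hf.1.2.1, hf.2⟩
  have hex : ∀ f, ∃ τ : (Finset (Fin d → Bool) × Finset (Fin d → Bool))
      × (Finset (Fin d → Bool) × Finset (Fin d → Bool)), f ∈ Ψ →
      Approximates t τ.1.1 (evenClass f 1) ∧ Approximates t τ.1.2 (evenClass f 2) ∧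
      Approximates t τ.2.1 (enclosed f 1) ∧ Approximates t τ.2.2 (enclosed f 2) ∧
      ∃ S ∈ visited 6 (2 * (4 * (g / t))) x,
        τ.1.1 ⊆ S ∧ τ.1.2 ⊆ S ∧ τ.2.1 ⊆ S ∧ τ.2.2 ⊆ S := by
    intro f
    by_cases hf : f ∈ Ψ
    · obtain ⟨F₁, F₂, G₁, G₂, h⟩ := exists_approximating_sets ht0 ht (mem_filter.1 hf).1
        (mem_filter.1 hf).2
      exact ⟨((F₁, F₂), (G₁, G₂)), fun _ => h⟩
    · exact ⟨((∅, ∅), (∅, ∅)), fun h => absurd h hf⟩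
  choose τ hτ using hex
  set 𝒯 := (visited 6 (2 * (4 * (g / t))) x).biUnion fun S =>
    (S.powerset ×ˢ S.powerset) ×ˢ (S.powerset ×ˢ S.powerset) with h𝒯
  have hcard : 𝒯.card ≤ (d + 1) ^ (48 * (g / t)) * 2 ^ (4 * (8 * (g / t) + 1)) := by
    refine card_biUnion_le.trans ((sum_le_card_nsmul _ _ (2 ^ (4 * (8 * (g / t) + 1)))
      fun S hS => ?_).trans (Nat.mul_le_mul_right _ ((card_visited_le 6 _ x).trans_eq ?_)))
    · rw [card_product, card_product, card_powerset, ← pow_add, ← pow_add]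
      have := card_le_of_mem_visited hS
      exact Nat.pow_le_pow_right two_pos (by omega)
    · congr 1
      ring
  have hmaps : ∀ f ∈ Ψ, τ f ∈ 𝒯 := by
    intro f hf
    obtain ⟨-, -, -, -, S, hS, h1, h2, h3, h4⟩ := hτ f hf
    exact mem_biUnion.2 ⟨S, hS, by simp [h1, h2, h3, h4]⟩
  rw [card_eq_sum_card_fiberwise hmaps, sum_mul]
  refine (sum_le_card_nsmul _ _ (2 ^ 2 ^ (d - 1)) fun σ _ => ?_).trans
    (Nat.mul_le_mul_right _ hcard)
  refine card_fibre_mul_le (F₁ := σ.1.1) (F₂ := σ.1.2) (G₁ := σ.2.1) (G₂ := σ.2.2) (g := g)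
    (by omega) ht hk (fun f hf => (hmem f (mem_filter.1 hf).1).1)
    (fun f hf => (hmem f (mem_filter.1 hf).1).2.1)
    (fun f hf => (hmem f (mem_filter.1 hf).1).2.2) ?_ ?_ ?_ ?_
  all_goals
    intro f hf
    obtain ⟨hfΨ, rfl⟩ := mem_filter.1 hf
  exacts [(hτ f hfΨ).1, (hτ f hfΨ).2.1, (hτ f hfΨ).2.2.1, (hτ f hfΨ).2.2.2.1]

end Containers

section ClusterBound

variable {d : ℕ}

lemma eventually_mul_pow_le_two_pow (C a : ℕ) {q : ℕ} (hq : 0 < q) :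
    ∀ᶠ d : ℕ in Filter.atTop, C * (d + 1) ^ a ≤ 2 ^ (d / q) := by
  have h1 : Filter.Tendsto (fun n : ℕ => (n : ℝ) ^ a / 2 ^ n) Filter.atTop (nhds 0) :=
    tendsto_pow_const_div_const_pow_of_one_lt a one_lt_two
  have hpos : (0 : ℝ) < 1 / (2 * (C * q ^ a) + 1) := by positivity
  have h2 := h1.eventually_le_const hpos
  have h3 : Filter.Tendsto (fun d : ℕ => d / q + 1) Filter.atTop Filter.atTop :=
    Filter.tendsto_add_atTop_nat 1 |>.comp (Nat.tendsto_div_const_atTop hq.ne')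
  filter_upwards [h3.eventually h2] with d hd
  rw [div_le_div_iff₀ (by positivity) (by positivity)] at hd
  have h4 : d + 1 ≤ q * (d / q + 1) := by
    have := Nat.lt_mul_div_succ d hq
    omega
  have h5 : (d / q + 1) ^ a * (2 * (C * q ^ a) + 1) ≤ 1 * 2 ^ (d / q + 1) := by exact_mod_cast hd
  have h6 : C * (d + 1) ^ a ≤ (d / q + 1) ^ a * (C * q ^ a) := by
    calc C * (d + 1) ^ a ≤ C * (q * (d / q + 1)) ^ a :=
          Nat.mul_le_mul_left _ (Nat.pow_le_pow_left h4 _)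
      _ = _ := by rw [mul_pow]; ring
  rw [pow_succ] at h5
  have h7 : (d / q + 1) ^ a * (2 * (C * q ^ a) + 1)
      = 2 * ((d / q + 1) ^ a * (C * q ^ a)) + (d / q + 1) ^ a := by ring
  omega

lemma card_clustered_of_nbhd_le {k g : ℕ} (hd : 64 ≤ d)
    (hpoly : 2 ^ 32 * (d + 1) ^ 48 ≤ 2 ^ (d / 10240))
    (hk : 3 * (k * d) ≤ 2 ^ (d - 2 * (d / 64))) (hg : 640 * d ≤ g) (x : Fin d → Bool) :
    ((clustered k x).filter fun f => (nbhd (defects f false 0)).card = g).card * 2 ^ (3 * d)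
      ≤ 2 ^ 2 ^ (d - 1) := by
  set t := d / 64 with ht
  have h1 := card_clustered_mul_le (g := g) (by omega) (by omega) hk x
  have h2 : (d + 1) ^ (48 * (g / t)) * 2 ^ (4 * (8 * (g / t) + 1)) ≤ 2 ^ (g / 160 + 4) := by
    calc (d + 1) ^ (48 * (g / t)) * 2 ^ (4 * (8 * (g / t) + 1))
        = (2 ^ 32 * (d + 1) ^ 48) ^ (g / t) * 2 ^ 4 := by
          rw [mul_pow, ← pow_mul, ← pow_mul, mul_add, pow_add, ← mul_assoc 4 8]
          ring
      _ ≤ (2 ^ (d / 10240)) ^ (g / t) * 2 ^ 4 :=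
          Nat.mul_le_mul_right _ (Nat.pow_le_pow_left hpoly _)
      _ ≤ _ := by
          rw [← pow_mul, ← pow_add]
          refine Nat.pow_le_pow_right two_pos (Nat.add_le_add_right ?_ _)
          rw [Nat.le_div_iff_mul_le (by norm_num)]
          have e1 : d / 10240 * 160 ≤ t := by omega
          calc d / 10240 * (g / t) * 160 = (d / 10240 * 160) * (g / t) := by ring
            _ ≤ t * (g / t) := Nat.mul_le_mul_right _ e1
            _ ≤ g := Nat.mul_div_le _ _
  have h3 : g / 64 ≤ 2 * t * g / d := by
    rw [Nat.le_div_iff_mul_le (by omega)]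
    calc g / 64 * d ≤ g / 64 * (128 * t) := Nat.mul_le_mul_left _ (by omega)
      _ = (64 * (g / 64)) * (2 * t) := by ring
      _ ≤ g * (2 * t) := Nat.mul_le_mul_right _ (Nat.mul_div_le _ _)
      _ = _ := by ring
  have h4 : g / 160 + 4 + 3 * d ≤ 2 * t * g / d := by omega
  refine Nat.le_of_mul_le_mul_left (c := 2 ^ (g / 160 + 4)) ?_ (by positivity)
  set L := ((clustered k x).filter fun f => (nbhd (defects f false 0)).card = g).card
  calc 2 ^ (g / 160 + 4) * (L * 2 ^ (3 * d)) = L * 2 ^ (g / 160 + 4 + 3 * d) := by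
        rw [pow_add]; ring
    _ ≤ L * 2 ^ (2 * t * g / d) := Nat.mul_le_mul_left _ (Nat.pow_le_pow_right two_pos h4)
    _ ≤ _ := h1
    _ ≤ _ := Nat.mul_le_mul_right _ h2

lemma card_large_clusters_le {k m : ℕ} (hd : 64 ≤ d)
    (hpoly : 2 ^ 32 * (d + 1) ^ 48 ≤ 2 ^ (d / 10240))
    (hk : 3 * (k * d) ≤ 2 ^ (d - 2 * (d / 64))) (hm : 640 * d + m * m ≤ m * d)
    (x : Fin d → Bool) :
    ((clustered k x).filter fun f => m ≤ (defects f false 0).card).card * 2 ^ (3 * d)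
      ≤ (2 ^ d + 1) * 2 ^ 2 ^ (d - 1) := by
  have hmaps : ∀ f ∈ (clustered k x).filter fun f => m ≤ (defects f false 0).card,
      (nbhd (defects f false 0)).card ∈ range (2 ^ d + 1) := fun f _ => by
    rw [mem_range, Nat.lt_succ_iff]
    simpa using card_le_univ (nbhd (defects f false 0))
  rw [card_eq_sum_card_fiberwise hmaps, sum_mul]
  refine (sum_le_card_nsmul _ _ (2 ^ 2 ^ (d - 1)) fun g _ => ?_).trans_eq (by simp)
  rw [filter_filter]
  rcases lt_or_ge g (640 * d) with hg | hg
  · rw [filter_eq_empty_iff.2 fun f _ hf => ?_]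
    · simp
    · have := mul_le_card_nbhd_add hf.1
      omega
  · refine (Nat.mul_le_mul_right _ (card_le_card ?_)).trans
      (card_clustered_of_nbhd_le hd hpoly hk hg x)
    exact monotone_filter_right _ fun f _ hf => hf.2

lemma card_clustered_le {k m : ℕ} (hd : 64 ≤ d)
    (hpoly : 2 ^ 32 * (d + 1) ^ 48 ≤ 2 ^ (d / 10240))
    (hpoly' : 16 * ((d + 1) ^ (2 * (2 * m)) * (2 ^ (2 * m + 1) * 2 ^ (2 * m + 1))) ≤ 2 ^ (d / 2))
    (hk : 3 * (k * d) ≤ 2 ^ (d - 2 * (d / 64))) (hm : 640 * d + m * m ≤ m * d) (hmd : m + 1 < d)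
    (x : Fin d → Bool) :
    (clustered k x).card * 2 ^ (2 * d)
      ≤ (2 * 2 ^ d + 2 * 2 ^ (d / 2)) * 2 ^ 2 ^ (d - 1) := by
  have h1 := card_singleton_clusters_le (by omega) k x
  have h2 := card_small_clusters_le hmd k x
  have h3 := card_large_clusters_le hd hpoly hk hm x
  set N := 2 ^ 2 ^ (d - 1)
  set L₁ := ((clustered k x).filter fun f => (defects f false 0).card ≤ 1).card
  set L₂ := ((clustered k x).filter fun f =>
    1 < (defects f false 0).card ∧ (defects f false 0).card ≤ m + 1).card
  set L₃ := ((clustered k x).filter fun f => m ≤ (defects f false 0).card).card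
  have h0 : (clustered k x).card ≤ L₁ + (L₂ + L₃) := by
    refine le_trans ?_ ((card_union_le _ _).trans (Nat.add_le_add_left (card_union_le _ _) _))
    refine card_le_card fun f hf => ?_
    simp only [mem_union, mem_filter, hf, true_and]
    omega
  have e1 : L₁ * 2 ^ (2 * d) ≤ 2 * 2 ^ d * N := by
    rw [two_mul d, pow_add]
    nlinarith [Nat.mul_le_mul_right (2 ^ d) h1]
  have e2 : L₂ * 2 ^ (2 * d) ≤ 2 ^ (d / 2) * N := by
    have e : 2 ^ (2 * d) = 2 ^ (2 * d - 4) * 16 := by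
      rw [show (16 : ℕ) = 2 ^ 4 by norm_num, ← pow_add]
      congr 1
      omega
    calc L₂ * 2 ^ (2 * d) = 16 * (L₂ * 2 ^ (2 * d - 4)) := by rw [e]; ring
      _ ≤ 16 * (_ * N) := Nat.mul_le_mul_left _ h2
      _ = (16 * _) * N := (mul_assoc _ _ _).symm
      _ ≤ _ := Nat.mul_le_mul_right _ hpoly'
  have e3 : L₃ * 2 ^ (2 * d) ≤ 2 * N := by
    refine Nat.le_of_mul_le_mul_right (c := 2 ^ d) ?_ (by positivity)
    have e : 2 ^ (3 * d) = 2 ^ (2 * d) * 2 ^ d := by rw [← pow_add]; congr 1; ring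
    rw [e] at h3
    have : 1 ≤ 2 ^ d := Nat.one_le_two_pow
    nlinarith [Nat.mul_le_mul_right N this]
  have e4 : 2 ≤ 2 ^ (d / 2) := Nat.le_self_pow (by omega) 2
  calc (clustered k x).card * 2 ^ (2 * d)
      ≤ (L₁ + (L₂ + L₃)) * 2 ^ (2 * d) := Nat.mul_le_mul_right _ h0
    _ = L₁ * 2 ^ (2 * d) + (L₂ * 2 ^ (2 * d) + L₃ * 2 ^ (2 * d)) := by ring
    _ ≤ 2 * 2 ^ d * N + (2 ^ (d / 2) * N + 2 * N) := add_le_add e1 (add_le_add e2 e3)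
    _ ≤ _ := by nlinarith [Nat.mul_le_mul_right N e4]

/-- The number of colourings close to a given ground state is at most
`e ^ (1 + o(1)) * 2 ^ 2 ^ (d - 1)`. -/
lemma card_nearGround_le {k m : ℕ} (hd : 64 ≤ d)
    (hpoly : 2 ^ 32 * (d + 1) ^ 48 ≤ 2 ^ (d / 10240))
    (hpoly' : 16 * ((d + 1) ^ (2 * (2 * m)) * (2 ^ (2 * m + 1) * 2 ^ (2 * m + 1))) ≤ 2 ^ (d / 2))
    (hk : 3 * (k * d) ≤ 2 ^ (d - 2 * (d / 64))) (hm : 640 * d + m * m ≤ m * d)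
    (hmd : m + 1 < d) :
    ((nearGround d false 0 k).card : ℝ)
      ≤ 2 ^ 2 ^ (d - 1) * Real.exp (1 + 2 ^ (d / 2) / 2 ^ d) := by
  set y : ℝ := (2 * 2 ^ d + 2 * 2 ^ (d / 2)) / 2 ^ (2 * d) with hy
  have hy0 : 0 ≤ y := by positivity
  refine (card_nearGround_le_pow (by omega) k (y := y) fun x => ?_).trans ?_
  · have h : ((clustered k x).card : ℝ) * 2 ^ (2 * d)
        ≤ (2 * 2 ^ d + 2 * 2 ^ (d / 2)) * 2 ^ 2 ^ (d - 1) := by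
      exact_mod_cast card_clustered_le hd hpoly hpoly' hk hm hmd x
    rw [hy, div_mul_eq_mul_div, le_div_iff₀ (by positivity)]
    exact h
  · refine mul_le_mul_of_nonneg_left ?_ (by positivity)
    have h1 : (1 + y) ^ 2 ^ (d - 1) ≤ Real.exp y ^ 2 ^ (d - 1) := by
      refine pow_le_pow_left₀ (by positivity) ?_ _
      rw [add_comm]
      exact Real.add_one_le_exp y
    refine h1.trans_eq ?_
    rw [← Real.exp_nat_mul]
    congr 1
    obtain ⟨e, rfl⟩ : ∃ e, d = e + 1 := ⟨d - 1, by omega⟩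
    rw [hy, Nat.add_sub_cancel, two_mul, pow_add]
    push_cast
    field_simp
    ring

end ClusterBound

section Symmetry

variable {d : ℕ}

lemma card_nearGround_le_recolour (p : Bool) (a b : Fin 3) (k : ℕ) :
    (nearGround d p a k).card ≤ (nearGround d p b k).card := by
  refine card_le_card_of_injOn (fun f w => Equiv.swap a b (f w)) (fun f hf => ?_) ?_
  · rw [mem_coe, nearGround, mem_filter, mem_colourings] at hf ⊢
    refine ⟨fun x i => (Equiv.swap a b).injective.ne (hf.1 x i), le_of_eq_of_le ?_ hf.2⟩
    congr 1
    ext w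
    rw [mem_defects, mem_defects, Ne, Ne, Equiv.swap_apply_eq_iff, Equiv.swap_apply_right]
  · intro f _ g _ h
    funext w
    exact (Equiv.swap a b).injective (congrFun h w)

lemma card_nearGround_le_flip (i : Fin d) (p : Bool) (a : Fin 3) (k : ℕ) :
    (nearGround d p a k).card ≤ (nearGround d (!p) a k).card := by
  refine card_le_card_of_injOn (fun f w => f (flipAt i w)) (fun f hf => ?_) ?_
  · rw [mem_coe, nearGround, mem_filter, mem_colourings] at hf ⊢
    refine ⟨fun x j => ?_, le_trans ?_ hf.2⟩
    · change f (flipAt i (flipAt j x)) ≠ f (flipAt i x)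
      rw [flipAt_comm]
      exact hf.1 _ _
    · refine card_le_card_of_injOn (flipAt i) (fun w hw => ?_) (flipAt_injective i).injOn
      rw [mem_coe, mem_defects] at hw ⊢
      simpa [hw.1] using hw.2
  · intro f _ g _ h
    funext w
    simpa using congrFun h (flipAt i w)

lemma card_nearGround_eq (hd : 1 ≤ d) (p : Bool) (a : Fin 3) (k : ℕ) :
    (nearGround d p a k).card = (nearGround d false 0 k).card := by
  have i : Fin d := ⟨0, hd⟩
  have h1 := card_nearGround_le_flip i p 0 k
  have h2 := card_nearGround_le_flip i (!p) 0 k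
  refine ((card_nearGround_le_recolour p a 0 k).antisymm
    (card_nearGround_le_recolour p 0 a k)).trans ?_
  cases p
  · rfl
  · exact h1.antisymm h2

end Symmetry

/-! ### The lower bound -/

section Weights

variable {d : ℕ}

lemma sum_prod_apply (φ : (Fin d → Bool) → Fin 3 → ℝ) :
    ∑ h : (Fin d → Bool) → Fin 3, ∏ w, φ w (h w) = ∏ w, ∑ c, φ w c := by
  rw [prod_univ_sum, Fintype.piFinset_univ]

/-- The weight of giving colour `c` to `w`, when almost all even vertices have colour `0` and the
odd vertices are irrelevant. -/
noncomputable def siteWeight (w : Fin d → Bool) (c : Fin 3) : ℝ :=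
  if c = 0 then 1 else if parity w = false then (1 / 2) ^ d else 0

lemma siteWeight_nonneg (w : Fin d → Bool) (c : Fin 3) : 0 ≤ siteWeight w c := by
  unfold siteWeight
  split_ifs <;> positivity

/-- The weight of a configuration on the even vertices. -/
noncomputable def weight (h : (Fin d → Bool) → Fin 3) : ℝ := ∏ w, siteWeight w (h w)

lemma weight_nonneg (h : (Fin d → Bool) → Fin 3) : 0 ≤ weight h :=
  prod_nonneg fun w _ => siteWeight_nonneg w _

lemma sum_siteWeight (w : Fin d → Bool) :
    ∑ c, siteWeight w c = if parity w = false then 1 + 2 * (1 / 2) ^ d else 1 := by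
  rw [Fin.sum_univ_three]
  unfold siteWeight
  split_ifs <;> simp_all
  ring

lemma sum_weight (hd : 1 ≤ d) :
    ∑ h : (Fin d → Bool) → Fin 3, weight h = (1 + 2 * (1 / 2) ^ d) ^ 2 ^ (d - 1) := by
  unfold weight
  rw [sum_prod_apply, prod_congr rfl fun w _ => sum_siteWeight w, prod_ite, prod_const,
    prod_const_one, mul_one, ← card_parityClass hd false, parityClass]

lemma sum_weight_filter_le {U : Finset (Fin d → Bool)} (hU : U ⊆ parityClass d false) :
    ∑ h : (Fin d → Bool) → Fin 3, (if ∀ u ∈ U, h u ≠ 0 then weight h else 0)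
      ≤ (2 * (1 / 2) ^ d) ^ U.card * ∑ h : (Fin d → Bool) → Fin 3, weight h := by
  set φ : (Fin d → Bool) → Fin 3 → ℝ := fun w c => if w ∈ U ∧ c = 0 then 0 else siteWeight w c
    with hφ
  have hφ0 : ∀ w c, 0 ≤ φ w c := fun w c => by
    simp only [hφ]
    split_ifs
    exacts [le_rfl, siteWeight_nonneg w c]
  have h1 : ∀ h : (Fin d → Bool) → Fin 3,
      (if ∀ u ∈ U, h u ≠ 0 then weight h else 0) ≤ ∏ w, φ w (h w) := by
    intro h
    split_ifs with hh
    · refine (prod_congr rfl fun w _ => ?_).le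
      simp only [hφ]
      rw [if_neg fun hw => hh w hw.1 hw.2]
    · exact prod_nonneg fun w _ => hφ0 _ _
  refine (sum_le_sum fun h _ => h1 h).trans ?_
  unfold weight
  rw [sum_prod_apply, sum_prod_apply, ← prod_const, ← Fintype.prod_ite_mem U, ← prod_mul_distrib]
  refine prod_le_prod (fun w _ => sum_nonneg fun c _ => hφ0 w c) fun w _ => ?_
  rw [sum_siteWeight]
  split_ifs with hw hp hp
  · have hpos : (0 : ℝ) ≤ (1 / 2) ^ d := by positivity
    rw [Fin.sum_univ_three]
    simp only [hφ, hw, siteWeight, hp, (by decide : (1 : Fin 3) ≠ 0), (by decide : (2 : Fin 3) ≠ 0)]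
    norm_num
    nlinarith
  · exact absurd (mem_parityClass.1 (hU hw)) hp
  · rw [one_mul]
    refine ((sum_congr rfl fun c _ => ?_).trans (sum_siteWeight w)).le.trans_eq (if_pos hp)
    simp [hφ, hw]
  · rw [one_mul]
    refine ((sum_congr rfl fun c _ => ?_).trans (sum_siteWeight w)).le.trans_eq (if_neg hp)
    simp [hφ, hw]

lemma two_pow_le_card_extensions (hd : 1 ≤ d) {h : (Fin d → Bool) → Fin 3}
    (hconf : ∀ v, parity v = true → ∀ i j, i ≠ j → h (flipAt i v) = 0 ∨ h (flipAt j v) = 0) :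
    2 ^ 2 ^ (d - 1) ≤ ((colourings d).filter fun g => ∀ x ∈ parityClass d false, g x = h x).card
      * 2 ^ ((defects h false 0).card * d) := by
  rw [card_extend false h, ← card_parityClass hd true, ← prod_const]
  have h1 : 2 ^ ((parityClass d true).filter fun v => v ∈ nbhd (defects h false 0)).card
      ≤ 2 ^ ((defects h false 0).card * d) := by
    refine Nat.pow_le_pow_right two_pos (le_trans (card_le_card fun v hv => ?_) (card_nbhd_le _))
    exact (mem_filter.1 hv).2
  refine le_trans ?_ (Nat.mul_le_mul_left _ h1)
  rw [← prod_const, prod_filter, Bool.not_false, ← prod_mul_distrib]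
  refine prod_le_prod' fun v hv => ?_
  rw [mem_parityClass] at hv
  split_ifs with hvA
  · obtain ⟨i, hi⟩ := mem_nbhd.1 hvA
    have hi0 := (mem_defects.1 hi).2
    have hsub : palette h univ v ⊆ {h (flipAt i v), 0} := by
      intro c hc
      obtain ⟨j, -, rfl⟩ := mem_palette.1 hc
      rcases eq_or_ne i j with rfl | hij
      · simp
      · simp [(hconf v hv i j hij).resolve_left hi0]
    have := (card_le_card hsub).trans card_le_two
    omega
  · rw [palette_const hd (a := 0) fun i => ?_]
    · simp
    · by_contra h0
      exact hvA (mem_nbhd.2 ⟨i, mem_defects.2 ⟨by simp [hv], h0⟩⟩)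

lemma weight_eq {h : (Fin d → Bool) → Fin 3} (h0 : ∀ w, parity w = true → h w = 0) :
    weight h = ((1 / 2) ^ d) ^ (defects h false 0).card := by
  unfold weight
  rw [← prod_const, ← Fintype.prod_ite_mem (defects h false 0)]
  refine prod_congr rfl fun w _ => ?_
  by_cases hw : h w = 0
  · simp [hw, siteWeight, mem_defects]
  · have : parity w = false := by
      by_contra hp
      exact hw (h0 w (by simpa using hp))
    simp [hw, this, siteWeight, mem_defects]

lemma weight_eq_zero {h : (Fin d → Bool) → Fin 3} {w : Fin d → Bool} (hp : parity w = true)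
    (hw : h w ≠ 0) : weight h = 0 :=
  prod_eq_zero (mem_univ w) (by simp [siteWeight, hw, hp])

/-- The pairs of distinct neighbours of an odd vertex. -/
def cherries (d : ℕ) : Finset ((Fin d → Bool) × (Fin d × Fin d)) :=
  (parityClass d true ×ˢ univ).filter fun s => s.2.1 ≠ s.2.2

lemma weight_mul_le (hd : 1 ≤ d) {k : ℕ} (hk : 0 < k) (h : (Fin d → Bool) → Fin 3) :
    weight h * 2 ^ 2 ^ (d - 1)
      ≤ (((nearGround d false 0 k).filter fun f => evenPart f = h).card : ℝ)
        + (∑ s ∈ cherries d, (if ∀ u ∈ ({flipAt s.2.1 s.1, flipAt s.2.2 s.1} : Finset _), h u ≠ 0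
            then weight h else 0)
          + (∑ u ∈ parityClass d false, if ∀ u' ∈ ({u} : Finset _), h u' ≠ 0
            then weight h else 0) / k) * 2 ^ 2 ^ (d - 1) := by
  have hw0 := weight_nonneg h
  have hnn : ∀ (P : Prop) [Decidable P], 0 ≤ if P then weight h else 0 := fun P _ => by
    split_ifs
    exacts [hw0, le_rfl]
  have hs1 : 0 ≤ ∑ s ∈ cherries d,
      (if ∀ u ∈ ({flipAt s.2.1 s.1, flipAt s.2.2 s.1} : Finset _), h u ≠ 0
        then weight h else 0) := sum_nonneg fun s _ => hnn _
  have hs2 : 0 ≤ (∑ u ∈ parityClass d false, if ∀ u' ∈ ({u} : Finset _), h u' ≠ 0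
      then weight h else 0) / (k : ℝ) := div_nonneg (sum_nonneg fun s _ => hnn _) (by positivity)
  have hc0 : (0 : ℝ) ≤ ((nearGround d false 0 k).filter fun f => evenPart f = h).card := by
    positivity
  have hN : (0 : ℝ) ≤ 2 ^ 2 ^ (d - 1) := by positivity
  by_cases h0 : ∀ w, parity w = true → h w = 0
  swap
  · push Not at h0
    obtain ⟨w, hp, hw⟩ := h0
    rw [weight_eq_zero hp hw, zero_mul]
    rw [weight_eq_zero hp hw] at hs1 hs2
    positivity
  by_cases hA : (defects h false 0).card ≤ k
  swap
  · have h1 : (∑ u ∈ parityClass d false, if ∀ u' ∈ ({u} : Finset _), h u' ≠ 0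
        then weight h else 0) = (defects h false 0).card * weight h := by
      simp only [mem_singleton, forall_eq]
      rw [← sum_filter, sum_const, nsmul_eq_mul]
      rfl
    have h2 : weight h ≤ (defects h false 0).card * weight h / k := by
      rw [le_div_iff₀ (by exact_mod_cast hk), mul_comm]
      exact mul_le_mul_of_nonneg_right (by exact_mod_cast (not_le.1 hA).le) hw0
    rw [h1]
    nlinarith [mul_le_mul_of_nonneg_right h2 hN, mul_nonneg hs1 hN]
  by_cases hconf : ∀ v, parity v = true → ∀ i j, i ≠ j →
      h (flipAt i v) = 0 ∨ h (flipAt j v) = 0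
  swap
  · push Not at hconf
    obtain ⟨v, hv, i, j, hij, hi, hj⟩ := hconf
    have h1 := single_le_sum (fun s _ => hnn (∀ u ∈ ({flipAt s.2.1 s.1, flipAt s.2.2 s.1} :
      Finset (Fin d → Bool)), h u ≠ 0)) (show (v, (i, j)) ∈ cherries d by simp [cherries, hv, hij])
    rw [if_pos (by simp [hi, hj])] at h1
    nlinarith [mul_le_mul_of_nonneg_right h1 hN, mul_nonneg hs2 hN]
  · have h1 := two_pow_le_card_extensions hd hconf
    have h2 : ((colourings d).filter fun g => ∀ x ∈ parityClass d false, g x = h x).card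
        ≤ ((nearGround d false 0 k).filter fun f => evenPart f = h).card := by
      refine card_le_card fun g hg => ?_
      rw [mem_filter] at hg
      simp only [nearGround, mem_filter]
      refine ⟨⟨hg.1, ?_⟩, ?_⟩
      · convert hA using 2
        refine filter_congr fun w hw => ?_
        rw [hg.2 w hw]
      · funext w
        simp only [evenPart]
        split_ifs with hw
        · exact hg.2 w (mem_parityClass.2 hw)
        · exact (h0 w (by simpa using hw)).symm
    have h3 : (2 : ℝ) ^ 2 ^ (d - 1)
        ≤ (((nearGround d false 0 k).filter fun f => evenPart f = h).card : ℝ)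
          * 2 ^ ((defects h false 0).card * d) := by
      exact_mod_cast h1.trans (Nat.mul_le_mul_right _ h2)
    have h4 : weight h * 2 ^ ((defects h false 0).card * d) = 1 := by
      rw [weight_eq h0, ← pow_mul, mul_comm d, ← mul_pow]
      norm_num
    have h5 := mul_le_mul_of_nonneg_left h3 hw0
    rw [mul_left_comm, h4, mul_one] at h5
    have h6 := mul_nonneg (add_nonneg hs1 hs2) hN
    linarith

lemma le_card_nearGround (hd : 1 ≤ d) {k : ℕ} (hk : 0 < k) :
    (1 + 2 * (1 / 2 : ℝ) ^ d) ^ 2 ^ (d - 1) * (1 - 2 * d ^ 2 * (1 / 2) ^ d - 1 / k)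
        * 2 ^ 2 ^ (d - 1)
      ≤ (nearGround d false 0 k).card := by
  have h1 := sum_le_sum fun h (_ : h ∈ (univ : Finset ((Fin d → Bool) → Fin 3))) =>
    weight_mul_le hd hk h
  rw [← sum_mul, sum_add_distrib, ← sum_mul, sum_add_distrib, ← sum_div, sum_comm,
    sum_comm (t := parityClass d false), ← Nat.cast_sum,
    ← card_eq_sum_card_fiberwise fun f _ => mem_univ _] at h1
  have hρ : (2 : ℝ) * (1 / 2) ^ d * 2 ^ (d - 1) = 1 := by
    obtain ⟨e, rfl⟩ : ∃ e, d = e + 1 := ⟨d - 1, by omega⟩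
    rw [Nat.add_sub_cancel, pow_succ]
    have : (1 / 2 : ℝ) ^ e * 2 ^ e = 1 := by rw [← mul_pow]; norm_num
    linear_combination this
  set ρ : ℝ := 2 * (1 / 2) ^ d with hρd
  have hρ0 : 0 ≤ ρ := by positivity
  have h2 : ∑ s ∈ cherries d, ∑ h : (Fin d → Bool) → Fin 3,
      (if ∀ u ∈ ({flipAt s.2.1 s.1, flipAt s.2.2 s.1} : Finset _), h u ≠ 0 then weight h else 0)
      ≤ d ^ 2 * ρ * ∑ h : (Fin d → Bool) → Fin 3, weight h := by
    have hc : ((cherries d).card : ℝ) ≤ 2 ^ (d - 1) * d ^ 2 := by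
      have : (cherries d).card ≤ 2 ^ (d - 1) * d ^ 2 := by
        refine (card_filter_le _ _).trans_eq ?_
        rw [card_product, card_parityClass hd, card_univ, Fintype.card_prod, Fintype.card_fin, sq]
      exact_mod_cast this
    have hW : 0 ≤ ∑ h : (Fin d → Bool) → Fin 3, weight h := sum_nonneg fun h _ => weight_nonneg h
    calc _ ≤ ∑ s ∈ cherries d, ρ ^ 2 * ∑ h : (Fin d → Bool) → Fin 3, weight h := by
          refine sum_le_sum fun s hs => ?_
          simp only [cherries, mem_filter, mem_product, mem_parityClass] at hs
          refine (sum_weight_filter_le ?_).trans_eq ?_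
          · intro u hu
            rw [mem_insert, mem_singleton] at hu
            rcases hu with rfl | rfl <;> simp [hs.1.1]
          · rw [card_pair fun h => hs.2 (flipAt_left_injective _ h)]
      _ = (cherries d).card * (ρ ^ 2 * ∑ h : (Fin d → Bool) → Fin 3, weight h) := by
          rw [sum_const, nsmul_eq_mul]
      _ ≤ 2 ^ (d - 1) * d ^ 2 * (ρ ^ 2 * ∑ h : (Fin d → Bool) → Fin 3, weight h) :=
          mul_le_mul_of_nonneg_right hc (by positivity)
      _ = d ^ 2 * ρ * ∑ h : (Fin d → Bool) → Fin 3, weight h := by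
          linear_combination ((d : ℝ) ^ 2 * ρ * ∑ h : (Fin d → Bool) → Fin 3, weight h) * hρ
  have h3 : ∑ u ∈ parityClass d false, ∑ h : (Fin d → Bool) → Fin 3,
      (if ∀ u' ∈ ({u} : Finset _), h u' ≠ 0 then weight h else 0)
      ≤ ∑ h : (Fin d → Bool) → Fin 3, weight h := by
    calc _ ≤ ∑ u ∈ parityClass d false, ρ * ∑ h : (Fin d → Bool) → Fin 3, weight h := by
          refine sum_le_sum fun u hu => ?_
          refine (sum_weight_filter_le (singleton_subset_iff.2 hu)).trans_eq ?_
          rw [card_singleton, pow_one]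
      _ = _ := by
          rw [sum_const, nsmul_eq_mul, card_parityClass hd]
          push_cast
          linear_combination (∑ h : (Fin d → Bool) → Fin 3, weight h) * hρ
  rw [sum_weight hd] at h1 h2 h3
  have h4 := div_le_div_of_nonneg_right h3 (Nat.cast_nonneg k)
  have h5 := mul_le_mul_of_nonneg_right (add_le_add h2 h4)
    (by positivity : (0 : ℝ) ≤ 2 ^ 2 ^ (d - 1))
  refine le_of_eq_of_le ?_ (sub_le_iff_le_add.2 (h1.trans (add_le_add_right h5 _)))
  rw [hρd]
  ring

end Weights

/-! ### The total count -/

section Overlap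

variable {d : ℕ}

lemma card_nearGround_inter_le (a b : Fin 3) (k : ℕ) :
    ((nearGround d false a k ∩ nearGround d true b k).card : ℝ)
      ≤ 16 ^ (2 * k) * (9 / 8) ^ 2 ^ d := by
  set g : (Fin d → Bool) → Fin 3 := fun w => if parity w = false then a else b with hg
  set φ : (Fin d → Bool) → Fin 3 → ℝ := fun w c => if c ≠ g w then 1 / 16 else 1 with hφ
  have hφ0 : ∀ w c, 0 ≤ φ w c := fun w c => by
    simp only [hφ]
    split_ifs <;> norm_num
  have h1 : ∀ f ∈ nearGround d false a k ∩ nearGround d true b k,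
      (1 / 16 : ℝ) ^ (2 * k) ≤ ∏ w, φ w (f w) := by
    intro f hf
    simp only [nearGround, mem_inter, mem_filter] at hf
    rw [← prod_filter, prod_const]
    refine pow_le_pow_of_le_one (by norm_num) (by norm_num) ?_
    refine (card_le_card (t := defects f false a ∪ defects f true b) fun w hw => ?_).trans
      ((card_union_le _ _).trans (by omega))
    rw [mem_filter] at hw
    rw [mem_union, mem_defects, mem_defects]
    have := hw.2
    simp only [hg] at this
    split_ifs at this with hp
    · exact Or.inl ⟨hp, this⟩
    · exact Or.inr ⟨by simpa using hp, this⟩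
  have h2 := card_nsmul_le_sum _ _ _ h1
  have h3 : ∑ h : (Fin d → Bool) → Fin 3, ∏ w, φ w (h w) = (9 / 8) ^ 2 ^ d := by
    rw [sum_prod_apply, prod_congr rfl (g := fun _ => (9 / 8 : ℝ)), prod_const, card_univ]
    · simp
    · intro w _
      simp only [hφ]
      generalize g w = c
      rw [Fin.sum_univ_three]
      fin_cases c <;> norm_num [Fin.ext_iff]
  have h4 := h2.trans (sum_le_univ_sum_of_nonneg fun h => prod_nonneg fun w _ => hφ0 w (h w))
  rw [h3, nsmul_eq_mul, one_div, inv_pow, ← div_eq_mul_inv, div_le_iff₀ (by positivity)] at h4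
  linarith

lemma disjoint_nearGround (hd : 1 ≤ d) (p : Bool) {a b : Fin 3} (hab : a ≠ b) {k : ℕ}
    (hk : 2 * k < 2 ^ (d - 1)) : Disjoint (nearGround d p a k) (nearGround d p b k) := by
  rw [disjoint_left]
  intro f ha hb
  simp only [nearGround, mem_filter] at ha hb
  have h1 : (parityClass d p).card ≤ (defects f p a ∪ defects f p b).card := by
    refine card_le_card fun w hw => ?_
    rw [mem_parityClass] at hw
    rw [mem_union, mem_defects, mem_defects]
    by_cases h : f w = a
    · exact Or.inr ⟨hw, h ▸ hab⟩
    · exact Or.inl ⟨hw, h⟩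
  rw [card_parityClass hd] at h1
  have h2 := h1.trans (card_union_le _ _)
  omega

lemma six_mul_card_nearGround_le (hd : 1 ≤ d) {k : ℕ} (hk : 2 * k < 2 ^ (d - 1)) :
    6 * ((nearGround d false 0 k).card : ℝ)
      ≤ (colourings d).card + 9 * (16 ^ (2 * k) * (9 / 8) ^ 2 ^ d) := by
  set A : Bool → Finset ((Fin d → Bool) → Fin 3) :=
    fun p => univ.biUnion fun a => nearGround d p a k with hA
  have h1 : ∀ p, (A p).card = 3 * (nearGround d false 0 k).card := fun p => by
    rw [hA, card_biUnion fun a _ b _ hab => disjoint_nearGround hd p hab hk,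
      sum_congr rfl fun a _ => card_nearGround_eq hd p a k]
    simp
  have h2 : (A false ∪ A true).card ≤ (colourings d).card := by
    refine card_le_card fun f hf => ?_
    simp only [hA, mem_union, mem_biUnion, nearGround, mem_filter] at hf
    obtain ⟨_, _, h, _⟩ | ⟨_, _, h, _⟩ := hf <;> exact h
  have h3 : ((A false ∩ A true).card : ℝ) ≤ 9 * (16 ^ (2 * k) * (9 / 8) ^ 2 ^ d) := by
    have h4 : A false ∩ A true ⊆ (univ : Finset (Fin 3 × Fin 3)).biUnion
        fun c => nearGround d false c.1 k ∩ nearGround d true c.2 k := by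
      intro f hf
      simp only [hA, mem_inter, mem_biUnion, mem_univ, true_and] at hf
      obtain ⟨⟨a, ha⟩, b, hb⟩ := hf
      exact mem_biUnion.2 ⟨(a, b), mem_univ _, mem_inter.2 ⟨ha, hb⟩⟩
    have h5 := (card_le_card h4).trans card_biUnion_le
    calc ((A false ∩ A true).card : ℝ)
        ≤ ∑ c : Fin 3 × Fin 3,
          ((nearGround d false c.1 k ∩ nearGround d true c.2 k).card : ℝ) := by exact_mod_cast h5
      _ ≤ ∑ _c : Fin 3 × Fin 3, (16 ^ (2 * k) * (9 / 8) ^ 2 ^ d : ℝ) :=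
          sum_le_sum fun c _ => card_nearGround_inter_le _ _ _
      _ = _ := by
          rw [sum_const, nsmul_eq_mul, card_univ, Fintype.card_prod, Fintype.card_fin]
          norm_num
  have h4 := card_union_add_card_inter (A false) (A true)
  rw [h1, h1] at h4
  have h5 : ((A false ∪ A true).card : ℝ) + (A false ∩ A true).card
      = 6 * (nearGround d false 0 k).card := by
    rw [← Nat.cast_add, h4]
    push_cast
    ring
  have h6 : ((A false ∪ A true).card : ℝ) ≤ (colourings d).card := by exact_mod_cast h2
  linarith

lemma card_colourings_le_six_mul (hd : 1 ≤ d) (k : ℕ) :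
    ((colourings d).card : ℝ) ≤ 6 * (nearGround d false 0 k).card
      + count d fun f => ∀ p a, f ∉ nearGround d p a k := by
  classical
  rw [count_eq_card]
  have h1 : colourings d ⊆ ((univ : Finset (Bool × Fin 3)).biUnion fun s => nearGround d s.1 s.2 k)
      ∪ (colourings d).filter fun f => ∀ p a, f ∉ nearGround d p a k := by
    intro f hf
    rw [mem_union, mem_biUnion, mem_filter]
    by_cases h : ∀ p a, f ∉ nearGround d p a k
    · exact Or.inr ⟨hf, h⟩
    · push Not at h
      obtain ⟨p, a, h⟩ := h
      exact Or.inl ⟨(p, a), mem_univ _, h⟩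
  have h2 := (card_le_card h1).trans ((card_union_le _ _).trans
    (Nat.add_le_add_right card_biUnion_le _))
  rw [sum_congr rfl fun s _ => card_nearGround_eq hd s.1 s.2 k, sum_const, card_univ,
    Fintype.card_prod, Fintype.card_bool, Fintype.card_fin, smul_eq_mul] at h2
  exact_mod_cast h2

end Overlap

section Asymptotics

variable {d : ℕ}

lemma half_pow_le_of_le {a b c n : ℕ} {x : ℝ} (hx : x ≤ 2 ^ a) (h : a + b + c ≤ n) :
    x * 2 ^ b * (1 / 2 : ℝ) ^ n ≤ (1 / 2) ^ c := by
  obtain ⟨e, rfl⟩ := Nat.exists_eq_add_of_le h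
  have h1 : (2 : ℝ) ^ a * (1 / 2) ^ a = 1 := by rw [← mul_pow]; norm_num
  have h2 : (2 : ℝ) ^ b * (1 / 2) ^ b = 1 := by rw [← mul_pow]; norm_num
  have h3 : (1 / 2 : ℝ) ^ e ≤ 1 := pow_le_one₀ (by norm_num) (by norm_num)
  calc x * 2 ^ b * (1 / 2 : ℝ) ^ (a + b + c + e)
      ≤ 2 ^ a * 2 ^ b * (1 / 2 : ℝ) ^ (a + b + c + e) := by gcongr
    _ = (2 ^ a * (1 / 2) ^ a) * (2 ^ b * (1 / 2) ^ b) * (1 / 2 : ℝ) ^ c * (1 / 2) ^ e := by ring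
    _ ≤ (1 / 2) ^ c := by
        rw [h1, h2, one_mul, one_mul]
        exact mul_le_of_le_one_right (by positivity) h3

lemma exp_one_mul_le_pow {n : ℕ} {ρ : ℝ} (hρ : 0 ≤ ρ) (h : n * ρ = 1) :
    Real.exp 1 * (1 - ρ) ≤ (1 + ρ) ^ n := by
  have h1 := Real.one_sub_inv_le_log_of_pos (by linarith : 0 < 1 + ρ)
  have h2 : 1 - ρ ≤ n * (1 - (1 + ρ)⁻¹) := by
    have h3 : n * (1 - (1 + ρ)⁻¹) = (1 + ρ)⁻¹ := by
      field_simp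
      linear_combination h
    rw [h3, ← one_div, le_div_iff₀ (by linarith)]
    nlinarith [sq_nonneg ρ]
  have h4 : Real.exp (1 + -ρ) ≤ (1 + ρ) ^ n := by
    rw [← Real.exp_log (by linarith : 0 < 1 + ρ), ← Real.exp_nat_mul]
    exact Real.exp_le_exp.2
      (by nlinarith [mul_le_mul_of_nonneg_left h1 (Nat.cast_nonneg' (α := ℝ) n)])
  refine le_trans ?_ h4
  rw [Real.exp_add]
  have := Real.add_one_le_exp (-ρ)
  exact mul_le_mul_of_nonneg_left (by linarith) (Real.exp_pos 1).le

lemma overlap_le (hd : 1000 ≤ d) :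
    (16 : ℝ) ^ (2 * 2 ^ (d - d / 20)) * (9 / 8) ^ 2 ^ d ≤ 2 ^ 2 ^ (d - 1) * (1 / 2) ^ (d / 20) := by
  obtain ⟨e, rfl⟩ : ∃ e, d = e + 6 := ⟨d - 6, by omega⟩
  have h1 : 2 ^ (e + 6 - (e + 6) / 20) ≤ 2 ^ e := Nat.pow_le_pow_right two_pos (by omega)
  have h2 : e < 2 ^ e := e.lt_two_pow_self
  have h3 : (9 / 8 : ℝ) ^ 2 ^ (e + 6) ≤ 2 ^ (2 ^ e * 16) := by
    rw [show 2 ^ (e + 6) = 4 * (2 ^ e * 16) by ring, pow_mul]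
    exact pow_le_pow_left₀ (by positivity) (by norm_num) _
  have h4 : (16 : ℝ) ^ (2 * 2 ^ (e + 6 - (e + 6) / 20)) ≤ 2 ^ (8 * 2 ^ e) := by
    rw [show (16 : ℝ) = 2 ^ 4 by norm_num, ← pow_mul]
    exact pow_le_pow_right₀ one_le_two (by omega)
  calc (16 : ℝ) ^ (2 * 2 ^ (e + 6 - (e + 6) / 20)) * (9 / 8) ^ 2 ^ (e + 6)
      ≤ 2 ^ (8 * 2 ^ e) * 2 ^ (2 ^ e * 16) := mul_le_mul h4 h3 (by positivity) (by positivity)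
    _ = 2 ^ (24 * 2 ^ e) := by ring
    _ ≤ 2 ^ (2 ^ (e + 6 - 1) - (e + 6) / 20) := by
        refine pow_le_pow_right₀ one_le_two ?_
        rw [show e + 6 - 1 = e + 5 by omega, pow_add]
        omega
    _ = _ := by
        rw [one_div, inv_pow, ← div_eq_mul_inv, pow_sub₀ _ two_ne_zero, div_eq_mul_inv]
        rw [show e + 6 - 1 = e + 5 by omega, pow_add]
        omega

lemma le_card_colourings (hd : 1000 ≤ d) (hpoly : 2 * (d + 1) ^ 2 ≤ 2 ^ (d / 80)) :
    6 * Real.exp 1 * 2 ^ 2 ^ (d - 1) * (1 - 3 * (1 / 2) ^ (d / 20))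
      ≤ (colourings d).card + 9 * (2 ^ 2 ^ (d - 1) * (1 / 2) ^ (d / 20)) := by
  have hk : 2 * 2 ^ (d - d / 20) < 2 ^ (d - 1) := by
    rw [← pow_succ']
    exact Nat.pow_lt_pow_right one_lt_two (by omega)
  have h1 := six_mul_card_nearGround_le (by omega) hk
  have h2 := le_card_nearGround (d := d) (by omega) (Nat.two_pow_pos (d - d / 20))
  have h3 := overlap_le hd
  set δ : ℝ := (1 / 2) ^ (d / 20) with hδ
  have hδ1 : δ ≤ 1 / 8 := by
    rw [hδ, show (1 / 8 : ℝ) = (1 / 2) ^ 3 by norm_num]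
    exact pow_le_pow_of_le_one (by norm_num) (by norm_num) (by omega)
  have hδ0 : 0 < δ := by positivity
  have hpoly' : 2 * ((d : ℝ) + 1) ^ 2 ≤ 2 ^ (d / 80) := by exact_mod_cast hpoly
  have hd0 : (0 : ℝ) ≤ d := d.cast_nonneg
  have h4 : 2 * (d : ℝ) ^ 2 * (1 / 2) ^ d ≤ δ := by
    have := half_pow_le_of_le (x := 2 * (d : ℝ) ^ 2) (a := d / 80) (b := 0) (c := d / 20) (n := d)
      (by nlinarith) (by omega)
    rwa [pow_zero, mul_one] at this
  have h5 : 2 * (1 / 2 : ℝ) ^ d ≤ δ := by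
    have := half_pow_le_of_le (x := 2) (a := 1) (b := 0) (c := d / 20) (n := d)
      (by norm_num) (by omega)
    rwa [pow_zero, mul_one] at this
  have h6 : (1 : ℝ) / ((2 ^ (d - d / 20) : ℕ) : ℝ) ≤ δ := by
    rw [Nat.cast_pow, Nat.cast_ofNat, ← one_div_pow]
    exact pow_le_pow_of_le_one (by norm_num) (by norm_num) (by omega)
  have h7 : ((2 ^ (d - 1) : ℕ) : ℝ) * (2 * (1 / 2 : ℝ) ^ d) = 1 := by
    obtain ⟨e, rfl⟩ : ∃ e, d = e + 1 := ⟨d - 1, by omega⟩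
    rw [Nat.add_sub_cancel, pow_succ, Nat.cast_pow, Nat.cast_ofNat]
    have : (1 / 2 : ℝ) ^ e * 2 ^ e = 1 := by rw [← mul_pow]; norm_num
    linear_combination this
  have h8 := exp_one_mul_le_pow (by positivity) h7
  set W : ℝ := 2 ^ 2 ^ (d - 1) with hW
  have hW0 : 0 < W := by positivity
  set y : ℝ := 1 - 2 * d ^ 2 * (1 / 2) ^ d - 1 / ((2 ^ (d - d / 20) : ℕ) : ℝ) with hy
  have hy1 : 1 - 2 * δ ≤ y := by linarith
  have h9 : Real.exp 1 * (1 - 3 * δ) ≤ (1 + 2 * (1 / 2 : ℝ) ^ d) ^ 2 ^ (d - 1) * y := by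
    refine le_trans ?_ (mul_le_mul h8 hy1 (by linarith) (by positivity))
    rw [mul_assoc]
    refine mul_le_mul_of_nonneg_left ?_ (Real.exp_pos 1).le
    nlinarith
  have h10 := mul_le_mul_of_nonneg_right h9 hW0.le
  linarith

lemma count_not_nearGround_le (hd : 1000 ≤ d) {C : ℕ} (hC : C = 32 * (2 ^ 65 + 1))
    (hpoly : C * (d + 1) ^ 2 ≤ 2 ^ (d / 80)) :
    count d (fun f => ∀ p a, f ∉ nearGround d p a (2 ^ (d - d / 20)))
      ≤ (1 / 2) ^ (d / 20) * (colourings d).card := by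
  set T : ℝ := ((colourings d).card : ℝ) with hT
  have hT0 : 0 ≤ T := Nat.cast_nonneg _
  have hd0 : (0 : ℝ) ≤ d := d.cast_nonneg
  have hq : ∀ (v : Fin d → Bool) (i k : Fin d), i ≠ k →
      count d (fun f => palette f univ v ≠ palette f univ (flipAt i (flipAt k v)))
        ≤ C * (d + 1) * (1 / 2) ^ (d / 8) * T := by
    intro v i k hik
    refine (count_palette_ne_le (by omega) hik v).trans (mul_le_mul_of_nonneg_right ?_ hT0)
    have h1 : (1 / 2 : ℝ) ^ d ≤ (1 / 2) ^ (d / 8) :=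
      pow_le_pow_of_le_one (by norm_num) (by norm_num) (Nat.div_le_self _ _)
    have h2 : (0 : ℝ) ≤ (1 / 2) ^ (d / 8) := by positivity
    have hC' : (C : ℝ) = 32 * (2 ^ 65 + 1) := by rw [hC]; norm_num
    have key : ∀ (M x y : ℝ), 0 ≤ M → x ≤ y → 0 ≤ y →
        32 * (M * x + d * y) ≤ 32 * (M + 1) * (d + 1) * y := by
      intro M x y hM hxy hy
      nlinarith [mul_le_mul_of_nonneg_left hxy hM, mul_nonneg (mul_nonneg hM hd0) hy]
    rw [hC']
    exact key _ _ _ (by positivity) h1 h2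
  have h1 := mul_count_not_nearGround_le (by omega) (by positivity) hq (2 ^ (d - d / 20))
  set B := count d (fun f => ∀ p a, f ∉ nearGround d p a (2 ^ (d - d / 20)))
  have hk0 : (0 : ℝ) < 2 ^ (d - d / 20) := by positivity
  rw [Nat.cast_pow, Nat.cast_ofNat] at h1
  refine le_of_mul_le_mul_left (h1.trans ?_) hk0
  have hpoly' : (C : ℝ) * ((d : ℝ) + 1) ^ 2 ≤ 2 ^ (d / 80) := by exact_mod_cast hpoly
  have hx : d * (C * ((d : ℝ) + 1)) ≤ 2 ^ (d / 80) := by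
    refine le_trans ?_ hpoly'
    nlinarith [mul_nonneg (Nat.cast_nonneg' (α := ℝ) C) (by linarith : (0 : ℝ) ≤ d + 1)]
  have h2 := half_pow_le_of_le (b := d / 20) (c := d / 20) (n := d / 8) hx (by omega)
  have h3 : (2 : ℝ) ^ (d - 1) ≤ 2 ^ (d - d / 20) * 2 ^ (d / 20) := by
    rw [← pow_add]
    exact pow_le_pow_right₀ one_le_two (by omega)
  calc (2 : ℝ) ^ (d - 1) * (d * (C * (d + 1) * (1 / 2) ^ (d / 8) * T))
      ≤ 2 ^ (d - d / 20) * 2 ^ (d / 20) * (d * (C * (d + 1) * (1 / 2) ^ (d / 8) * T)) :=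
        mul_le_mul_of_nonneg_right h3 (by positivity)
    _ = 2 ^ (d - d / 20) * (d * (C * (d + 1)) * 2 ^ (d / 20) * (1 / 2) ^ (d / 8) * T) := by ring
    _ ≤ 2 ^ (d - d / 20) * ((1 / 2) ^ (d / 20) * T) := by gcongr

lemma card_colourings_le (hd : 1000 ≤ d) {C m : ℕ} (hC : C = 32 * (2 ^ 65 + 1))
    (hpoly : C * (d + 1) ^ 2 ≤ 2 ^ (d / 80)) (hpoly₁ : 2 ^ 32 * (d + 1) ^ 48 ≤ 2 ^ (d / 10240))
    (hpoly₂ : 16 * ((d + 1) ^ (2 * (2 * m)) * (2 ^ (2 * m + 1) * 2 ^ (2 * m + 1))) ≤ 2 ^ (d / 2))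
    (hm : 640 * d + m * m ≤ m * d) (hmd : m + 1 < d) :
    (colourings d).card * (1 - 2 * (1 / 2 : ℝ) ^ (d / 20)) ≤ 6 * Real.exp 1 * 2 ^ 2 ^ (d - 1) := by
  have hC3 : 3 ≤ C := by rw [hC]; norm_num
  have hk : 3 * (2 ^ (d - d / 20) * d) ≤ 2 ^ (d - 2 * (d / 64)) := by
    have h1 : 3 * d ≤ 2 ^ (d / 80) := by
      refine le_trans (Nat.mul_le_mul hC3 ?_) hpoly
      nlinarith
    calc 3 * (2 ^ (d - d / 20) * d) = 3 * d * 2 ^ (d - d / 20) := by ring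
      _ ≤ 2 ^ (d / 80) * 2 ^ (d - d / 20) := Nat.mul_le_mul_right _ h1
      _ ≤ _ := by
        rw [← pow_add]
        exact Nat.pow_le_pow_right two_pos (by omega)
  have h1 := card_nearGround_le (by omega) hpoly₁ hpoly₂ hk hm hmd
  have h2 := card_colourings_le_six_mul (d := d) (by omega) (2 ^ (d - d / 20))
  have h3 := count_not_nearGround_le hd hC hpoly
  set T : ℝ := ((colourings d).card : ℝ) with hT
  have hT0 : 0 ≤ T := Nat.cast_nonneg _
  set δ : ℝ := (1 / 2) ^ (d / 20) with hδ
  set ε : ℝ := 2 ^ (d / 2) / 2 ^ d with hε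
  set W : ℝ := 2 ^ 2 ^ (d - 1) with hW
  have hδ1 : δ ≤ 1 / 8 := by
    rw [hδ, show (1 / 8 : ℝ) = (1 / 2) ^ 3 by norm_num]
    exact pow_le_pow_of_le_one (by norm_num) (by norm_num) (by omega)
  have hδ0 : 0 < δ := by positivity
  have hεδ : ε ≤ δ := by
    have := half_pow_le_of_le (x := 1) (a := 0) (b := d / 2) (c := d / 20) (n := d)
      (by norm_num) (by omega)
    rwa [one_mul, one_div_pow 2 d, mul_one_div] at this
  have h4 : Real.exp ε * (1 - δ) ≤ 1 := by
    have h5 := Real.add_one_le_exp (-ε)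
    have h6 : Real.exp ε * Real.exp (-ε) = 1 := by rw [← Real.exp_add]; simp
    rw [← h6]
    exact mul_le_mul_of_nonneg_left (by linarith) (Real.exp_pos ε).le
  rw [Real.exp_add] at h1
  have h5 : T * (1 - δ) ≤ 6 * Real.exp 1 * W * Real.exp ε := by linarith
  have h6 := mul_le_mul_of_nonneg_right h5 (by linarith : 0 ≤ 1 - δ)
  have h7 := mul_le_mul_of_nonneg_left h4 (by positivity : 0 ≤ 6 * Real.exp 1 * W)
  nlinarith [mul_nonneg hT0 (sq_nonneg δ)]

lemma seventy_two_mul_le_exp (hd : 1000 ≤ d) :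
    72 * (1 / 2 : ℝ) ^ (d / 20) ≤ Real.exp (-(1 / 100) * d) := by
  obtain ⟨e, he⟩ : ∃ e, d / 20 = e + 12 := ⟨d / 20 - 12, by omega⟩
  have h1 : (d : ℝ) ≤ 20 * ((e + 12 + 1 : ℕ) : ℝ) := by exact_mod_cast (by omega)
  have h2 : (4 / 5 : ℝ) ^ (e + 12 + 1) ≤ Real.exp (-(1 / 100) * d) := by
    calc (4 / 5 : ℝ) ^ (e + 12 + 1) ≤ Real.exp (-(1 / 5)) ^ (e + 12 + 1) := by
          refine pow_le_pow_left₀ (by norm_num) ?_ _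
          have := Real.add_one_le_exp (-(1 / 5) : ℝ)
          linarith
      _ = Real.exp ((e + 12 + 1 : ℕ) * (-(1 / 5))) := by rw [Real.exp_nat_mul]
      _ ≤ _ := Real.exp_le_exp.2 (by linarith)
  refine le_trans ?_ h2
  rw [he]
  have h3 : (1 / 2 : ℝ) ^ e ≤ (4 / 5) ^ e := pow_le_pow_left₀ (by norm_num) (by norm_num) _
  rw [pow_add, pow_add, pow_add]
  have h4 : (0 : ℝ) ≤ (4 / 5) ^ e := by positivity
  norm_num
  linarith

lemma abs_card_colourings_sub_le (hd : 1000 ≤ d) {C m : ℕ} (hC : C = 32 * (2 ^ 65 + 1))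
    (hpoly : C * (d + 1) ^ 2 ≤ 2 ^ (d / 80)) (hpoly₁ : 2 ^ 32 * (d + 1) ^ 48 ≤ 2 ^ (d / 10240))
    (hpoly₂ : 16 * ((d + 1) ^ (2 * (2 * m)) * (2 ^ (2 * m + 1) * 2 ^ (2 * m + 1))) ≤ 2 ^ (d / 2))
    (hm : 640 * d + m * m ≤ m * d) (hmd : m + 1 < d) :
    |((colourings d).card : ℝ) - 6 * Real.exp 1 * 2 ^ 2 ^ (d - 1)|
      ≤ 72 * (1 / 2) ^ (d / 20) * 2 ^ 2 ^ (d - 1) := by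
  have hC2 : 2 ≤ C := by rw [hC]; norm_num
  have h1 := le_card_colourings hd ((Nat.mul_le_mul_right _ hC2).trans hpoly)
  have h2 := card_colourings_le hd hC hpoly hpoly₁ hpoly₂ hm hmd
  set T : ℝ := ((colourings d).card : ℝ) with hT
  have hT0 : 0 ≤ T := Nat.cast_nonneg _
  set δ : ℝ := (1 / 2) ^ (d / 20) with hδ
  set W : ℝ := 2 ^ 2 ^ (d - 1) with hW
  have hδ1 : δ ≤ 1 / 8 := by
    rw [hδ, show (1 / 8 : ℝ) = (1 / 2) ^ 3 by norm_num]
    exact pow_le_pow_of_le_one (by norm_num) (by norm_num) (by omega)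
  have hδ0 : 0 < δ := by positivity
  have hW0 : 0 < W := by positivity
  have he : Real.exp 1 < 3 := Real.exp_one_lt_d9.trans (by norm_num)
  have h3 := mul_lt_mul_of_pos_right he (mul_pos hδ0 hW0)
  rw [abs_le]
  constructor
  · nlinarith [mul_pos hδ0 hW0]
  · have h4 : T ≤ 8 * Real.exp 1 * W := by
      nlinarith [mul_le_mul_of_nonneg_left hδ1 hT0]
    nlinarith [mul_le_mul_of_nonneg_right h4 hδ0.le]

end Asymptotics

end HammingCube

theorem count_three_colourings :
    ∃ c > (0:ℝ), ∃ d₀ : ℕ, ∀ d : ℕ, d₀ ≤ d →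
      |((Col3 d).ncard : ℝ) - 6 * Real.exp 1 * 2 ^ 2 ^ (d - 1)| ≤
        Real.exp (-c * d) * 2 ^ 2 ^ (d - 1) := by
  obtain ⟨C, hC⟩ : ∃ C, C = 32 * (2 ^ 65 + 1) := ⟨_, rfl⟩
  obtain ⟨m, hm⟩ : ∃ m, m = 700 := ⟨_, rfl⟩
  obtain ⟨d₀, hd₀⟩ := Filter.eventually_atTop.1
    ((HammingCube.eventually_mul_pow_le_two_pow C 2 (by norm_num : 0 < 80)).and
      ((HammingCube.eventually_mul_pow_le_two_pow (2 ^ 32) 48 (by norm_num : 0 < 10240)).and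
        (HammingCube.eventually_mul_pow_le_two_pow (16 * (2 ^ (2 * m + 1) * 2 ^ (2 * m + 1)))
          (2 * (2 * m)) two_pos)))
  refine ⟨1 / 100, by norm_num, max d₀ 10000, fun d hd => ?_⟩
  have hd' : 10000 ≤ d := (le_max_right _ _).trans hd
  obtain ⟨h1, h2, h3⟩ := hd₀ d ((le_max_left _ _).trans hd)
  rw [HammingCube.ncard_Col3]
  refine (HammingCube.abs_card_colourings_sub_le (m := m) (by omega) hC h1 h2
    (le_of_eq_of_le (by ring) h3) (by subst hm; omega) (by omega)).trans ?_
  exact mul_le_mul_of_nonneg_right (HammingCube.seventy_two_mul_le_exp (by omega)) (by positivity)
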